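/- arXiv:0803.1890 — 3 statements merged into one kernel-verified Lean document; each statement's English description precedes it below -/
import Mathlib

section
/- Condition NA1_s holds if and only if, for every T ∈ [0,∞), the set {X_T : X ∈ 𝒳_s(1)} is bounded in probability, i.e., lim_{ℓ→∞} sup_{X ∈ 𝒳_s(1)} P[X_T > ℓ] = 0 holds for all T ∈ [0,∞). -/
open MeasureTheory Set Filter
open scoped NNReal ENNReal Topology

noncomputable section

/-- A property of a path: right-continuous with left limits (càdlàg). -/
def IsCadlag {E : Type*} [TopologicalSpace E] (f : ℝ≥0 → E) : Prop :=
  (∀ t : ℝ≥0, ContinuousWithinAt f (Set.Ici t) t) ∧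
    ∀ t : ℝ≥0, 0 < t → ∃ l : E, Filter.Tendsto f (nhdsWithin t (Set.Iio t)) (nhds l)

/-- The `d`-dimensional simplex. -/
def stdSimplexSet (d : ℕ) : Set (Fin d → ℝ) :=
  {z | (∀ i, 0 ≤ z i) ∧ ∑ i, z i ≤ 1}

variable {Ω : Type*} {m : MeasurableSpace Ω}

/-- A simple predictable strategy: finitely many trading times `τ 0 = 0 ≤ τ 1 ≤ … ≤ τ n`
(finite stopping times), where the (random) vector `ϑ j` of numbers of units of the `d` assets
held on the interval `(τ j, τ (j+1)]` is `ℱ_{τ j}`-measurable. -/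
structure SimpleStrategy (ℱ : MeasureTheory.Filtration ℝ≥0 m) (d : ℕ) where
  n : ℕ
  τ : ℕ → Ω → ℝ≥0
  ϑ : ℕ → Ω → Fin d → ℝ
  τ_zero : ∀ ω, τ 0 ω = 0
  τ_mono : ∀ j, ∀ ω, τ j ω ≤ τ (j + 1) ω
  τ_stopping : ∀ j, MeasureTheory.IsStoppingTime ℱ (fun ω => (τ j ω : WithTop ℝ≥0))
  ϑ_meas : ∀ j, Measurable[(τ_stopping j).measurableSpace] (ϑ j)

namespace SimpleStrategy

variable {ℱ : MeasureTheory.Filtration ℝ≥0 m} {d : ℕ}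

/-- The wealth process `X^{x,θ}` associated with initial capital `x` and simple strategy `θ`. -/
def wealth (θ : SimpleStrategy ℱ d) (S : ℝ≥0 → Ω → Fin d → ℝ) (x : ℝ) (t : ℝ≥0) (ω : Ω) : ℝ :=
  x + ∑ j ∈ Finset.range θ.n, ∑ i, θ.ϑ j ω i *
    (S (min (θ.τ (j + 1) ω) t) ω i - S (min (θ.τ j ω) t) ω i)

/-- No-short-sales admissibility: all holdings are nonnegative, and the value of the held
assets never exceeds current wealth. -/
def Admissible (θ : SimpleStrategy ℱ d) (P : MeasureTheory.Measure Ω)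
    (S : ℝ≥0 → Ω → Fin d → ℝ) (x : ℝ) : Prop :=
  ∀ j < θ.n, ∀ᵐ ω ∂P, (∀ i, 0 ≤ θ.ϑ j ω i) ∧
    ∑ i, θ.ϑ j ω i * S (θ.τ j ω) ω i ≤ θ.wealth S x (θ.τ j ω) ω

end SimpleStrategy

/-- `𝒳_s(x)`: wealth processes of simple, no-short-sales strategies with initial capital `x`. -/
def Xs (P : MeasureTheory.Measure Ω) (ℱ : MeasureTheory.Filtration ℝ≥0 m) {d : ℕ}
    (S : ℝ≥0 → Ω → Fin d → ℝ) (x : ℝ) : Set (ℝ≥0 → Ω → ℝ) :=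
  {X | ∃ θ : SimpleStrategy ℱ d, θ.Admissible P S x ∧ X = θ.wealth S x}

/-- `𝒳_s = ⋃_{x ≥ 0} 𝒳_s(x)`. -/
def XsAll (P : MeasureTheory.Measure Ω) (ℱ : MeasureTheory.Filtration ℝ≥0 m) {d : ℕ}
    (S : ℝ≥0 → Ω → Fin d → ℝ) : Set (ℝ≥0 → Ω → ℝ) :=
  {X | ∃ x : ℝ, 0 ≤ x ∧ X ∈ Xs P ℱ S x}

/-- `ξ` is an arbitrage of the first kind on `[0, T]`. -/
def ArbitrageOfFirstKind (P : MeasureTheory.Measure Ω) (ℱ : MeasureTheory.Filtration ℝ≥0 m)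
    {d : ℕ} (S : ℝ≥0 → Ω → Fin d → ℝ) (T : ℝ≥0) (ξ : Ω → ℝ) : Prop :=
  Measurable[ℱ T] ξ ∧ (∀ᵐ ω ∂P, 0 ≤ ξ ω) ∧ 0 < P {ω | 0 < ξ ω} ∧
    ∀ x : ℝ, 0 < x → ∃ X ∈ Xs P ℱ S x, ∀ᵐ ω ∂P, ξ ω ≤ X T ω

/-- Condition NA1_s: no arbitrage of the first kind on any interval `[0, T]`. -/
def NA1s (P : MeasureTheory.Measure Ω) (ℱ : MeasureTheory.Filtration ℝ≥0 m) {d : ℕ}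
    (S : ℝ≥0 → Ω → Fin d → ℝ) : Prop :=
  ∀ (T : ℝ≥0) (ξ : Ω → ℝ), ¬ ArbitrageOfFirstKind P ℱ S T ξ

/-- A set of random variables is bounded in probability. -/
def BddInProb (P : MeasureTheory.Measure Ω) (C : Set (Ω → ℝ)) : Prop :=
  Filter.Tendsto (fun ℓ : ℝ => ⨆ f ∈ C, P {ω | ℓ < |f ω|}) Filter.atTop (nhds 0)

/-- The filtration is right-continuous. -/
def RightContinuousFiltration (ℱ : MeasureTheory.Filtration ℝ≥0 m) : Prop :=
  ∀ t : ℝ≥0, (ℱ t : MeasurableSpace Ω) = ⨅ (u : ℝ≥0) (_ : t < u), ℱ u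

/-- `ℱ 0` (hence every `ℱ t`) contains all `P`-null sets. -/
def CompleteFiltration (ℱ : MeasureTheory.Filtration ℝ≥0 m) (P : MeasureTheory.Measure Ω) : Prop :=
  ∀ N : Set Ω, MeasurableSet N → P N = 0 → MeasurableSet[ℱ 0] N

/-- The (first) bankruptcy time `ζ^X` of a process `X`, valued in `ℝ≥0∞`. -/
def bankruptcyTime (X : ℝ≥0 → Ω → ℝ) (ω : Ω) : ℝ≥0∞ :=
  sInf ((fun t : ℝ≥0 => (t : ℝ≥0∞)) ''
    {t : ℝ≥0 | Function.leftLim (fun s => X s ω) t = 0 ∨ X t ω = 0})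

/-- `X` cannot revive from bankruptcy: a.s., `X_t = 0` for all `t ≥ ζ^X` on `{ζ^X < ∞}`. -/
def CannotRevive (P : MeasureTheory.Measure Ω) (X : ℝ≥0 → Ω → ℝ) : Prop :=
  ∀ᵐ ω ∂P, ∀ t : ℝ≥0, bankruptcyTime X ω ≤ (t : ℝ≥0∞) → X t ω = 0

/-- `𝒴_s`: strictly positive supermartingale deflators for simple, no-short-sales trading. -/
def Ys (P : MeasureTheory.Measure Ω) (ℱ : MeasureTheory.Filtration ℝ≥0 m) {d : ℕ}
    (S : ℝ≥0 → Ω → Fin d → ℝ) : Set (ℝ≥0 → Ω → ℝ) :=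
  {Y | MeasureTheory.StronglyAdapted ℱ Y ∧ (∀ ω, IsCadlag (fun t => Y t ω)) ∧
    (∀ᵐ ω ∂P, Y 0 ω = 1 ∧ ∀ t : ℝ≥0, 0 < Y t ω) ∧
    ∀ X ∈ XsAll P ℱ S, MeasureTheory.Supermartingale (fun t ω => Y t ω * X t ω) ℱ P}

section Aux

variable {ℱ : MeasureTheory.Filtration ℝ≥0 m} {d : ℕ}

/-- clamp `v` to the interval `[c, e]` -/
def clampTo (v c e : ℝ≥0) : ℝ≥0 := min (max v c) e

lemma clampTo_swap (f : ℝ≥0 → ℝ) {a b c e : ℝ≥0} (hab : a ≤ b) (hce : c ≤ e) :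
    f (clampTo b c e) - f (clampTo a c e) = f (clampTo e a b) - f (clampTo c a b) := by
  unfold clampTo
  rcases le_total a c with h1 | h1 <;> rcases le_total a e with h2 | h2 <;>
    rcases le_total b c with h3 | h3 <;> rcases le_total b e with h4 | h4 <;>
    simp_all [max_def, min_def] <;> grind

lemma measurable_restrict_le {E : Type*} [MeasurableSpace E] [Zero E]
    {τ π : Ω → WithTop ℝ≥0} (hτ : IsStoppingTime ℱ τ) (hπ : IsStoppingTime ℱ π)
    {f : Ω → E} (hf : Measurable[hτ.measurableSpace] f) :
    Measurable[hπ.measurableSpace] ({ω | τ ω ≤ π ω}.indicator f) := by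
  intro B hB
  have hA : MeasurableSet[hπ.measurableSpace] {ω | τ ω ≤ π ω} :=
    hτ.measurableSet_stopping_time_le hπ
  have h1 : MeasurableSet[hπ.measurableSpace] (f ⁻¹' B ∩ {ω | τ ω ≤ π ω}) := by
    have := hτ.measurableSet_inter_le hπ _ (hf hB)
    rw [IsStoppingTime.measurableSet_min_iff hτ hπ] at this
    exact this.2
  by_cases h0 : (0 : E) ∈ B
  · have : {ω | τ ω ≤ π ω}.indicator f ⁻¹' B = (f ⁻¹' B ∩ {ω | τ ω ≤ π ω}) ∪ {ω | τ ω ≤ π ω}ᶜ := by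
      ext ω
      by_cases h : τ ω ≤ π ω <;> simp [Set.indicator, h, h0]
    rw [this]
    exact @MeasurableSet.union _ hπ.measurableSpace _ _ h1
      (@MeasurableSet.compl _ _ hπ.measurableSpace hA)
  · have : {ω | τ ω ≤ π ω}.indicator f ⁻¹' B = (f ⁻¹' B ∩ {ω | τ ω ≤ π ω}) := by
      ext ω
      by_cases h : τ ω ≤ π ω <;> simp [Set.indicator, h, h0]
    rw [this]
    exact h1

namespace SimpleStrategy

lemma τ_monotone (θ : SimpleStrategy ℱ d) (ω : Ω) : Monotone (fun j => θ.τ j ω) :=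
  monotone_nat_of_le_succ fun j => θ.τ_mono j ω

lemma wealth_between (θ : SimpleStrategy ℱ d) (S : ℝ≥0 → Ω → Fin d → ℝ) (x : ℝ) (ω : Ω)
    {j : ℕ} (hj : j < θ.n) {t : ℝ≥0} (h1 : θ.τ j ω ≤ t) (h2 : t ≤ θ.τ (j + 1) ω) :
    θ.wealth S x t ω = θ.wealth S x (θ.τ j ω) ω +
      ∑ i, θ.ϑ j ω i * (S t ω i - S (θ.τ j ω) ω i) := by
  unfold wealth
  rw [← sub_eq_iff_eq_add', add_sub_add_left_eq_sub, ← Finset.sum_sub_distrib]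
  rw [Finset.sum_eq_single j]
  · have e1 : min (θ.τ (j + 1) ω) (θ.τ j ω) = θ.τ j ω := min_eq_right (θ.τ_mono j ω)
    simp [min_eq_right h2, min_eq_left h1, e1]
  · intro l _ hlj
    rcases lt_or_gt_of_ne hlj with h | h
    · have a1 : θ.τ (l + 1) ω ≤ θ.τ j ω := θ.τ_monotone ω h
      have a2 : θ.τ l ω ≤ θ.τ j ω := θ.τ_monotone ω h.le
      rw [min_eq_left a1, min_eq_left a2, min_eq_left (a1.trans h1), min_eq_left (a2.trans h1),
        sub_self]
    · have a1 : θ.τ (j + 1) ω ≤ θ.τ l ω := θ.τ_monotone ω h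
      have a2 : θ.τ (j + 1) ω ≤ θ.τ (l + 1) ω := θ.τ_monotone ω (by omega : j + 1 ≤ l + 1)
      have a3 := θ.τ_mono j ω
      rw [min_eq_right (h2.trans a1), min_eq_right (h2.trans a2), min_eq_right (a3.trans a1),
        min_eq_right (a3.trans a2)]
      simp
  · intro h
    exact absurd (Finset.mem_range.2 hj) h

lemma wealth_after (θ : SimpleStrategy ℱ d) (S : ℝ≥0 → Ω → Fin d → ℝ) (x : ℝ) (ω : Ω)
    {t : ℝ≥0} (h : θ.τ θ.n ω ≤ t) :
    θ.wealth S x t ω = θ.wealth S x (θ.τ θ.n ω) ω := by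
  unfold wealth
  congr 1
  refine Finset.sum_congr rfl fun l hl => ?_
  have a1 : θ.τ (l + 1) ω ≤ θ.τ θ.n ω := θ.τ_monotone ω (Finset.mem_range.1 hl)
  have a2 : θ.τ l ω ≤ θ.τ θ.n ω := θ.τ_monotone ω (Finset.mem_range.1 hl).le
  rw [min_eq_left a1, min_eq_left a2, min_eq_left (a1.trans h), min_eq_left (a2.trans h)]

/-- Pathwise admissibility. -/
def PathAdm (θ : SimpleStrategy ℱ d) (S : ℝ≥0 → Ω → Fin d → ℝ) (x : ℝ) (ω : Ω) : Prop :=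
  ∀ j < θ.n, (∀ i, 0 ≤ θ.ϑ j ω i) ∧
    ∑ i, θ.ϑ j ω i * S (θ.τ j ω) ω i ≤ θ.wealth S x (θ.τ j ω) ω

lemma admissible_iff (θ : SimpleStrategy ℱ d) (P : Measure Ω) (S : ℝ≥0 → Ω → Fin d → ℝ) (x : ℝ) :
    θ.Admissible P S x ↔ ∀ᵐ ω ∂P, θ.PathAdm S x ω := by
  unfold Admissible PathAdm
  rw [ae_all_iff]
  refine forall_congr' fun j => ?_
  by_cases hj : j < θ.n <;> simp [hj]

lemma PathAdm.le {θ : SimpleStrategy ℱ d} {S : ℝ≥0 → Ω → Fin d → ℝ} {x : ℝ} {ω : Ω}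
    (h : θ.PathAdm S x ω) {j : ℕ} (hj : j < θ.n) {t : ℝ≥0}
    (h1 : θ.τ j ω ≤ t) (h2 : t ≤ θ.τ (j + 1) ω) :
    ∑ i, θ.ϑ j ω i * S t ω i ≤ θ.wealth S x t ω := by
  rw [θ.wealth_between S x ω hj h1 h2]
  simp only [mul_sub, Finset.sum_sub_distrib]
  linarith [(h j hj).2]

lemma PathAdm.nonneg {θ : SimpleStrategy ℱ d} {S : ℝ≥0 → Ω → Fin d → ℝ} {x : ℝ} {ω : Ω}
    (h : θ.PathAdm S x ω) (hx : 0 ≤ x) (hS : ∀ t ω i, 0 ≤ S t ω i) (t : ℝ≥0) :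
    0 ≤ θ.wealth S x t ω := by
  have key : ∀ j < θ.n, θ.τ j ω ≤ t → t ≤ θ.τ (j + 1) ω → 0 ≤ θ.wealth S x t ω :=
    fun j hj h1 h2 => le_trans
      (Finset.sum_nonneg fun i _ => mul_nonneg ((h j hj).1 i) (hS _ _ _)) (h.le hj h1 h2)
  rcases Nat.eq_zero_or_pos θ.n with hn | hn
  · simp [wealth, hn, hx]
  rcases le_total (θ.τ θ.n ω) t with ht | ht
  · rw [θ.wealth_after S x ω ht]
    have hn' : θ.n - 1 + 1 = θ.n := by omega
    have hl := h.le (j := θ.n - 1) (by omega) (t := θ.τ θ.n ω)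
      (θ.τ_monotone ω (by omega)) (by rw [hn'])
    exact le_trans (Finset.sum_nonneg fun i _ =>
      mul_nonneg ((h (θ.n - 1) (by omega)).1 i) (hS _ _ _)) hl
  · have : ∀ k ≤ θ.n, t ≤ θ.τ k ω → 0 ≤ θ.wealth S x t ω := by
      intro k
      induction k with
      | zero =>
        intro _ hk
        exact key 0 hn (by rw [θ.τ_zero]; exact zero_le) (hk.trans (θ.τ_mono 0 ω))
      | succ k ih =>
        intro hk hk'
        rcases le_total t (θ.τ k ω) with h' | h'
        · exact ih (by omega) h'
        · exact key k (by omega) h' hk'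
    exact this θ.n le_rfl ht

/-- Add a final period without holdings, ending at `M`. -/
def pad (θ : SimpleStrategy ℱ d) (M : Ω → ℝ≥0)
    (hM : IsStoppingTime ℱ (fun ω => (M ω : WithTop ℝ≥0))) (hle : ∀ ω, θ.τ θ.n ω ≤ M ω) :
    SimpleStrategy ℱ d where
  n := θ.n + 1
  τ j ω := if j ≤ θ.n then θ.τ j ω else M ω
  ϑ j ω := if j < θ.n then θ.ϑ j ω else 0
  τ_zero ω := by simp [θ.τ_zero]
  τ_mono j ω := by
    by_cases h : j + 1 ≤ θ.n
    · simp [h, (by omega : j ≤ θ.n), θ.τ_mono]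
    · by_cases h' : j ≤ θ.n
      · simpa [h, h'] using (θ.τ_monotone ω h').trans (hle ω)
      · simp [h, h']
  τ_stopping j := by
    by_cases h : j ≤ θ.n
    · simpa [h] using θ.τ_stopping j
    · simpa [h] using hM
  ϑ_meas j := by
    by_cases h : j < θ.n
    · simp only [h, if_true]
      refine (θ.ϑ_meas j).mono ?_ le_rfl
      refine IsStoppingTime.measurableSpace_mono _ _ fun ω => ?_
      simp only [h.le, if_true]
      exact le_rfl
    · simp only [h, if_false]
      exact @measurable_const _ _ _ (_) _

lemma pad_wealth (θ : SimpleStrategy ℱ d) (M : Ω → ℝ≥0)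
    (hM : IsStoppingTime ℱ (fun ω => (M ω : WithTop ℝ≥0))) (hle : ∀ ω, θ.τ θ.n ω ≤ M ω)
    (S : ℝ≥0 → Ω → Fin d → ℝ) (x : ℝ) : (θ.pad M hM hle).wealth S x = θ.wealth S x := by
  funext t ω
  simp only [wealth, pad]
  rw [Finset.sum_range_succ]
  simp only [lt_irrefl, if_false, Pi.zero_apply, zero_mul, Finset.sum_const_zero, add_zero]
  congr 1
  refine Finset.sum_congr rfl fun l hl => ?_
  have hl' := Finset.mem_range.1 hl
  simp [hl', hl'.le, Nat.succ_le_iff.2 hl']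

lemma pad_adm (θ : SimpleStrategy ℱ d) (M : Ω → ℝ≥0)
    (hM : IsStoppingTime ℱ (fun ω => (M ω : WithTop ℝ≥0))) (hle : ∀ ω, θ.τ θ.n ω ≤ M ω)
    (S : ℝ≥0 → Ω → Fin d → ℝ) {x : ℝ} (hx : 0 ≤ x) (hS : ∀ t ω i, 0 ≤ S t ω i) {ω : Ω}
    (h : θ.PathAdm S x ω) : (θ.pad M hM hle).PathAdm S x ω := by
  intro j hj
  rw [pad_wealth]
  by_cases hj' : j < θ.n
  · simpa [pad, hj', hj'.le] using h j hj'
  · simp only [pad, hj', if_false, Pi.zero_apply, le_refl, zero_mul, Finset.sum_const_zero,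
      implies_true, true_and]
    exact h.nonneg hx hS _

end SimpleStrategy

lemma sum_range_mul_aux (G : ℕ → ℝ) (a b : ℕ) :
    ∑ q ∈ Finset.range (a * b), G q =
      ∑ j ∈ Finset.range a, ∑ k ∈ Finset.range b, G (j * b + k) := by
  induction a with
  | zero => simp
  | succ a ih => rw [Nat.succ_mul, Finset.sum_range_add, ih, Finset.sum_range_succ]

lemma clampTo_mono {v w c e : ℝ≥0} (h : v ≤ w) : clampTo v c e ≤ clampTo w c e :=
  min_le_min_right _ (max_le_max_right _ h)

lemma clampTo_ge {v c e : ℝ≥0} (h : c ≤ e) : c ≤ clampTo v c e :=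
  le_min (le_max_right _ _) h

lemma clampTo_le {v c e : ℝ≥0} : clampTo v c e ≤ e := min_le_right _ _

lemma clampTo_zero {c e : ℝ≥0} (h : c ≤ e) : clampTo 0 c e = c := by
  simp [clampTo, h]

lemma clampTo_of_ge {v c e : ℝ≥0} (h : e ≤ v) : clampTo v c e = e := by
  simp [clampTo, h]

lemma clampTo_const {v w c e : ℝ≥0} (hvw : v ≤ w) (hce : c ≤ e)
    (h : ¬ (v ≤ clampTo v c e ∧ clampTo v c e ≤ w)) : clampTo w c e = clampTo v c e := by
  unfold clampTo at *
  rcases le_total v c with h1 | h1 <;> rcases le_total v e with h2 | h2 <;>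
    rcases le_total w c with h3 | h3 <;> rcases le_total w e with h4 | h4 <;>
    simp_all [max_def, min_def] <;> grind

lemma isStoppingTime_clampTo {a b c : Ω → ℝ≥0}
    (ha : IsStoppingTime ℱ (fun ω => (a ω : WithTop ℝ≥0)))
    (hb : IsStoppingTime ℱ (fun ω => (b ω : WithTop ℝ≥0)))
    (hc : IsStoppingTime ℱ (fun ω => (c ω : WithTop ℝ≥0))) :
    IsStoppingTime ℱ (fun ω => (clampTo (a ω) (b ω) (c ω) : WithTop ℝ≥0)) := by
  have := (ha.max hb).min hc
  refine (iff_of_eq ?_).1 this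
  congr 1

lemma divmod_aux {b k : ℕ} (j : ℕ) (hk : k < b) : (j * b + k) / b = j ∧ (j * b + k) % b = k := by
  have hb : 0 < b := by omega
  constructor
  · rw [mul_comm, Nat.mul_add_div hb, Nat.div_eq_of_lt hk, add_zero]
  · rw [mul_comm, Nat.mul_add_mod, Nat.mod_eq_of_lt hk]

namespace SimpleStrategy

/-- The sum of two strategies on the common refinement of their grids. -/
def merge (θ η : SimpleStrategy ℱ d) (hn : 0 < η.n) (hend : ∀ ω, θ.τ θ.n ω = η.τ η.n ω) :
    SimpleStrategy ℱ d where
  n := θ.n * η.n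
  τ q ω := clampTo (η.τ (q % η.n) ω) (θ.τ (q / η.n) ω) (θ.τ (q / η.n + 1) ω)
  ϑ q ω := θ.ϑ (q / η.n) ω +
    ({ω | clampTo (η.τ (q % η.n) ω) (θ.τ (q / η.n) ω) (θ.τ (q / η.n + 1) ω)
      ≤ η.τ (q % η.n + 1) ω}.indicator
    ({ω | η.τ (q % η.n) ω ≤
        clampTo (η.τ (q % η.n) ω) (θ.τ (q / η.n) ω) (θ.τ (q / η.n + 1) ω)}.indicator
        (η.ϑ (q % η.n)))) ω
  τ_zero ω := by
    simp [θ.τ_zero, η.τ_zero, clampTo]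
  τ_mono q ω := by
    have hk := Nat.mod_lt q hn
    have hq : q / η.n * η.n + q % η.n = q := Nat.div_add_mod' q η.n
    rcases Nat.lt_or_ge (q % η.n + 1) η.n with h | h
    · obtain ⟨e1, e2⟩ := divmod_aux (q / η.n) h
      rw [← add_assoc, hq] at e1 e2
      rw [e1, e2]
      exact clampTo_mono (η.τ_mono _ ω)
    · have h' : q % η.n + 1 = η.n := by omega
      obtain ⟨e1, e2⟩ := divmod_aux (q / η.n + 1) hn
      have : (q / η.n + 1) * η.n + 0 = q + 1 := by
        rw [Nat.succ_mul]; omega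
      rw [this] at e1 e2
      rw [e1, e2]
      exact clampTo_le.trans (clampTo_ge (θ.τ_mono _ ω))
  τ_stopping q := isStoppingTime_clampTo (η.τ_stopping _) (θ.τ_stopping _) (θ.τ_stopping _)
  ϑ_meas q := by
    have hσ := isStoppingTime_clampTo (η.τ_stopping (q % η.n)) (θ.τ_stopping (q / η.n))
      (θ.τ_stopping (q / η.n + 1))
    refine Measurable.add (m := hσ.measurableSpace) ?_ ?_
    · refine (θ.ϑ_meas (q / η.n)).mono ?_ le_rfl
      refine IsStoppingTime.measurableSpace_mono _ hσ fun ω => ?_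
      exact WithTop.coe_le_coe.2 (clampTo_ge (θ.τ_mono _ ω))
    · refine Measurable.indicator (m := hσ.measurableSpace) ?_ ?_
      · have := measurable_restrict_le (η.τ_stopping (q % η.n)) hσ (η.ϑ_meas (q % η.n))
        simpa only [WithTop.coe_le_coe] using this
      · have := hσ.measurableSet_le_stopping_time (η.τ_stopping (q % η.n + 1))
        simpa only [WithTop.coe_le_coe] using this

lemma merge_τ (θ η : SimpleStrategy ℱ d) (hn : 0 < η.n) (hend : ∀ ω, θ.τ θ.n ω = η.τ η.n ω)
    {j k : ℕ} (hk : k < η.n) (ω : Ω) :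
    (θ.merge η hn hend).τ (j * η.n + k) ω = clampTo (η.τ k ω) (θ.τ j ω) (θ.τ (j + 1) ω) := by
  obtain ⟨e1, e2⟩ := divmod_aux j hk
  simp only [merge, e1, e2]

lemma merge_τ_succ (θ η : SimpleStrategy ℱ d) (hn : 0 < η.n)
    (hend : ∀ ω, θ.τ θ.n ω = η.τ η.n ω) {j k : ℕ} (hj : j < θ.n) (hk : k < η.n) (ω : Ω) :
    (θ.merge η hn hend).τ (j * η.n + k + 1) ω =
      clampTo (η.τ (k + 1) ω) (θ.τ j ω) (θ.τ (j + 1) ω) := by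
  rcases Nat.lt_or_ge (k + 1) η.n with h | h
  · exact merge_τ θ η hn hend h ω
  · have h' : k + 1 = η.n := by omega
    have e : j * η.n + k + 1 = (j + 1) * η.n + 0 := by rw [Nat.succ_mul]; omega
    rw [e, merge_τ θ η hn hend hn ω, h', ← hend, η.τ_zero, clampTo_zero (θ.τ_mono _ ω),
      clampTo_of_ge]
    exact θ.τ_monotone ω hj

lemma merge_ϑ (θ η : SimpleStrategy ℱ d) (hn : 0 < η.n) (hend : ∀ ω, θ.τ θ.n ω = η.τ η.n ω)
    {j k : ℕ} (hk : k < η.n) (ω : Ω) :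
    (θ.merge η hn hend).ϑ (j * η.n + k) ω = θ.ϑ j ω +
      if η.τ k ω ≤ clampTo (η.τ k ω) (θ.τ j ω) (θ.τ (j + 1) ω) ∧
        clampTo (η.τ k ω) (θ.τ j ω) (θ.τ (j + 1) ω) ≤ η.τ (k + 1) ω then η.ϑ k ω else 0 := by
  obtain ⟨e1, e2⟩ := divmod_aux j hk
  simp only [merge, e1, e2, Set.indicator, Set.mem_ofPred_eq]
  split_ifs <;> first | rfl | (exfalso; tauto)

lemma merge_wealth (θ η : SimpleStrategy ℱ d) (hn : 0 < η.n)
    (hend : ∀ ω, θ.τ θ.n ω = η.τ η.n ω) (S : ℝ≥0 → Ω → Fin d → ℝ) (x y : ℝ) (t : ℝ≥0) (ω : Ω) :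
    (θ.merge η hn hend).wealth S (x + y) t ω = θ.wealth S x t ω + η.wealth S y t ω := by
  set f : Fin d → ℝ≥0 → ℝ := fun i r => S (min r t) ω i with hf
  set u : ℕ → ℝ≥0 := fun j => θ.τ j ω with hu
  set v : ℕ → ℝ≥0 := fun j => η.τ j ω with hv
  have huv : u θ.n = v η.n := hend ω
  have step : ∀ j ∈ Finset.range θ.n, ∀ k ∈ Finset.range η.n,
      ∑ i, (θ.merge η hn hend).ϑ (j * η.n + k) ω i *
        (S (min ((θ.merge η hn hend).τ (j * η.n + k + 1) ω) t) ω i -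
          S (min ((θ.merge η hn hend).τ (j * η.n + k) ω) t) ω i) =
      ∑ i, θ.ϑ j ω i * (f i (clampTo (v (k + 1)) (u j) (u (j + 1)))
          - f i (clampTo (v k) (u j) (u (j + 1)))) +
      ∑ i, η.ϑ k ω i * (f i (clampTo (u (j + 1)) (v k) (v (k + 1)))
          - f i (clampTo (u j) (v k) (v (k + 1)))) := by
    intro j hj k hk
    have hj := Finset.mem_range.1 hj
    have hk := Finset.mem_range.1 hk
    rw [merge_ϑ θ η hn hend hk, merge_τ θ η hn hend hk, merge_τ_succ θ η hn hend hj hk,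
      ← Finset.sum_add_distrib]
    refine Finset.sum_congr rfl fun i _ => ?_
    rw [← clampTo_swap (f i) (η.τ_mono k ω) (θ.τ_mono j ω)]
    split_ifs with hc
    · simp only [hf, hu, hv, Pi.add_apply]
      ring
    · have := clampTo_const (η.τ_mono k ω) (θ.τ_mono j ω) hc
      simp only [hf, hu, hv, this, sub_self, mul_zero, add_zero]
  have e1 : ∑ j ∈ Finset.range θ.n, ∑ k ∈ Finset.range η.n,
      ∑ i, θ.ϑ j ω i * (f i (clampTo (v (k + 1)) (u j) (u (j + 1)))
          - f i (clampTo (v k) (u j) (u (j + 1)))) =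
      ∑ j ∈ Finset.range θ.n, ∑ i, θ.ϑ j ω i * (f i (u (j + 1)) - f i (u j)) := by
    refine Finset.sum_congr rfl fun j hj => ?_
    rw [Finset.sum_comm]
    refine Finset.sum_congr rfl fun i _ => ?_
    rw [← Finset.mul_sum, Finset.sum_range_sub (fun k => f i (clampTo (v k) (u j) (u (j + 1))))]
    have h0 : v 0 = 0 := η.τ_zero ω
    rw [← huv, h0, clampTo_zero (θ.τ_mono j ω), clampTo_of_ge]
    exact θ.τ_monotone ω (Finset.mem_range.1 hj)
  have e2 : ∑ j ∈ Finset.range θ.n, ∑ k ∈ Finset.range η.n,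
      ∑ i, η.ϑ k ω i * (f i (clampTo (u (j + 1)) (v k) (v (k + 1)))
          - f i (clampTo (u j) (v k) (v (k + 1)))) =
      ∑ k ∈ Finset.range η.n, ∑ i, η.ϑ k ω i * (f i (v (k + 1)) - f i (v k)) := by
    rw [Finset.sum_comm]
    refine Finset.sum_congr rfl fun k hk => ?_
    rw [Finset.sum_comm]
    refine Finset.sum_congr rfl fun i _ => ?_
    rw [← Finset.mul_sum, Finset.sum_range_sub (fun j => f i (clampTo (u j) (v k) (v (k + 1))))]
    have h0 : u 0 = 0 := θ.τ_zero ω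
    rw [huv, h0, clampTo_zero (η.τ_mono k ω), clampTo_of_ge]
    exact η.τ_monotone ω (Finset.mem_range.1 hk)
  have e3 := sum_range_mul_aux (fun q => ∑ i, (θ.merge η hn hend).ϑ q ω i *
        (S (min ((θ.merge η hn hend).τ (q + 1) ω) t) ω i -
          S (min ((θ.merge η hn hend).τ q ω) t) ω i)) θ.n η.n
  rw [Finset.sum_congr rfl fun j hj => Finset.sum_congr rfl (step j hj)] at e3
  simp only [Finset.sum_add_distrib] at e3
  rw [e1, e2] at e3
  change x + y + _ = (x + _) + (y + _)
  rw [show (θ.merge η hn hend).n = θ.n * η.n from rfl, e3]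
  simp only [hf, hu, hv]
  ring

lemma merge_adm (θ η : SimpleStrategy ℱ d) (hn : 0 < η.n)
    (hend : ∀ ω, θ.τ θ.n ω = η.τ η.n ω) (S : ℝ≥0 → Ω → Fin d → ℝ) {x y : ℝ}
    (hy : 0 ≤ y) (hS : ∀ t ω i, 0 ≤ S t ω i) {ω : Ω}
    (h1 : θ.PathAdm S x ω) (h2 : η.PathAdm S y ω) :
    (θ.merge η hn hend).PathAdm S (x + y) ω := by
  intro q hq
  change q < θ.n * η.n at hq
  have hk := Nat.mod_lt q hn
  have hj : q / η.n < θ.n := Nat.div_lt_of_lt_mul (by rwa [mul_comm])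
  rw [← Nat.div_add_mod' q η.n]
  generalize q / η.n = j at hj
  generalize q % η.n = k at hk
  rw [merge_wealth, merge_ϑ θ η hn hend hk, merge_τ θ η hn hend hk]
  have a1 := h1.le hj (clampTo_ge (v := η.τ k ω) (θ.τ_mono j ω)) clampTo_le
  split_ifs with hc
  · have a2 := h2.le hk hc.1 hc.2
    refine ⟨fun i => add_nonneg ((h1 j hj).1 i) ((h2 k hk).1 i), ?_⟩
    simp only [Pi.add_apply, add_mul, Finset.sum_add_distrib]
    linarith
  · have a2 := h2.nonneg hy hS (clampTo (η.τ k ω) (θ.τ j ω) (θ.τ (j + 1) ω))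
    simp only [add_zero]
    exact ⟨(h1 j hj).1, by linarith⟩

/-- Multiply a strategy by a constant. -/
def scale (θ : SimpleStrategy ℱ d) (c : ℝ) : SimpleStrategy ℱ d where
  n := θ.n
  τ := θ.τ
  ϑ j ω := c • θ.ϑ j ω
  τ_zero := θ.τ_zero
  τ_mono := θ.τ_mono
  τ_stopping := θ.τ_stopping
  ϑ_meas j := (measurable_const_smul c).comp (θ.ϑ_meas j)

lemma scale_wealth (θ : SimpleStrategy ℱ d) (c : ℝ) (S : ℝ≥0 → Ω → Fin d → ℝ) (x : ℝ)
    (t : ℝ≥0) (ω : Ω) : (θ.scale c).wealth S (c * x) t ω = c * θ.wealth S x t ω := by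
  simp only [wealth, scale, mul_add, Finset.mul_sum, Pi.smul_apply, smul_eq_mul, mul_assoc]

lemma scale_adm (θ : SimpleStrategy ℱ d) {c : ℝ} (hc : 0 ≤ c) (S : ℝ≥0 → Ω → Fin d → ℝ) {x : ℝ}
    {ω : Ω} (h : θ.PathAdm S x ω) : (θ.scale c).PathAdm S (c * x) ω := by
  intro j hj
  rw [scale_wealth]
  refine ⟨fun i => mul_nonneg hc ((h j hj).1 i), ?_⟩
  simp only [scale, Pi.smul_apply, smul_eq_mul, mul_assoc, ← Finset.mul_sum]
  exact mul_le_mul_of_nonneg_left (h j hj).2 hc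

end SimpleStrategy

lemma Xs_add {P : Measure Ω} {S : ℝ≥0 → Ω → Fin d → ℝ} (hS : ∀ t ω i, 0 ≤ S t ω i)
    {x y : ℝ} (hx : 0 ≤ x) (hy : 0 ≤ y) {X Y : ℝ≥0 → Ω → ℝ}
    (hX : X ∈ Xs P ℱ S x) (hY : Y ∈ Xs P ℱ S y) :
    (fun t ω => X t ω + Y t ω) ∈ Xs P ℱ S (x + y) := by
  obtain ⟨θ, hθ, rfl⟩ := hX
  obtain ⟨η, hη, rfl⟩ := hY
  rw [SimpleStrategy.admissible_iff] at hθ hη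
  have hM : IsStoppingTime ℱ
      (fun ω => ((max (θ.τ θ.n ω) (η.τ η.n ω) : ℝ≥0) : WithTop ℝ≥0)) := by
    have := (θ.τ_stopping θ.n).max (η.τ_stopping η.n)
    refine (iff_of_eq ?_).1 this
    congr 1
  have l1 : ∀ ω, θ.τ θ.n ω ≤ max (θ.τ θ.n ω) (η.τ η.n ω) := fun ω => le_max_left _ _
  have l2 : ∀ ω, η.τ η.n ω ≤ max (θ.τ θ.n ω) (η.τ η.n ω) := fun ω => le_max_right _ _
  have hn : 0 < (η.pad _ hM l2).n := Nat.succ_pos _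
  have hend : ∀ ω, (θ.pad _ hM l1).τ (θ.pad _ hM l1).n ω =
      (η.pad _ hM l2).τ (η.pad _ hM l2).n ω := by
    intro ω
    simp [SimpleStrategy.pad]
  refine ⟨(θ.pad _ hM l1).merge (η.pad _ hM l2) hn hend, ?_, ?_⟩
  · rw [SimpleStrategy.admissible_iff]
    filter_upwards [hθ, hη] with ω h1 h2
    exact SimpleStrategy.merge_adm _ _ _ _ _ hy hS (θ.pad_adm _ hM l1 S hx hS h1)
      (η.pad_adm _ hM l2 S hy hS h2)
  · funext t ω
    rw [SimpleStrategy.merge_wealth, SimpleStrategy.pad_wealth, SimpleStrategy.pad_wealth]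

lemma Xs_smul {P : Measure Ω} {S : ℝ≥0 → Ω → Fin d → ℝ}
    {x c : ℝ} (hc : 0 ≤ c) {X : ℝ≥0 → Ω → ℝ} (hX : X ∈ Xs P ℱ S x) :
    (fun t ω => c * X t ω) ∈ Xs P ℱ S (c * x) := by
  obtain ⟨θ, hθ, rfl⟩ := hX
  rw [SimpleStrategy.admissible_iff] at hθ
  refine ⟨θ.scale c, ?_, ?_⟩
  · rw [SimpleStrategy.admissible_iff]
    filter_upwards [hθ] with ω h1
    exact θ.scale_adm hc S h1
  · funext t ω
    rw [SimpleStrategy.scale_wealth]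

lemma Xs_zero {P : Measure Ω} {S : ℝ≥0 → Ω → Fin d → ℝ} :
    (fun _ _ => (0 : ℝ)) ∈ Xs P ℱ S 0 := by
  refine ⟨⟨0, fun _ _ => 0, fun _ _ => 0, fun _ => rfl, fun _ _ => le_rfl,
    fun _ => isStoppingTime_const ℱ 0, fun _ => @measurable_const _ _ _ (_) _⟩, ?_, ?_⟩
  · intro j hj
    exact absurd hj (Nat.not_lt_zero j)
  · funext t ω
    simp [SimpleStrategy.wealth]

lemma Xs_nonneg {P : Measure Ω} {S : ℝ≥0 → Ω → Fin d → ℝ} (hS : ∀ t ω i, 0 ≤ S t ω i)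
    {x : ℝ} (hx : 0 ≤ x) {X : ℝ≥0 → Ω → ℝ} (hX : X ∈ Xs P ℱ S x) (T : ℝ≥0) :
    ∀ᵐ ω ∂P, 0 ≤ X T ω := by
  obtain ⟨θ, hθ, rfl⟩ := hX
  rw [SimpleStrategy.admissible_iff] at hθ
  filter_upwards [hθ] with ω h
  exact h.nonneg hx hS T

lemma Xs_sum {P : Measure Ω} {S : ℝ≥0 → Ω → Fin d → ℝ} (hS : ∀ t ω i, 0 ≤ S t ω i)
    {X : ℕ → ℝ≥0 → Ω → ℝ} (hX : ∀ k, X k ∈ Xs P ℱ S 1) {c : ℕ → ℝ} (hc : ∀ k, 0 ≤ c k) (K : ℕ) :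
    (fun t ω => ∑ k ∈ Finset.range K, c k * X k t ω) ∈ Xs P ℱ S (∑ k ∈ Finset.range K, c k) := by
  induction K with
  | zero => simpa using Xs_zero
  | succ K ih =>
    simp only [Finset.sum_range_succ]
    have := Xs_smul (hc K) (hX K)
    rw [mul_one] at this
    exact Xs_add hS (Finset.sum_nonneg fun k _ => hc k) (hc K) ih this

lemma measurable_nat_comp {Ω' : Type*} [MeasurableSpace Ω'] {g : ℕ → Ω' → ℝ}
    (hg : ∀ n, Measurable (g n)) {N : Ω' → ℕ} (hN : Measurable N) :
    Measurable (fun ω => g (N ω) ω) := by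
  have h1 : Measurable (fun p : ℕ × Ω' => g p.1 p.2) :=
    measurable_from_prod_countable_right fun n => hg n
  exact h1.comp (hN.prodMk measurable_id)

lemma measurable_rightCont_comp {Ω' : Type*} [MeasurableSpace Ω'] {Z : ℝ≥0 → Ω' → ℝ} {T : ℝ≥0}
    (hZ : ∀ t ≤ T, Measurable (Z t))
    (hc : ∀ ω t, ContinuousWithinAt (fun s => Z s ω) (Set.Ici t) t)
    {ρ : Ω' → ℝ≥0} (hρ : Measurable ρ) (hρT : ∀ ω, ρ ω ≤ T) :
    Measurable (fun ω => Z (ρ ω) ω) := by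
  let D : ℕ → ℕ → ℝ≥0 := fun k N => min (((N : ℝ≥0) + 1) / ((k : ℝ≥0) + 1)) T
  let N : ℕ → Ω' → ℕ := fun k ω => ⌊((k : ℝ≥0) + 1) * ρ ω⌋₊
  have hlow : ∀ k ω, ρ ω ≤ D k (N k ω) := by
    intro k ω
    refine le_min ?_ (hρT ω)
    have hk : (0 : ℝ≥0) < (k : ℝ≥0) + 1 := by positivity
    rw [le_div_iff₀ hk, mul_comm]
    exact (Nat.lt_floor_add_one _).le
  have hup : ∀ k ω, D k (N k ω) ≤ ρ ω + 1 / ((k : ℝ≥0) + 1) := by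
    intro k ω
    refine (min_le_left _ _).trans ?_
    have hk : (0 : ℝ≥0) < (k : ℝ≥0) + 1 := by positivity
    rw [div_le_iff₀ hk, add_mul, div_mul_cancel₀ _ hk.ne', mul_comm]
    gcongr
    exact Nat.floor_le zero_le
  refine measurable_of_tendsto_metrizable (f := fun k ω => Z (D k (N k ω)) ω) ?_ ?_
  · intro k
    have h2 : Measurable (N k) := Nat.measurable_floor.comp (hρ.const_mul _)
    exact measurable_nat_comp (g := fun n ω => Z (D k n) ω) (fun n => hZ (D k n) (min_le_right _ _)) h2
  · rw [tendsto_pi_nhds]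
    intro ω
    have hlim : Tendsto (fun k => D k (N k ω)) atTop (𝓝 (ρ ω)) := by
      refine tendsto_of_tendsto_of_tendsto_of_le_of_le tendsto_const_nhds ?_
        (fun k => hlow k ω) (fun k => hup k ω)
      have : Tendsto (fun k : ℕ => 1 / ((k : ℝ≥0) + 1)) atTop (𝓝 0) :=
        tendsto_one_div_add_atTop_nhds_zero_nat
      simpa using tendsto_const_nhds.add this
    exact (hc ω (ρ ω)).tendsto.comp
      (tendsto_nhdsWithin_iff.2 ⟨hlim, Eventually.of_forall fun k => hlow k ω⟩)

lemma measurable_min_stopping {τ : Ω → ℝ≥0}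
    (hτ : IsStoppingTime ℱ (fun ω => (τ ω : WithTop ℝ≥0))) (T : ℝ≥0) :
    Measurable[ℱ T] (fun ω => min (τ ω) T) := by
  refine @measurable_of_Iic _ _ _ _ _ (ℱ T) _ _ _ _ fun a => ?_
  rcases lt_or_ge a T with h | h
  · have e : (fun ω => min (τ ω) T) ⁻¹' Iic a = {ω | (τ ω : WithTop ℝ≥0) ≤ a} := by
      ext ω
      have : ((τ ω : WithTop ℝ≥0) ≤ a) ↔ τ ω ≤ a := WithTop.coe_le_coe
      refine Iff.trans ?_ this.symm
      simp [not_le.2 h]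
    rw [e]
    exact ℱ.mono h.le _ (hτ a)
  · have e : (fun ω => min (τ ω) T) ⁻¹' Iic a = Set.univ := by
      ext ω
      simp [h]
    rw [e]
    exact @MeasurableSet.univ _ (ℱ T)

lemma Xs_measurable {P : Measure Ω} {S : ℝ≥0 → Ω → Fin d → ℝ}
    (hS_adapted : MeasureTheory.StronglyAdapted ℱ S)
    (hS_cadlag : ∀ ω, IsCadlag (fun t => S t ω))
    {x : ℝ} {X : ℝ≥0 → Ω → ℝ} (hX : X ∈ Xs P ℱ S x) (T : ℝ≥0) : Measurable[ℱ T] (X T) := by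
  obtain ⟨θ, -, rfl⟩ := hX
  have hSm : ∀ j i, Measurable[ℱ T] (fun ω => S (min (θ.τ j ω) T) ω i) := by
    intro j i
    refine @measurable_rightCont_comp Ω (ℱ T) (fun t ω => S t ω i) T ?_ ?_ _
      (measurable_min_stopping (θ.τ_stopping j) T) fun ω => min_le_right _ _
    · intro t ht
      exact (measurable_pi_apply i).comp (((hS_adapted t).measurable).mono (ℱ.mono ht) le_rfl)
    · intro ω t
      exact (continuous_apply i).continuousAt.comp_continuousWithinAt ((hS_cadlag ω).1 t)
  have hϑm : ∀ j, Measurable[ℱ T] ({ω | θ.τ j ω ≤ T}.indicator (θ.ϑ j)) := by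
    intro j
    have h := measurable_restrict_le (θ.τ_stopping j) (isStoppingTime_const ℱ T) (θ.ϑ_meas j)
    rw [IsStoppingTime.measurableSpace_const] at h
    simpa only [WithTop.coe_le_coe] using h
  have e : θ.wealth S x T = fun ω => x + ∑ j ∈ Finset.range θ.n, ∑ i,
      ({ω | θ.τ j ω ≤ T}.indicator (θ.ϑ j)) ω i *
      (S (min (θ.τ (j + 1) ω) T) ω i - S (min (θ.τ j ω) T) ω i) := by
    funext ω
    unfold SimpleStrategy.wealth
    congr 1
    refine Finset.sum_congr rfl fun j _ => Finset.sum_congr rfl fun i _ => ?_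
    by_cases h : θ.τ j ω ≤ T
    · simp [Set.indicator, h]
    · have h := (not_le.1 h).le
      rw [min_eq_right h, min_eq_right (h.trans (θ.τ_mono j ω)), sub_self, mul_zero, mul_zero]
  rw [e]
  refine Measurable.const_add (m := ℱ T) ?_ x
  refine Finset.measurable_fun_sum (m := ℱ T) _ fun j _ => ?_
  refine Finset.measurable_fun_sum (m := ℱ T) _ fun i _ => ?_
  exact Measurable.mul (m := ℱ T) ((measurable_pi_apply i).comp (hϑm j))
    (Measurable.sub (m := ℱ T) (hSm _ i) (hSm _ i))

lemma exists_K_aux {P : Measure Ω} [IsProbabilityMeasure P] {E : ℕ → Set Ω}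
    (hE : ∀ k, MeasurableSet (E k)) {ε : ℝ≥0∞} (hε : ε ≠ 0) (h : ∀ k, ε ≤ P (E k)) :
    ∃ K : ℕ → ℕ, 0 < P (⋂ M, ⋃ k ∈ Finset.Ico M (K M), E k) := by
  obtain ⟨δ, hδ, hδε⟩ := ENNReal.exists_pos_sum_of_countable' hε ℕ
  let U : ℕ → Set Ω := fun M => ⋃ k ∈ Set.Ici M, E k
  have hU : ∀ M, MeasurableSet (U M) :=
    fun M => MeasurableSet.biUnion (Set.to_countable _) fun k _ => hE k
  let B : ℕ → ℕ → Set Ω := fun M K => ⋃ k ∈ Finset.Ico M K, E k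
  have hB : ∀ M K, MeasurableSet (B M K) :=
    fun M K => Finset.measurableSet_biUnion _ fun k _ => hE k
  have hK : ∀ M, ∃ K, P (U M \ B M K) < δ M := by
    intro M
    have ht := tendsto_measure_iInter_atTop (μ := P) (s := fun K => U M \ B M K)
      (fun K => ((hU M).diff (hB M K)).nullMeasurableSet)
      (fun K K' hKK => Set.sdiff_subset_sdiff_right
        (Set.biUnion_subset_biUnion_left fun k hk => by
          simp only [Finset.coe_Ico, Finset.mem_Ico, Set.mem_Ico] at hk ⊢
          exact ⟨hk.1, hk.2.trans_le hKK⟩))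
      ⟨0, measure_ne_top _ _⟩
    have he : (⋂ K, U M \ B M K) = ∅ := by
      ext ω
      simp only [U, B, Set.mem_iInter, Set.mem_sdiff, Set.mem_iUnion, Set.mem_empty_iff_false,
        iff_false, not_forall]
      by_contra hcon
      push Not at hcon
      obtain ⟨k, hk, hω⟩ := (hcon 0).1
      exact (hcon (k + 1)).2 k (Finset.mem_Ico.2 ⟨hk, Nat.lt_succ_self k⟩) hω
    rw [he, measure_empty] at ht
    exact (ht.eventually (gt_mem_nhds (hδ M))).exists
  choose K hK using hK
  refine ⟨K, ?_⟩
  rw [pos_iff_ne_zero]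
  intro h0
  have hlim : ε ≤ P (⋂ M, U M) := by
    have ht := tendsto_measure_iInter_atTop (μ := P) (s := U)
      (fun M => (hU M).nullMeasurableSet)
      (fun M M' hM => Set.biUnion_subset_biUnion_left (Set.Ici_subset_Ici.2 hM))
      ⟨0, measure_ne_top _ _⟩
    refine ge_of_tendsto' ht fun M => (h M).trans (measure_mono ?_)
    exact Set.subset_biUnion_of_mem (u := E) (Set.self_mem_Ici)
  have hsub : (⋂ M, U M) ⊆ (⋂ M, B M (K M)) ∪ ⋃ M, (U M \ B M (K M)) := by
    intro ω hω
    by_cases hc : ω ∈ ⋂ M, B M (K M)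
    · exact Or.inl hc
    · right
      rw [Set.mem_iInter, not_forall] at hc
      obtain ⟨M, hM⟩ := hc
      exact Set.mem_iUnion.2 ⟨M, Set.mem_iInter.1 hω M, hM⟩
  have : ε < ε := calc
    ε ≤ P (⋂ M, U M) := hlim
    _ ≤ P (⋂ M, B M (K M)) + P (⋃ M, (U M \ B M (K M))) :=
      (measure_mono hsub).trans (measure_union_le _ _)
    _ = P (⋃ M, (U M \ B M (K M))) := by rw [h0, zero_add]
    _ ≤ ∑' M, P (U M \ B M (K M)) := measure_iUnion_le _
    _ ≤ ∑' M, δ M := ENNReal.tsum_le_tsum fun M => (hK M).le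
    _ < ε := hδε
  exact lt_irrefl _ this

lemma na1s_of_bdd {P : Measure Ω} [IsProbabilityMeasure P] {S : ℝ≥0 → Ω → Fin d → ℝ}
    (hb : ∀ T : ℝ≥0, BddInProb P ((fun X : ℝ≥0 → Ω → ℝ => X T) '' Xs P ℱ S 1)) :
    NA1s P ℱ S := by
  intro T ξ ⟨_, _, hpos, hX⟩
  have hex : ∃ n : ℕ, 0 < P {ω | 1 / ((n : ℝ) + 1) < ξ ω} := by
    by_contra! hcon
    have hsub : {ω | 0 < ξ ω} ⊆ ⋃ n : ℕ, {ω | 1 / ((n : ℝ) + 1) < ξ ω} := by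
      intro ω hω
      obtain ⟨n, hn⟩ := exists_nat_one_div_lt (show 0 < ξ ω from hω)
      exact Set.mem_iUnion.2 ⟨n, hn⟩
    have : P {ω | 0 < ξ ω} ≤ 0 := (measure_mono hsub).trans
      ((measure_iUnion_null fun n => le_antisymm (hcon n) zero_le).le)
    exact absurd hpos (not_lt.2 this)
  obtain ⟨n, hn⟩ := hex
  set c := 1 / ((n : ℝ) + 1) with hc
  have hc0 : 0 < c := by positivity
  have hlow : ∀ ℓ : ℝ, 0 < ℓ → P {ω | c < ξ ω} ≤
      ⨆ f ∈ (fun X : ℝ≥0 → Ω → ℝ => X T) '' Xs P ℱ S 1, P {ω | ℓ < |f ω|} := by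
    intro ℓ hℓ
    obtain ⟨X, hXm, hXξ⟩ := hX (c / ℓ) (by positivity)
    have hs := Xs_smul (c := ℓ / c) (by positivity) hXm
    rw [show ℓ / c * (c / ℓ) = 1 by field_simp] at hs
    refine le_trans ?_ (le_iSup₂ (fun ω => ℓ / c * X T ω) ⟨_, hs, rfl⟩)
    refine measure_mono_ae ?_
    filter_upwards [hXξ] with ω h1 h2
    have h2 : c < ξ ω := h2
    change ℓ < |ℓ / c * X T ω|
    refine lt_of_lt_of_le ?_ (le_abs_self _)
    calc ℓ = ℓ / c * c := by field_simp
      _ < ℓ / c * X T ω := mul_lt_mul_of_pos_left (h2.trans_le h1) (by positivity)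
  have := ge_of_tendsto (hb T) ((eventually_gt_atTop (0 : ℝ)).mono hlow)
  exact absurd hn (not_lt.2 this)

lemma bdd_of_na1s {P : Measure Ω} [IsProbabilityMeasure P] {S : ℝ≥0 → Ω → Fin d → ℝ}
    (hS_adapted : MeasureTheory.StronglyAdapted ℱ S)
    (hS_cadlag : ∀ ω, IsCadlag (fun t => S t ω))
    (hS : ∀ t ω i, 0 ≤ S t ω i) (hna : NA1s P ℱ S) (T : ℝ≥0) :
    BddInProb P ((fun X : ℝ≥0 → Ω → ℝ => X T) '' Xs P ℱ S 1) := by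
  by_contra hcon
  unfold BddInProb at hcon
  rw [ENNReal.tendsto_nhds_zero] at hcon
  push Not at hcon
  obtain ⟨ε, hε, hfr⟩ := hcon
  have hex : ∀ k : ℕ, ∃ X ∈ Xs P ℱ S 1, ε ≤ P {ω | (4 : ℝ) ^ k < X T ω} := by
    intro k
    obtain ⟨ℓ, h1, h2⟩ := (hfr.and_eventually (eventually_ge_atTop ((4 : ℝ) ^ k))).exists
    rw [lt_iSup_iff] at h1
    obtain ⟨f, h1⟩ := h1
    rw [lt_iSup_iff] at h1
    obtain ⟨⟨X, hX, rfl⟩, h1⟩ := h1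
    refine ⟨X, hX, h1.le.trans (measure_mono_ae ?_)⟩
    filter_upwards [Xs_nonneg hS zero_le_one hX T] with ω h3 h4
    have h4 : ℓ < |X T ω| := h4
    rw [abs_of_nonneg h3] at h4
    exact h2.trans_lt h4
  choose X hX hP using hex
  have hmeas : ∀ k, MeasurableSet[ℱ T] {ω | (4 : ℝ) ^ k < X k T ω} := fun k =>
    (Xs_measurable hS_adapted hS_cadlag (hX k) T) measurableSet_Ioi
  obtain ⟨K, hK⟩ := exists_K_aux (fun k => ℱ.le T _ (hmeas k)) hε.ne' hP
  set A : Set Ω := ⋂ M, ⋃ k ∈ Finset.Ico M (K M), {ω | (4 : ℝ) ^ k < X k T ω} with hA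
  have hAm : MeasurableSet[ℱ T] A :=
    @MeasurableSet.iInter _ _ (ℱ T) _ _ fun M =>
      @Finset.measurableSet_biUnion _ _ (ℱ T) _ _ fun k _ => hmeas k
  refine hna T (A.indicator fun _ => (1 : ℝ)) ⟨?_, ?_, ?_, ?_⟩
  · exact Measurable.indicator (m := ℱ T) (@measurable_const _ _ _ (ℱ T) _) hAm
  · exact Eventually.of_forall fun ω => Set.indicator_nonneg (fun _ _ => zero_le_one) ω
  · have : {ω | 0 < A.indicator (fun _ => (1 : ℝ)) ω} = A := by
      ext ω
      by_cases h : ω ∈ A <;> simp [h]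
    rw [this]
    exact hK
  · intro x hx
    obtain ⟨M, hM⟩ := pow_unbounded_of_one_lt (2 / x) (one_lt_two : (1 : ℝ) < 2)
    have hW := Xs_sum hS hX (c := fun k => (1 / 2 : ℝ) ^ k) (fun k => by positivity) (K M + 1)
    set s : ℝ := ∑ k ∈ Finset.range (K M + 1), (1 / 2 : ℝ) ^ k with hs
    have hs1 : 0 < s := Finset.sum_pos (fun k _ => by positivity) ⟨0, by simp⟩
    have hs2 : s ≤ 2 := by
      rw [hs, geom_sum_eq (by norm_num)]
      have : (0 : ℝ) < (1 / 2) ^ (K M + 1) := by positivity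
      rw [div_le_iff_of_neg (by norm_num)]
      linarith
    have hV := Xs_smul (c := x / s) (by positivity) hW
    rw [div_mul_cancel₀ _ hs1.ne'] at hV
    refine ⟨_, hV, ?_⟩
    have hnn : ∀ᵐ ω ∂P, ∀ k, 0 ≤ X k T ω :=
      ae_all_iff.2 fun k => Xs_nonneg hS zero_le_one (hX k) T
    filter_upwards [hnn] with ω hω
    have hterm : ∀ k ∈ Finset.range (K M + 1), 0 ≤ (1 / 2 : ℝ) ^ k * X k T ω :=
      fun k _ => mul_nonneg (by positivity) (hω k)
    by_cases hωA : ω ∈ A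
    · rw [Set.indicator_of_mem hωA]
      have h1 := Set.mem_iInter.1 hωA M
      simp only [Set.mem_iUnion] at h1
      obtain ⟨k, hk, hk2⟩ := h1
      have hk2 : (4 : ℝ) ^ k < X k T ω := hk2
      have hk' := Finset.mem_Ico.1 hk
      have h3 : (2 : ℝ) ^ M ≤ (1 / 2 : ℝ) ^ k * X k T ω := calc
        (2 : ℝ) ^ M ≤ 2 ^ k := pow_le_pow_right₀ one_le_two hk'.1
        _ = (1 / 2 : ℝ) ^ k * 4 ^ k := by rw [← mul_pow]; norm_num
        _ ≤ (1 / 2 : ℝ) ^ k * X k T ω := mul_le_mul_of_nonneg_left hk2.le (by positivity)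
      have h4 := Finset.single_le_sum hterm (Finset.mem_range.2 (by omega : k < K M + 1))
      have h5 : 2 / x ≤ ∑ k ∈ Finset.range (K M + 1), (1 / 2 : ℝ) ^ k * X k T ω :=
        hM.le.trans (h3.trans h4)
      calc (1 : ℝ) = x / 2 * (2 / x) := by field_simp
        _ ≤ x / s * ∑ k ∈ Finset.range (K M + 1), (1 / 2 : ℝ) ^ k * X k T ω := by
          gcongr
    · rw [Set.indicator_of_notMem hωA]
      exact mul_nonneg (by positivity) (Finset.sum_nonneg hterm)

end Aux

/-- **Proposition 2.1.** Condition NA1_s holds if and only if, for every `T ∈ [0,∞)`, the set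
`{X_T : X ∈ 𝒳_s(1)}` is bounded in probability. -/
theorem na1s_iff_bddInProb
    {Ω : Type*} {m : MeasurableSpace Ω} (P : MeasureTheory.Measure Ω)
    [MeasureTheory.IsProbabilityMeasure P] (ℱ : MeasureTheory.Filtration ℝ≥0 m)
    (hright : RightContinuousFiltration ℱ) (hcompl : CompleteFiltration ℱ P)
    (d : ℕ) (S : ℝ≥0 → Ω → Fin d → ℝ)
    (hS_adapted : MeasureTheory.StronglyAdapted ℱ S)
    (hS_cadlag : ∀ ω, IsCadlag (fun t => S t ω))
    (hS_nonneg : ∀ t ω i, 0 ≤ S t ω i) :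
    NA1s P ℱ S ↔
      ∀ T : ℝ≥0, BddInProb P ((fun X : ℝ≥0 → Ω → ℝ => X T) '' Xs P ℱ S 1) := by
  exact ⟨fun h T => bdd_of_na1s hS_adapted hS_cadlag hS_nonneg h T, na1s_of_bdd⟩

end
end

section
/- Condition NA1_s holds if and only if, for every finite stopping time T, the set {X_T : X ∈ 𝒳_s(1)} is bounded in probability. -/
open MeasureTheory Set Filter
open scoped NNReal ENNReal Topology

noncomputable section

variable {Ω : Type*} {m : MeasurableSpace Ω}

namespace NA1Aux

/-- Pathwise wealth. -/
def pw {d : ℕ} (n : ℕ) (τ : ℕ → ℝ≥0) (ϑ : ℕ → Fin d → ℝ) (s : ℝ≥0 → Fin d → ℝ) (x : ℝ)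
    (t : ℝ≥0) : ℝ :=
  x + ∑ j ∈ Finset.range n, ∑ i, ϑ j i * (s (min (τ (j + 1)) t) i - s (min (τ j) t) i)

/-- Pathwise (right-continuous) holdings. -/
def hold {d : ℕ} (n : ℕ) (τ : ℕ → ℝ≥0) (ϑ : ℕ → Fin d → ℝ) (t : ℝ≥0) (i : Fin d) : ℝ :=
  ∑ j ∈ Finset.range n, if τ j ≤ t ∧ t < τ (j + 1) then ϑ j i else 0

section path
variable {d : ℕ} {n : ℕ} {τ : ℕ → ℝ≥0} {ϑ : ℕ → Fin d → ℝ} {s : ℝ≥0 → Fin d → ℝ} {x : ℝ}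

lemma pw_step (hτ : Monotone τ) {j : ℕ} (hj : j < n) {t : ℝ≥0} (h1 : τ j ≤ t)
    (h2 : t ≤ τ (j + 1)) :
    pw n τ ϑ s x t = pw n τ ϑ s x (τ j) + ∑ i, ϑ j i * (s t i - s (τ j) i) := by
  have key : ∀ k ∈ Finset.range n,
      ∑ i, ϑ k i * (s (min (τ (k + 1)) t) i - s (min (τ k) t) i) =
      ∑ i, ϑ k i * (s (min (τ (k + 1)) (τ j)) i - s (min (τ k) (τ j)) i) +
        if k = j then ∑ i, ϑ j i * (s t i - s (τ j) i) else 0 := by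
    intro k _
    rcases lt_trichotomy k j with h | h | h
    · have a1 : τ (k + 1) ≤ τ j := hτ (by omega)
      have a2 : τ k ≤ τ j := hτ (by omega)
      simp [h.ne, a1, a2, a1.trans h1, a2.trans h1]
    · subst h
      simp [h1, h2, hτ (Nat.le_succ k)]
    · have a1 : τ (j + 1) ≤ τ k := hτ (by omega)
      have a2 : τ (j + 1) ≤ τ (k + 1) := hτ (by omega)
      have a3 : τ j ≤ τ (j + 1) := hτ (by omega)
      simp [h.ne', h2.trans a1, h2.trans a2, a3.trans a1, a3.trans a2]
  unfold pw
  rw [Finset.sum_congr rfl key, Finset.sum_add_distrib, Finset.sum_ite_eq']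
  simp [hj]
  ring

lemma pw_after (hτ : Monotone τ) {t : ℝ≥0} (h1 : τ n ≤ t) :
    pw n τ ϑ s x t = pw n τ ϑ s x (τ n) := by
  unfold pw
  congr 1
  refine Finset.sum_congr rfl fun k hk => ?_
  rw [Finset.mem_range] at hk
  have a1 : τ (k + 1) ≤ τ n := hτ (by omega)
  have a2 : τ k ≤ τ n := hτ (by omega)
  simp [a1, a2, a1.trans h1, a2.trans h1]

lemma pw_zero (t : ℝ≥0) : pw 0 τ ϑ s x t = x := by simp [pw]

lemma exists_between (h0 : τ 0 = 0) {t : ℝ≥0} (h : t < τ n) :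
    ∃ j < n, τ j ≤ t ∧ t < τ (j + 1) := by
  induction n with
  | zero => simp [h0] at h
  | succ n ih =>
    by_cases h' : t < τ n
    · obtain ⟨j, hj, hh⟩ := ih h'
      exact ⟨j, by omega, hh⟩
    · exact ⟨n, by omega, not_lt.1 h', h⟩

lemma hold_eq (hτ : Monotone τ) {j : ℕ} (hj : j < n) {t : ℝ≥0} (h1 : τ j ≤ t)
    (h2 : t < τ (j + 1)) (i : Fin d) : hold n τ ϑ t i = ϑ j i := by
  unfold hold
  rw [Finset.sum_eq_single j]
  · simp [h1, h2]
  · intro k _ hk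
    rw [if_neg]
    rintro ⟨b1, b2⟩
    rcases lt_or_gt_of_ne hk with h | h
    · exact absurd (b2.trans_le (hτ (show k + 1 ≤ j by omega))) (not_lt.2 h1)
    · exact absurd (h2.trans_le (hτ (show j + 1 ≤ k by omega))) (not_lt.2 b1)
  · simp [hj]

lemma hold_after (hτ : Monotone τ) {t : ℝ≥0} (h1 : τ n ≤ t) (i : Fin d) :
    hold n τ ϑ t i = 0 := by
  unfold hold
  refine Finset.sum_eq_zero fun k hk => ?_
  rw [Finset.mem_range] at hk
  rw [if_neg]
  rintro ⟨_, b2⟩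
  exact absurd (b2.trans_le (hτ (show k + 1 ≤ n by omega))) (not_lt.2 h1)

lemma hold_le_pw (hτ : Monotone τ)
    (hadm : ∀ j < n, (∀ i, 0 ≤ ϑ j i) ∧ ∑ i, ϑ j i * s (τ j) i ≤ pw n τ ϑ s x (τ j))
    {j : ℕ} (hj : j < n) {t : ℝ≥0} (h1 : τ j ≤ t) (h2 : t ≤ τ (j + 1)) :
    ∑ i, ϑ j i * s t i ≤ pw n τ ϑ s x t := by
  rw [pw_step hτ hj h1 h2]
  have := (hadm j hj).2
  simp only [mul_sub, Finset.sum_sub_distrib]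
  linarith

lemma pw_nonneg (hτ : Monotone τ) (h0 : τ 0 = 0) (hx : 0 ≤ x) (hs : ∀ t i, 0 ≤ s t i)
    (hadm : ∀ j < n, (∀ i, 0 ≤ ϑ j i) ∧ ∑ i, ϑ j i * s (τ j) i ≤ pw n τ ϑ s x (τ j))
    (t : ℝ≥0) : 0 ≤ pw n τ ϑ s x t := by
  have key : ∀ j < n, ∀ t, τ j ≤ t → t ≤ τ (j + 1) → 0 ≤ pw n τ ϑ s x t := by
    intro j hj t h1 h2
    refine le_trans ?_ (hold_le_pw hτ hadm hj h1 h2)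
    exact Finset.sum_nonneg fun i _ => mul_nonneg ((hadm j hj).1 i) (hs t i)
  by_cases h : t < τ n
  · obtain ⟨j, hj, h1, h2⟩ := exists_between h0 h
    exact key j hj t h1 h2.le
  · rw [pw_after hτ (not_lt.1 h)]
    rcases n with _ | n
    · rw [pw_zero]; exact hx
    · exact key n (by omega) _ (hτ (by omega)) le_rfl

lemma hold_adm (hτ : Monotone τ) (h0 : τ 0 = 0) (hx : 0 ≤ x) (hs : ∀ t i, 0 ≤ s t i)
    (hadm : ∀ j < n, (∀ i, 0 ≤ ϑ j i) ∧ ∑ i, ϑ j i * s (τ j) i ≤ pw n τ ϑ s x (τ j))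
    (t : ℝ≥0) : (∀ i, 0 ≤ hold n τ ϑ t i) ∧
      ∑ i, hold n τ ϑ t i * s t i ≤ pw n τ ϑ s x t := by
  by_cases h : t < τ n
  · obtain ⟨j, hj, h1, h2⟩ := exists_between h0 h
    simp only [hold_eq hτ hj h1 h2]
    exact ⟨(hadm j hj).1, hold_le_pw hτ hadm hj h1 h2.le⟩
  · simp only [hold_after hτ (not_lt.1 h)]
    simpa using pw_nonneg hτ h0 hx hs hadm t

lemma telescope {ρ : ℕ → ℝ≥0} {K : ℕ} {a b : ℝ≥0} (hab : a ≤ b) (hρ : Monotone ρ)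
    (h0 : ρ 0 = 0)
    (hK : b ≤ ρ K) (ha : ∀ k < K, ¬ (ρ k < a ∧ a < ρ (k + 1)))
    (hb : ∀ k < K, ¬ (ρ k < b ∧ b < ρ (k + 1))) (g : ℝ≥0 → ℝ) (c : ℝ) :
    ∑ k ∈ Finset.range K, (if a ≤ ρ k ∧ ρ k < b then c else 0) * (g (ρ (k + 1)) - g (ρ k)) =
      c * (g b - g a) := by
  have e : ∀ k ∈ Finset.range K,
      (if a ≤ ρ k ∧ ρ k < b then c else 0) * (g (ρ (k + 1)) - g (ρ k)) =
      c * g (max a (min b (ρ (k + 1)))) - c * g (max a (min b (ρ k))) := by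
    intro k hk
    rw [Finset.mem_range] at hk
    have hm : ρ k ≤ ρ (k + 1) := hρ (by omega)
    have ha' := ha k hk
    have hb' := hb k hk
    split_ifs with h
    · have : ρ (k + 1) ≤ b := by
        by_contra hc
        exact hb' ⟨h.2, not_le.1 hc⟩
      rw [min_eq_right this, min_eq_right h.2.le, max_eq_right h.1, max_eq_right (h.1.trans hm)]
      ring
    · by_cases h1 : a ≤ ρ k
      · have h2 : b ≤ ρ k := by
          by_contra hc
          exact h ⟨h1, not_le.1 hc⟩
        rw [min_eq_left h2, min_eq_left (h2.trans hm)]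
        ring
      · have h2 : ρ (k + 1) ≤ a := by
          by_contra hc
          exact ha' ⟨not_le.1 h1, not_le.1 hc⟩
        rw [max_eq_left ((min_le_right _ _).trans h2),
          max_eq_left ((min_le_right _ _).trans (hm.trans h2))]
        ring
  rw [Finset.sum_congr rfl e, Finset.sum_range_sub (fun k => c * g (max a (min b (ρ k)))), h0,
    min_eq_left hK, max_eq_right hab]
  simp
  ring

lemma pw_refine (hτ : Monotone τ) {ρ : ℕ → ℝ≥0} {K : ℕ} (hρ : Monotone ρ) (h0 : ρ 0 = 0)
    (hK : τ n ≤ ρ K) (hr : ∀ k < K, ∀ j ≤ n, ¬ (ρ k < τ j ∧ τ j < ρ (k + 1))) (t : ℝ≥0) :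
    pw K ρ (fun k => hold n τ ϑ (ρ k)) s x t = pw n τ ϑ s x t := by
  unfold pw hold
  congr 1
  simp only [Finset.sum_mul]
  rw [Finset.sum_comm]
  conv_rhs => rw [Finset.sum_comm]
  refine Finset.sum_congr rfl fun i _ => ?_
  rw [Finset.sum_comm]
  refine Finset.sum_congr rfl fun j hj => ?_
  rw [Finset.mem_range] at hj
  exact telescope (hτ (Nat.le_succ j)) hρ h0 ((hτ hj).trans hK)
    (fun k hk => hr k hk j hj.le) (fun k hk => hr k hk (j + 1) hj)
    (fun u => s (min u t) i) (ϑ j i)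

lemma anti_ne (k : ℕ) : (Finset.HasAntidiagonal.antidiagonal k).Nonempty := ⟨(0, k), by simp⟩

/-- Merged sequence of times. -/
def mrg (σ τ : ℕ → ℝ≥0) (k : ℕ) : ℝ≥0 :=
  (Finset.HasAntidiagonal.antidiagonal k).inf' (anti_ne k) (fun p => max (σ p.1) (τ p.2))

lemma mrg_le_iff {σ τ : ℕ → ℝ≥0} {k : ℕ} {t : ℝ≥0} :
    mrg σ τ k ≤ t ↔ ∃ p ∈ Finset.HasAntidiagonal.antidiagonal k, σ p.1 ≤ t ∧ τ p.2 ≤ t := by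
  unfold mrg
  rw [Finset.inf'_le_iff]
  simp only [max_le_iff]

lemma mrg_mono {σ τ : ℕ → ℝ≥0} (hσ : Monotone σ) (hτ : Monotone τ) : Monotone (mrg σ τ) := by
  refine monotone_nat_of_le_succ fun k => ?_
  obtain ⟨⟨a, b⟩, hp, h1, h2⟩ := mrg_le_iff.1 (le_refl (mrg σ τ (k + 1)))
  rw [Finset.HasAntidiagonal.mem_antidiagonal] at hp
  refine mrg_le_iff.2 ?_
  simp only at hp h1 h2
  rcases a with _ | a
  · exact ⟨(0, k), by simp, h1, (hτ (by omega)).trans h2⟩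
  · exact ⟨(a, b), by simp; omega, (hσ (by omega)).trans h1, h2⟩

lemma mrg_zero {σ τ : ℕ → ℝ≥0} (hσ : σ 0 = 0) (hτ : τ 0 = 0) : mrg σ τ 0 = 0 := by
  simp [mrg, hσ, hτ]

lemma mrg_refine_left {σ τ : ℕ → ℝ≥0} (hσ : Monotone σ) (k j : ℕ) :
    ¬ (mrg σ τ k < σ j ∧ σ j < mrg σ τ (k + 1)) := by
  rintro ⟨h1, h2⟩
  obtain ⟨⟨a, b⟩, hp, h3, h4⟩ := mrg_le_iff.1 (le_refl (mrg σ τ k))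
  rw [Finset.HasAntidiagonal.mem_antidiagonal] at hp
  simp only at hp h3 h4
  refine absurd h2 (not_lt.2 (mrg_le_iff.2 ⟨(a + 1, b), by simp; omega, ?_, ?_⟩))
  · have : a < j := by
      by_contra hc
      exact absurd ((hσ (not_lt.1 hc)).trans h3) (not_le.2 h1)
    exact hσ this
  · exact h4.trans h1.le

lemma mrg_refine_right {σ τ : ℕ → ℝ≥0} (hτ : Monotone τ) (k j : ℕ) :
    ¬ (mrg σ τ k < τ j ∧ τ j < mrg σ τ (k + 1)) := by
  rintro ⟨h1, h2⟩
  obtain ⟨⟨a, b⟩, hp, h3, h4⟩ := mrg_le_iff.1 (le_refl (mrg σ τ k))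
  rw [Finset.HasAntidiagonal.mem_antidiagonal] at hp
  simp only at hp h3 h4
  refine absurd h2 (not_lt.2 (mrg_le_iff.2 ⟨(a, b + 1), by simp; omega, ?_, ?_⟩))
  · exact h3.trans h1.le
  · have : b < j := by
      by_contra hc
      exact absurd ((hτ (not_lt.1 hc)).trans h4) (not_le.2 h1)
    exact hτ this

lemma le_mrg {σ τ : ℕ → ℝ≥0} {M : ℝ≥0} {n p k : ℕ} (hk : n + p + 1 ≤ k)
    (hσ : ∀ j, n < j → M ≤ σ j) (hτ : ∀ j, p < j → M ≤ τ j) : M ≤ mrg σ τ k := by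
  obtain ⟨⟨a, b⟩, hp, h3, h4⟩ := mrg_le_iff.1 (le_refl (mrg σ τ k))
  rw [Finset.HasAntidiagonal.mem_antidiagonal] at hp
  simp only at hp h3 h4
  by_cases h : n < a
  · exact (hσ a h).trans h3
  · exact (hτ b (by omega)).trans h4

/-- Truncated sequence of times. -/
def ext (n : ℕ) (τ : ℕ → ℝ≥0) (M : ℝ≥0) (j : ℕ) : ℝ≥0 := if j ≤ n then τ j else M

lemma ext_of_le {M : ℝ≥0} {j : ℕ} (hj : j ≤ n) : ext n τ M j = τ j := if_pos hj

lemma ext_mono (hτ : Monotone τ) {M : ℝ≥0} (hM : τ n ≤ M) : Monotone (ext n τ M) := by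
  refine monotone_nat_of_le_succ fun k => ?_
  unfold ext
  split_ifs with h1 h2
  · exact hτ (by omega)
  · exact (hτ h1).trans hM
  · omega
  · exact le_rfl

end path

section meas
variable {ℱ : Filtration ℝ≥0 m} {d : ℕ}

lemma ind_meas {E : Type*} [MeasurableSpace E] [Zero E] {τ ρ κ : Ω → ℝ≥0}
    (hτ : IsStoppingTime ℱ (fun ω => (τ ω : WithTop ℝ≥0)))
    (hρ : IsStoppingTime ℱ (fun ω => (ρ ω : WithTop ℝ≥0)))
    (hκ : IsStoppingTime ℱ (fun ω => (κ ω : WithTop ℝ≥0)))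
    (h : ∀ ω, min (τ ω) (ρ ω) ≤ κ ω) {f : Ω → E}
    (hf : Measurable[hτ.measurableSpace] f) :
    Measurable[hκ.measurableSpace] ({ω | τ ω ≤ ρ ω}.indicator f) := by
  have hle : (hτ.min hρ).measurableSpace ≤ hκ.measurableSpace := by
    refine IsStoppingTime.measurableSpace_mono _ _ fun ω => ?_
    have := h ω
    simp only
    rw [← WithTop.coe_min]
    exact WithTop.coe_le_coe.2 this
  have e : {ω | τ ω ≤ ρ ω} = {ω | (τ ω : WithTop ℝ≥0) ≤ (ρ ω : WithTop ℝ≥0)} := by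
    ext ω; exact (WithTop.coe_le_coe (a := ρ ω) (b := τ ω)).symm
  have hset : MeasurableSet[hκ.measurableSpace] {ω | τ ω ≤ ρ ω} := by
    rw [e]
    exact hle _ (IsStoppingTime.measurableSet_stopping_time_le_min hτ hρ)
  intro B hB
  rw [Set.indicator_preimage, Set.ite]
  refine MeasurableSet.union ?_ ?_
  · rw [e]
    exact hle _ (hτ.measurableSet_inter_le hρ _ (hf hB))
  · exact MeasurableSet.diff (@measurable_const _ _ _ hκ.measurableSpace (0 : E) B hB) hset

lemma meas_Iic {m' : MeasurableSpace Ω} {f : Ω → ℝ≥0} (h : ∀ t, MeasurableSet (f ⁻¹' Iic t)) :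
    Measurable f := measurable_of_Iic h

lemma meas_nat_comp {m' : MeasurableSpace Ω} {k : Ω → ℕ} (hk : Measurable k) {f : ℕ → Ω → ℝ}
    (hf : ∀ n, Measurable (f n)) : Measurable (fun ω => f (k ω) ω) := by
  have : Measurable (fun p : ℕ × Ω => f p.1 p.2) :=
    measurable_from_prod_countable_right hf
  exact this.comp (hk.prodMk measurable_id)

lemma meas_lim {m' : MeasurableSpace Ω} {f : ℕ → Ω → ℝ} {g : Ω → ℝ}
    (hf : ∀ n, Measurable (f n)) (hg : Tendsto f atTop (𝓝 g)) : Measurable g :=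
  measurable_of_tendsto_metrizable hf hg

lemma meas_stopped {u : ℝ≥0 → Ω → ℝ} (hu : ∀ t, Measurable[ℱ t] (u t))
    (hc : ∀ ω t, ContinuousWithinAt (fun t => u t ω) (Set.Ici t) t) {τ : Ω → ℝ≥0}
    (hτ : IsStoppingTime ℱ (fun ω => (τ ω : WithTop ℝ≥0))) (N : ℝ≥0) :
    Measurable[ℱ N] (fun ω => u (min (τ ω) N) ω) := by
  have hσ : Measurable[ℱ N] (fun ω => min (τ ω) N) := by
    refine meas_Iic fun t => ?_
    have : (fun ω => min (τ ω) N) ⁻¹' Iic t =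
        if N ≤ t then univ else {ω | (τ ω : WithTop ℝ≥0) ≤ (t : WithTop ℝ≥0)} := by
      ext ω
      split_ifs with h
      · simp [h]
      · simp only [Set.mem_preimage, Set.mem_Iic, min_le_iff, h, or_false]
        exact WithTop.coe_le_coe.symm
    rw [this]
    split_ifs with h
    · exact MeasurableSet.univ
    · exact ℱ.mono (not_le.1 h).le _ (hτ t)
  set a : ℕ → Ω → ℝ≥0 := fun n ω =>
    min (((⌊(min (τ ω) N) * (n + 1)⌋₊ : ℝ≥0) + 1) / (n + 1)) N with ha
  have ham : ∀ n, Measurable[ℱ N] (fun ω => u (a n ω) ω) := by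
    intro n
    have h1 : Measurable[ℱ N] (fun ω => ⌊(min (τ ω) N) * ((n : ℝ≥0) + 1)⌋₊) :=
      Nat.measurable_floor.comp (Measurable.mul_const hσ _)
    exact meas_nat_comp h1 (f := fun k ω => u (min (((k : ℝ≥0) + 1) / (n + 1)) N) ω)
      (fun k => (hu _).mono (ℱ.mono (min_le_right _ _)) le_rfl)
  refine meas_lim ham ?_
  rw [tendsto_pi_nhds]
  intro ω
  have hge : ∀ n, min (τ ω) N ≤ a n ω := by
    intro n
    refine le_min ?_ (min_le_right _ _)
    rw [le_div_iff₀ (by positivity)]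
    exact (Nat.lt_floor_add_one _).le
  have hle : ∀ n, a n ω ≤ min (τ ω) N + 1 / ((n : ℝ≥0) + 1) := by
    intro n
    refine (min_le_left _ _).trans ?_
    rw [add_div]
    gcongr
    rw [div_le_iff₀ (by positivity)]
    exact Nat.floor_le (by positivity)
  have hlim : Tendsto (fun n => a n ω) atTop (𝓝 (min (τ ω) N)) := by
    refine tendsto_of_tendsto_of_tendsto_of_le_of_le tendsto_const_nhds ?_ hge hle
    have : Tendsto (fun n : ℕ => 1 / ((n : ℝ≥0) + 1)) atTop (𝓝 0) :=
      tendsto_one_div_add_atTop_nhds_zero_nat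
    simpa using this.const_add (min (τ ω) N)
  exact (hc ω (min (τ ω) N)).tendsto.comp
    (tendsto_nhdsWithin_iff.2 ⟨hlim, Eventually.of_forall hge⟩)

lemma wealth_eq (θ : SimpleStrategy ℱ d) (S : ℝ≥0 → Ω → Fin d → ℝ) (x : ℝ) (t : ℝ≥0) (ω : Ω) :
    θ.wealth S x t ω =
      pw θ.n (fun j => θ.τ j ω) (fun j => θ.ϑ j ω) (fun t => S t ω) x t := rfl

lemma τ_monotone (θ : SimpleStrategy ℱ d) (ω : Ω) : Monotone (fun j => θ.τ j ω) :=
  monotone_nat_of_le_succ fun j => θ.τ_mono j ω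

lemma wealth_meas {S : ℝ≥0 → Ω → Fin d → ℝ} (hS : StronglyAdapted ℱ S)
    (hc : ∀ ω, IsCadlag (fun t => S t ω)) (θ : SimpleStrategy ℱ d) (x : ℝ) (N : ℝ≥0) :
    Measurable[ℱ N] (θ.wealth S x N) := by
  have hst : ∀ j i, Measurable[ℱ N] (fun ω => S (min (θ.τ j ω) N) ω i) := fun j i =>
    meas_stopped (u := fun t ω => S t ω i)
      (fun t => (measurable_pi_apply i).comp (hS t).measurable)
      (fun ω t => ((continuous_apply i).continuousAt.comp_continuousWithinAt ((hc ω).1 t)))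
      (θ.τ_stopping j) N
  have hϑ : ∀ j i, Measurable[ℱ N] (fun ω => {ω | θ.τ j ω ≤ N}.indicator (θ.ϑ j) ω i) := by
    intro j i
    have h := ind_meas (θ.τ_stopping j) (isStoppingTime_const ℱ N) (isStoppingTime_const ℱ N)
      (fun ω => min_le_right _ _) (θ.ϑ_meas j)
    rw [IsStoppingTime.measurableSpace_const] at h
    exact (measurable_pi_apply i).comp h
  have e : θ.wealth S x N = fun ω => x + ∑ j ∈ Finset.range θ.n, ∑ i,
      {ω | θ.τ j ω ≤ N}.indicator (θ.ϑ j) ω i *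
        (S (min (θ.τ (j + 1) ω) N) ω i - S (min (θ.τ j ω) N) ω i) := by
    funext ω
    unfold SimpleStrategy.wealth
    congr 1
    refine Finset.sum_congr rfl fun j _ => Finset.sum_congr rfl fun i _ => ?_
    by_cases h : θ.τ j ω ≤ N
    · rw [Set.indicator_of_mem (by exact h)]
    · have h' := (not_le.1 h).le
      rw [min_eq_right h', min_eq_right (h'.trans (θ.τ_mono j ω))]
      simp
  rw [e]
  refine Measurable.const_add ?_ x
  refine Finset.measurable_fun_sum _ fun j _ => Finset.measurable_fun_sum _ fun i _ => ?_
  exact (hϑ j i).mul ((hst _ i).sub (hst _ i))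

lemma adm_iff {P : Measure Ω} {S : ℝ≥0 → Ω → Fin d → ℝ} {x : ℝ} {θ : SimpleStrategy ℱ d} :
    θ.Admissible P S x ↔ ∀ᵐ ω ∂P, ∀ j < θ.n, (∀ i, 0 ≤ θ.ϑ j ω i) ∧
      ∑ i, θ.ϑ j ω i * S (θ.τ j ω) ω i ≤ θ.wealth S x (θ.τ j ω) ω := by
  unfold SimpleStrategy.Admissible
  simp only [ae_all_iff]

/-- Holdings are adapted. -/
lemma hold_meas (θ : SimpleStrategy ℱ d) {ρ : Ω → ℝ≥0}
    (hρ : IsStoppingTime ℱ (fun ω => (ρ ω : WithTop ℝ≥0))) :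
    Measurable[hρ.measurableSpace]
      (fun ω => hold θ.n (fun j => θ.τ j ω) (fun j => θ.ϑ j ω) (ρ ω)) := by
  refine @measurable_pi_lambda _ _ _ hρ.measurableSpace _ _ fun i => ?_
  unfold hold
  refine Finset.measurable_fun_sum _ fun j _ => ?_
  have h := ind_meas (θ.τ_stopping j) hρ hρ (fun ω => min_le_right _ _) (θ.ϑ_meas j)
  have h' : Measurable[hρ.measurableSpace]
      (fun ω => {ω | θ.τ j ω ≤ ρ ω}.indicator (θ.ϑ j) ω i) := (measurable_pi_apply i).comp h
  have hs : MeasurableSet[hρ.measurableSpace] {ω | θ.τ (j + 1) ω ≤ ρ ω} := by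
    have := IsStoppingTime.measurableSet_stopping_time_le (θ.τ_stopping (j + 1)) hρ
    have e : {ω | θ.τ (j + 1) ω ≤ ρ ω} =
        {ω | (θ.τ (j + 1) ω : WithTop ℝ≥0) ≤ (ρ ω : WithTop ℝ≥0)} := by
      ext ω; exact (WithTop.coe_le_coe (a := ρ ω) (b := θ.τ (j + 1) ω)).symm
    rw [e]
    exact this
  have e : (fun ω => if θ.τ j ω ≤ ρ ω ∧ ρ ω < θ.τ (j + 1) ω then θ.ϑ j ω i else 0) =
      {ω | θ.τ (j + 1) ω ≤ ρ ω}ᶜ.indicator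
        (fun ω => {ω | θ.τ j ω ≤ ρ ω}.indicator (θ.ϑ j) ω i) := by
    funext ω
    by_cases h1 : θ.τ j ω ≤ ρ ω <;> by_cases h2 : ρ ω < θ.τ (j + 1) ω <;>
      simp [Set.indicator, h1, h2]
  rw [e]
  exact h'.indicator hs.compl

lemma ext_stopping (θ : SimpleStrategy ℱ d) {M : Ω → ℝ≥0}
    (hM : IsStoppingTime ℱ (fun ω => (M ω : WithTop ℝ≥0))) (j : ℕ) :
    IsStoppingTime ℱ (fun ω => ((ext θ.n (fun j => θ.τ j ω) (M ω) j : ℝ≥0) : WithTop ℝ≥0)) := by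
  unfold ext
  split_ifs with h
  · exact θ.τ_stopping j
  · exact hM

lemma mrg_stopping {σ τ : ℕ → Ω → ℝ≥0}
    (hσ : ∀ j, IsStoppingTime ℱ (fun ω => (σ j ω : WithTop ℝ≥0)))
    (hτ : ∀ j, IsStoppingTime ℱ (fun ω => (τ j ω : WithTop ℝ≥0))) (k : ℕ) :
    IsStoppingTime ℱ
      (fun ω => ((mrg (fun j => σ j ω) (fun j => τ j ω) k : ℝ≥0) : WithTop ℝ≥0)) := by
  intro t
  have : {ω | ((mrg (fun j => σ j ω) (fun j => τ j ω) k : ℝ≥0) : WithTop ℝ≥0) ≤ (t : WithTop ℝ≥0)}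
      = ⋃ p ∈ Finset.HasAntidiagonal.antidiagonal k,
        ({ω | (σ p.1 ω : WithTop ℝ≥0) ≤ (t : WithTop ℝ≥0)} ∩
          {ω | (τ p.2 ω : WithTop ℝ≥0) ≤ (t : WithTop ℝ≥0)}) := by
    ext ω
    simp only [Set.mem_ofPred_eq, WithTop.coe_le_coe, mrg_le_iff, Set.mem_iUnion, Set.mem_inter_iff,
      exists_prop]
  rw [this]
  exact Finset.measurableSet_biUnion _ fun p _ => (hσ _ t).inter (hτ _ t)

lemma max_stopping {σ τ : Ω → ℝ≥0}
    (hσ : IsStoppingTime ℱ (fun ω => (σ ω : WithTop ℝ≥0)))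
    (hτ : IsStoppingTime ℱ (fun ω => (τ ω : WithTop ℝ≥0))) :
    IsStoppingTime ℱ (fun ω => ((max (σ ω) (τ ω) : ℝ≥0) : WithTop ℝ≥0)) := by
  have := hσ.max hτ
  simpa only [WithTop.coe_max] using this

lemma min_stopping {σ τ : Ω → ℝ≥0}
    (hσ : IsStoppingTime ℱ (fun ω => (σ ω : WithTop ℝ≥0)))
    (hτ : IsStoppingTime ℱ (fun ω => (τ ω : WithTop ℝ≥0))) :
    IsStoppingTime ℱ (fun ω => ((min (σ ω) (τ ω) : ℝ≥0) : WithTop ℝ≥0)) := by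
  have := hσ.min hτ
  simpa only [WithTop.coe_min] using this

/-- Common refinement times. -/
def sumτ (θ η : SimpleStrategy ℱ d) (k : ℕ) (ω : Ω) : ℝ≥0 :=
  mrg (fun j => ext θ.n (fun j => θ.τ j ω) (max (θ.τ θ.n ω) (η.τ η.n ω)) j)
    (fun j => ext η.n (fun j => η.τ j ω) (max (θ.τ θ.n ω) (η.τ η.n ω)) j) k

lemma sumτ_stopping (θ η : SimpleStrategy ℱ d) (k : ℕ) :
    IsStoppingTime ℱ (fun ω => (sumτ θ η k ω : WithTop ℝ≥0)) :=
  mrg_stopping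
    (fun j => ext_stopping θ (max_stopping (θ.τ_stopping θ.n) (η.τ_stopping η.n)) j)
    (fun j => ext_stopping η (max_stopping (θ.τ_stopping θ.n) (η.τ_stopping η.n)) j) k

lemma sumτ_mono (θ η : SimpleStrategy ℱ d) (ω : Ω) : Monotone (fun k => sumτ θ η k ω) :=
  mrg_mono (ext_mono (τ_monotone θ ω) (le_max_left _ _))
    (ext_mono (τ_monotone η ω) (le_max_right _ _))

lemma sumτ_zero (θ η : SimpleStrategy ℱ d) (ω : Ω) : sumτ θ η 0 ω = 0 :=
  mrg_zero (by simp [ext, θ.τ_zero]) (by simp [ext, η.τ_zero])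

lemma sumτ_last (θ η : SimpleStrategy ℱ d) (ω : Ω) :
    max (θ.τ θ.n ω) (η.τ η.n ω) ≤ sumτ θ η (θ.n + η.n + 1) ω :=
  le_mrg le_rfl (fun j hj => by simp [ext, not_le.2 hj]) (fun j hj => by simp [ext, not_le.2 hj])

/-- Sum of two strategies. -/
def sumS (θ η : SimpleStrategy ℱ d) : SimpleStrategy ℱ d where
  n := θ.n + η.n + 1
  τ := sumτ θ η
  ϑ := fun k ω i => hold θ.n (fun j => θ.τ j ω) (fun j => θ.ϑ j ω) (sumτ θ η k ω) i +
    hold η.n (fun j => η.τ j ω) (fun j => η.ϑ j ω) (sumτ θ η k ω) i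
  τ_zero := sumτ_zero θ η
  τ_mono := fun j ω => sumτ_mono θ η ω (Nat.le_succ j)
  τ_stopping := sumτ_stopping θ η
  ϑ_meas := fun j => (hold_meas θ (sumτ_stopping θ η j)).add (hold_meas η (sumτ_stopping θ η j))

lemma sumS_wealth (θ η : SimpleStrategy ℱ d) (S : ℝ≥0 → Ω → Fin d → ℝ) (x y : ℝ) (t : ℝ≥0)
    (ω : Ω) : (sumS θ η).wealth S (x + y) t ω = θ.wealth S x t ω + η.wealth S y t ω := by
  have h1 : pw (θ.n + η.n + 1) (fun k => sumτ θ η k ω)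
      (fun k => hold θ.n (fun j => θ.τ j ω) (fun j => θ.ϑ j ω) (sumτ θ η k ω))
      (fun t => S t ω) x t = θ.wealth S x t ω := by
    refine pw_refine (τ_monotone θ ω) (sumτ_mono θ η ω) (sumτ_zero θ η ω)
      ((le_max_left _ _).trans (sumτ_last θ η ω)) (fun k _ j hj => ?_) t
    have := mrg_refine_left (τ := fun j => ext η.n (fun j => η.τ j ω)
      (max (θ.τ θ.n ω) (η.τ η.n ω)) j)
      (ext_mono (n := θ.n) (τ_monotone θ ω) (le_max_left _ (η.τ η.n ω))) k j
    rw [ext_of_le hj] at this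
    exact this
  have h2 : pw (θ.n + η.n + 1) (fun k => sumτ θ η k ω)
      (fun k => hold η.n (fun j => η.τ j ω) (fun j => η.ϑ j ω) (sumτ θ η k ω))
      (fun t => S t ω) y t = η.wealth S y t ω := by
    refine pw_refine (τ_monotone η ω) (sumτ_mono θ η ω) (sumτ_zero θ η ω)
      ((le_max_right _ _).trans (sumτ_last θ η ω)) (fun k _ j hj => ?_) t
    have := mrg_refine_right (σ := fun j => ext θ.n (fun j => θ.τ j ω)
      (max (θ.τ θ.n ω) (η.τ η.n ω)) j)
      (ext_mono (n := η.n) (τ_monotone η ω) (le_max_right (θ.τ θ.n ω) _)) k j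
    rw [ext_of_le hj] at this
    exact this
  rw [← h1, ← h2, wealth_eq]
  simp only [pw, sumS, add_mul, Finset.sum_add_distrib]
  ring

section adm
variable {P : Measure Ω} {S : ℝ≥0 → Ω → Fin d → ℝ}

lemma Xs_nonneg (hS : ∀ t ω i, 0 ≤ S t ω i) {x : ℝ} (hx : 0 ≤ x) {X : ℝ≥0 → Ω → ℝ}
    (hX : X ∈ Xs P ℱ S x) : ∀ᵐ ω ∂P, ∀ t, 0 ≤ X t ω := by
  obtain ⟨θ, hθ, rfl⟩ := hX
  filter_upwards [adm_iff.1 hθ] with ω h t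
  exact pw_nonneg (τ_monotone θ ω) (θ.τ_zero ω) hx (fun t i => hS t ω i) h t

lemma Xs_add (hS : ∀ t ω i, 0 ≤ S t ω i) {x y : ℝ} (hx : 0 ≤ x) (hy : 0 ≤ y)
    {X Y : ℝ≥0 → Ω → ℝ} (hX : X ∈ Xs P ℱ S x) (hY : Y ∈ Xs P ℱ S y) :
    X + Y ∈ Xs P ℱ S (x + y) := by
  obtain ⟨θ, hθ, rfl⟩ := hX
  obtain ⟨η, hη, rfl⟩ := hY
  refine ⟨sumS θ η, adm_iff.2 ?_, ?_⟩
  · filter_upwards [adm_iff.1 hθ, adm_iff.1 hη] with ω h1 h2 k _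
    have a1 := hold_adm (τ_monotone θ ω) (θ.τ_zero ω) hx (fun t i => hS t ω i) h1 (sumτ θ η k ω)
    have a2 := hold_adm (τ_monotone η ω) (η.τ_zero ω) hy (fun t i => hS t ω i) h2 (sumτ θ η k ω)
    refine ⟨fun i => add_nonneg (a1.1 i) (a2.1 i), ?_⟩
    rw [sumS_wealth]
    simp only [sumS, add_mul, Finset.sum_add_distrib]
    exact add_le_add a1.2 a2.2
  · funext t ω
    rw [sumS_wealth]
    rfl

lemma Xs_smul {x c : ℝ} (hc : 0 ≤ c) {X : ℝ≥0 → Ω → ℝ} (hX : X ∈ Xs P ℱ S x) :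
    (fun t ω => c * X t ω) ∈ Xs P ℱ S (c * x) := by
  obtain ⟨θ, hθ, rfl⟩ := hX
  let η : SimpleStrategy ℱ d := { θ with
    ϑ := fun j ω i => c * θ.ϑ j ω i
    ϑ_meas := fun j => (θ.ϑ_meas j).const_smul c }
  have hw : ∀ t ω, η.wealth S (c * x) t ω = c * θ.wealth S x t ω := by
    intro t ω
    simp only [SimpleStrategy.wealth, η, mul_add, Finset.mul_sum, mul_assoc]
  refine ⟨η, adm_iff.2 ?_, ?_⟩
  · filter_upwards [adm_iff.1 hθ] with ω h j hj
    refine ⟨fun i => mul_nonneg hc ((h j hj).1 i), ?_⟩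
    rw [hw]
    simp only [η, mul_assoc, ← Finset.mul_sum]
    exact mul_le_mul_of_nonneg_left (h j hj).2 hc
  · funext t ω
    exact (hw t ω).symm

lemma Xs_shift {x y : ℝ} (hxy : x ≤ y) {X : ℝ≥0 → Ω → ℝ} (hX : X ∈ Xs P ℱ S x) :
    (fun t ω => X t ω + (y - x)) ∈ Xs P ℱ S y := by
  obtain ⟨θ, hθ, rfl⟩ := hX
  have hw : ∀ t ω, θ.wealth S y t ω = θ.wealth S x t ω + (y - x) := by
    intro t ω
    simp only [SimpleStrategy.wealth]
    ring
  refine ⟨θ, adm_iff.2 ?_, ?_⟩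
  · filter_upwards [adm_iff.1 hθ] with ω h j hj
    refine ⟨(h j hj).1, ?_⟩
    rw [hw]
    linarith [(h j hj).2]
  · funext t ω
    exact (hw t ω).symm

lemma Xs_zero : (0 : ℝ≥0 → Ω → ℝ) ∈ Xs P ℱ S 0 := by
  let η : SimpleStrategy ℱ d :=
    { n := 0
      τ := fun _ _ => 0
      ϑ := fun _ _ _ => 0
      τ_zero := fun _ => rfl
      τ_mono := fun _ _ => le_rfl
      τ_stopping := fun _ => isStoppingTime_const ℱ 0
      ϑ_meas := fun _ => measurable_const }
  refine ⟨η, fun j hj => absurd hj (Nat.not_lt_zero j), ?_⟩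
  funext t ω
  simp [SimpleStrategy.wealth, η]

lemma Xs_sum (hS : ∀ t ω i, 0 ≤ S t ω i) {x : ℕ → ℝ} (hx : ∀ k, 0 ≤ x k)
    {X : ℕ → ℝ≥0 → Ω → ℝ} (hX : ∀ k, X k ∈ Xs P ℱ S (x k)) (s : Finset ℕ) :
    ∑ k ∈ s, X k ∈ Xs P ℱ S (∑ k ∈ s, x k) := by
  induction s using Finset.induction_on with
  | empty => simpa using Xs_zero
  | insert a s ha ih =>
    rw [Finset.sum_insert ha, Finset.sum_insert ha]
    exact Xs_add hS (hx a) (Finset.sum_nonneg fun k _ => hx k) (hX a) ih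

lemma Xs_frozenAt (hS : ∀ t ω i, 0 ≤ S t ω i) {x : ℝ} (hx : 0 ≤ x) {X : ℝ≥0 → Ω → ℝ}
    (hX : X ∈ Xs P ℱ S x) {T : Ω → ℝ≥0}
    (hT : IsStoppingTime ℱ (fun ω => (T ω : WithTop ℝ≥0))) :
    (fun t ω => X (min (T ω) t) ω) ∈ Xs P ℱ S x := by
  have hnn := Xs_nonneg hS hx hX
  obtain ⟨θ, hθ, rfl⟩ := hX
  let η : SimpleStrategy ℱ d :=
    { n := θ.n
      τ := fun j ω => min (θ.τ j ω) (T ω)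
      ϑ := fun j => {ω | θ.τ j ω ≤ T ω}.indicator (θ.ϑ j)
      τ_zero := fun ω => by simp [θ.τ_zero]
      τ_mono := fun j ω => min_le_min_right _ (θ.τ_mono j ω)
      τ_stopping := fun j => min_stopping (θ.τ_stopping j) hT
      ϑ_meas := fun j => ind_meas _ hT _ (fun ω => le_rfl) (θ.ϑ_meas j) }
  have hw : ∀ t ω, η.wealth S x t ω = θ.wealth S x (min (T ω) t) ω := by
    intro t ω
    simp only [SimpleStrategy.wealth, η]
    congr 1
    refine Finset.sum_congr rfl fun j _ => Finset.sum_congr rfl fun i _ => ?_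
    by_cases h : θ.τ j ω ≤ T ω
    · rw [Set.indicator_of_mem (by exact h), min_assoc, min_assoc]
    · have h' := (not_le.1 h).le
      rw [Set.indicator_of_notMem (by exact h), ← min_assoc, ← min_assoc, min_eq_right h',
        min_eq_right (h'.trans (θ.τ_mono j ω))]
      simp
  refine ⟨η, adm_iff.2 ?_, ?_⟩
  · filter_upwards [adm_iff.1 hθ, hnn] with ω h hn j hj
    rw [hw]
    simp only [η]
    by_cases hh : θ.τ j ω ≤ T ω
    · rw [Set.indicator_of_mem (by exact hh), min_eq_left hh, min_eq_right hh]
      exact h j hj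
    · rw [Set.indicator_of_notMem (by exact hh)]
      simpa using hn _
  · funext t ω
    exact (hw t ω).symm

end adm
end meas

lemma exists_inter (P : Measure Ω) [IsProbabilityMeasure P] {B : ℕ → Set Ω}
    (hB : ∀ k, MeasurableSet (B k)) {ε : ℝ≥0∞} (hε : 0 < ε) (h : ∀ k, ε ≤ P (B k)) :
    ∃ r : ℕ → ℕ, 0 < P (⋂ n, ⋃ k ∈ Finset.Ico n (r n), B k) := by
  obtain ⟨δ, hδ, hsum⟩ := ENNReal.exists_pos_sum_of_countable hε.ne' ℕ
  have hr : ∀ n, ∃ r : ℕ, P ((⋃ k ≥ n, B k) \ ⋃ k ∈ Finset.Ico n r, B k) ≤ δ n := by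
    intro n
    have ht : Tendsto (fun r : ℕ => P ((⋃ k ≥ n, B k) \ ⋃ k ∈ Finset.Ico n r, B k)) atTop
        (𝓝 (P (⋂ r : ℕ, ((⋃ k ≥ n, B k) \ ⋃ k ∈ Finset.Ico n r, B k)))) := by
      refine tendsto_measure_iInter_atTop (fun r => ?_) ?_ ⟨0, measure_ne_top _ _⟩
      · refine MeasurableSet.nullMeasurableSet (MeasurableSet.diff ?_ ?_)
        · exact MeasurableSet.iUnion fun k => MeasurableSet.iUnion fun _ => hB k
        · exact Finset.measurableSet_biUnion _ fun k _ => hB k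
      · intro r r' hrr
        refine Set.sdiff_subset_sdiff_right ?_
        exact Set.biUnion_subset_biUnion_left (Finset.Ico_subset_Ico_right hrr)
    have he : (⋂ r : ℕ, ((⋃ k ≥ n, B k) \ ⋃ k ∈ Finset.Ico n r, B k)) = ∅ := by
      refine Set.eq_empty_of_forall_notMem fun ω hω => ?_
      rw [Set.mem_iInter] at hω
      obtain ⟨k, hk, hk'⟩ := Set.mem_iUnion₂.1 (hω 0).1
      exact (hω (k + 1)).2
        (Set.mem_iUnion₂.2 ⟨k, Finset.mem_Ico.2 ⟨hk, Nat.lt_succ_self k⟩, hk'⟩)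
    rw [he, measure_empty] at ht
    have hpos : (0 : ℝ≥0∞) < δ n := by exact_mod_cast hδ n
    exact ((ENNReal.tendsto_nhds_zero.1 ht) _ hpos).exists
  choose r hr using hr
  refine ⟨r, ?_⟩
  set A := ⋂ n, ⋃ k ∈ Finset.Ico n (r n), B k with hA
  set L := ⋂ n, ⋃ k ≥ n, B k with hL
  have hPL : ε ≤ P L := by
    have ht : Tendsto (fun n : ℕ => P (⋃ k ≥ n, B k)) atTop (𝓝 (P L)) := by
      refine tendsto_measure_iInter_atTop (fun r => ?_) ?_ ⟨0, measure_ne_top _ _⟩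
      · exact MeasurableSet.nullMeasurableSet
          (MeasurableSet.iUnion fun k => MeasurableSet.iUnion fun _ => hB k)
      · intro a b hab
        exact Set.biUnion_subset_biUnion_left fun k (hk : b ≤ k) => hab.trans hk
    refine ge_of_tendsto' ht fun n => (h n).trans (measure_mono ?_)
    exact fun ω hω => Set.mem_iUnion₂.2 ⟨n, le_refl n, hω⟩
  have hsub : L ⊆ A ∪ ⋃ n, ((⋃ k ≥ n, B k) \ ⋃ k ∈ Finset.Ico n (r n), B k) := by
    intro ω hω
    by_cases hωA : ω ∈ A
    · exact Or.inl hωA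
    · right
      rw [hA, Set.mem_iInter] at hωA
      push Not at hωA
      obtain ⟨n, hn⟩ := hωA
      exact Set.mem_iUnion.2 ⟨n, Set.mem_iInter.1 hω n, hn⟩
  by_contra hc
  have hA0 : P A = 0 := by simpa using hc
  have : ε < ε := calc
    ε ≤ P L := hPL
    _ ≤ P A + P (⋃ n, ((⋃ k ≥ n, B k) \ ⋃ k ∈ Finset.Ico n (r n), B k)) :=
      (measure_mono hsub).trans (measure_union_le _ _)
    _ ≤ 0 + ∑' n, (δ n : ℝ≥0∞) := by
      rw [hA0]
      exact add_le_add le_rfl ((measure_iUnion_le _).trans (ENNReal.tsum_le_tsum hr))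
    _ < ε := by rw [zero_add]; exact hsum
  exact lt_irrefl _ this

section main
variable {P : Measure Ω} [IsProbabilityMeasure P] {ℱ : Filtration ℝ≥0 m} {d : ℕ}
  {S : ℝ≥0 → Ω → Fin d → ℝ}

lemma not_arb (T : ℝ≥0)
    (h : BddInProb P ((fun X : ℝ≥0 → Ω → ℝ => fun ω => X T ω) '' Xs P ℱ S 1)) (ξ : Ω → ℝ) :
    ¬ ArbitrageOfFirstKind P ℱ S T ξ := by
  rintro ⟨-, -, hpos, hx⟩
  obtain ⟨ℓ, hℓ, hℓ0⟩ := ((h.eventually (gt_mem_nhds hpos)).and (eventually_gt_atTop 0)).exists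
  refine absurd hℓ (not_lt.2 ?_)
  have hU : {ω | 0 < ξ ω} = ⋃ n : ℕ, {ω | ℓ / (n + 1) < ξ ω} := by
    ext ω
    simp only [Set.mem_ofPred_eq, Set.mem_iUnion]
    constructor
    · intro hω
      obtain ⟨n, hn⟩ := exists_nat_gt (ℓ / ξ ω)
      refine ⟨n, ?_⟩
      rw [div_lt_iff₀ hω] at hn
      rw [div_lt_iff₀ (by positivity)]
      nlinarith
    · rintro ⟨n, hn⟩
      exact lt_trans (by positivity) hn
  have hmono : Monotone fun n : ℕ => {ω | ℓ / ((n : ℝ) + 1) < ξ ω} := by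
    intro a b hab ω hω
    have hab' : (a : ℝ) ≤ b := by exact_mod_cast hab
    have : ℓ / ((b : ℝ) + 1) ≤ ℓ / ((a : ℝ) + 1) := by gcongr
    exact lt_of_le_of_lt this hω
  rw [hU, hmono.measure_iUnion]
  refine iSup_le fun n => ?_
  obtain ⟨X, hX, hXξ⟩ := hx (1 / ((n : ℝ) + 1)) (by positivity)
  have hX' := Xs_smul (c := (n : ℝ) + 1) (by positivity) hX
  rw [mul_one_div_cancel (by positivity)] at hX'
  refine le_trans ?_ (le_iSup₂ (f := fun f (_ : f ∈ ((fun X : ℝ≥0 → Ω → ℝ => fun ω => X T ω) ''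
    Xs P ℱ S 1)) => P {ω | ℓ < |f ω|}) _ ⟨_, hX', rfl⟩)
  refine measure_mono_ae ?_
  filter_upwards [hXξ] with ω h1 h2
  have h2' : ℓ / ((n : ℝ) + 1) < ξ ω := h2
  rw [div_lt_iff₀ (by positivity)] at h2'
  show ℓ < |((n : ℝ) + 1) * X T ω|
  refine lt_of_lt_of_le ?_ (le_abs_self _)
  have : ξ ω * ((n : ℝ) + 1) ≤ X T ω * ((n : ℝ) + 1) := by gcongr
  linarith

lemma bdd_of_na (hS_adapted : StronglyAdapted ℱ S) (hS_cadlag : ∀ ω, IsCadlag (fun t => S t ω))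
    (hS : ∀ t ω i, 0 ≤ S t ω i) (hNA : NA1s P ℱ S) (T : Ω → ℝ≥0)
    (hT : IsStoppingTime ℱ (fun ω => (T ω : WithTop ℝ≥0))) :
    BddInProb P ((fun X : ℝ≥0 → Ω → ℝ => fun ω => X (T ω) ω) '' Xs P ℱ S 1) := by
  unfold BddInProb
  rw [ENNReal.tendsto_nhds_zero]
  intro ε hε
  suffices hs : ∃ ℓ : ℝ, (⨆ f ∈ ((fun X : ℝ≥0 → Ω → ℝ => fun ω => X (T ω) ω) '' Xs P ℱ S 1),
      P {ω | ℓ < |f ω|}) ≤ ε by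
    obtain ⟨ℓ, hℓ⟩ := hs
    filter_upwards [eventually_ge_atTop ℓ] with ℓ' hℓ'
    refine le_trans (iSup₂_mono fun f _ => measure_mono fun ω hω => ?_) hℓ
    exact lt_of_le_of_lt hℓ' hω
  by_contra hcon
  push Not at hcon
  have hex : ∀ k : ℕ, ∃ X ∈ Xs P ℱ S 1, ε < P {ω | (2 : ℝ) ^ k < |X (T ω) ω|} := by
    intro k
    have := hcon (2 ^ k)
    simp only [lt_iSup_iff] at this
    obtain ⟨f, ⟨X, hX, rfl⟩, hlt⟩ := this
    exact ⟨X, hX, hlt⟩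
  choose X hX hXε using hex
  have hεtop : ε ≠ ⊤ := ne_top_of_lt (hXε 0)
  have hε2 : 0 < ε / 2 := ENNReal.half_pos hε.ne'
  obtain ⟨N, hN⟩ : ∃ N : ℕ, P {ω | (N : ℝ≥0) < T ω} ≤ ε / 2 := by
    have ht : Tendsto (fun n : ℕ => P {ω | (n : ℝ≥0) < T ω}) atTop
        (𝓝 (P (⋂ n : ℕ, {ω | (n : ℝ≥0) < T ω}))) := by
      refine tendsto_measure_iInter_atTop (fun n => ?_) ?_ ⟨0, measure_ne_top _ _⟩
      · refine MeasurableSet.nullMeasurableSet ?_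
        have h1 := ℱ.le n _ (hT (n : ℝ≥0))
        have e : {ω | (n : ℝ≥0) < T ω} =
            {ω | (T ω : WithTop ℝ≥0) ≤ ((n : ℝ≥0) : WithTop ℝ≥0)}ᶜ := by
          ext ω
          rw [Set.mem_compl_iff, Set.mem_ofPred_eq, Set.mem_ofPred_eq, WithTop.coe_le_coe, not_le]
        rw [e]
        exact h1.compl
      · intro a b hab ω hω
        have hab' : (a : ℝ≥0) ≤ b := by exact_mod_cast hab
        exact lt_of_le_of_lt hab' hω
    have he : (⋂ n : ℕ, {ω | (n : ℝ≥0) < T ω}) = ∅ := by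
      refine Set.eq_empty_of_forall_notMem fun ω hω => ?_
      rw [Set.mem_iInter] at hω
      obtain ⟨n, hn⟩ := exists_nat_gt (T ω)
      exact absurd (hω n) (not_lt.2 hn.le)
    rw [he, measure_empty] at ht
    exact ((ENNReal.tendsto_nhds_zero.1 ht) _ hε2).exists
  set Y : ℕ → ℝ≥0 → Ω → ℝ := fun k t ω => (1 / 2 : ℝ) ^ k * X k (min (T ω) t) ω with hYdef
  have hY : ∀ k, Y k ∈ Xs P ℱ S ((1 / 2 : ℝ) ^ k) := by
    intro k
    have := Xs_smul (c := (1 / 2 : ℝ) ^ k) (by positivity) (Xs_frozenAt hS zero_le_one (hX k) hT)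
    rwa [mul_one] at this
  have hYnn : ∀ᵐ ω ∂P, ∀ k t, 0 ≤ Y k t ω := by
    rw [ae_all_iff]
    exact fun k => Xs_nonneg hS (by positivity) (hY k)
  have hYm : ∀ k, Measurable[ℱ N] (Y k N) := by
    intro k
    obtain ⟨θ, -, hθ⟩ := hY k
    rw [hθ]
    exact wealth_meas hS_adapted hS_cadlag θ _ _
  set B : ℕ → Set Ω := fun k => {ω | 1 < Y k N ω} with hB
  have hBm : ∀ k, MeasurableSet[ℱ N] (B k) := fun k => hYm k measurableSet_Ioi
  have hBP : ∀ k, ε / 2 ≤ P (B k) := by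
    intro k
    have h1 : P {ω | (2 : ℝ) ^ k < |X k (T ω) ω|} ≤ P ({ω | (N : ℝ≥0) < T ω} ∪ B k) := by
      refine measure_mono_ae ?_
      filter_upwards [Xs_nonneg hS zero_le_one (hX k)] with ω hnn hω
      by_cases hTN : (N : ℝ≥0) < T ω
      · exact Or.inl hTN
      · right
        have hω' : (2 : ℝ) ^ k < |X k (T ω) ω| := hω
        rw [abs_of_nonneg (hnn _)] at hω'
        show 1 < (1 / 2 : ℝ) ^ k * X k (min (T ω) N) ω
        rw [min_eq_left (not_lt.1 hTN), one_div, inv_pow, inv_mul_eq_div,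
          lt_div_iff₀ (by positivity), one_mul]
        exact hω'
    have h2 : ε / 2 + ε / 2 ≤ ε / 2 + P (B k) := by
      rw [ENNReal.add_halves]
      exact (hXε k).le.trans (h1.trans ((measure_union_le _ _).trans (add_le_add hN le_rfl)))
    exact (ENNReal.add_le_add_iff_left (ENNReal.div_ne_top hεtop (by norm_num))).1 h2
  obtain ⟨r, hr⟩ := exists_inter P (fun k => ℱ.le _ _ (hBm k)) hε2 hBP
  set A := ⋂ n, ⋃ k ∈ Finset.Ico n (r n), B k with hA
  have hAm : MeasurableSet[ℱ N] A :=
    MeasurableSet.iInter fun n => Finset.measurableSet_biUnion _ fun k _ => hBm k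
  refine hNA N (A.indicator fun _ => (1 : ℝ)) ⟨measurable_const.indicator hAm, ?_, ?_, ?_⟩
  · exact Eventually.of_forall fun ω => Set.indicator_nonneg (fun _ _ => zero_le_one) ω
  · refine lt_of_lt_of_le hr (measure_mono fun ω hω => ?_)
    show 0 < A.indicator (fun _ => (1 : ℝ)) ω
    rw [Set.indicator_of_mem hω]
    exact zero_lt_one
  · intro x hx
    obtain ⟨n, hn⟩ := exists_pow_lt_of_lt_one (show 0 < x / 2 by positivity)
      (show (1 / 2 : ℝ) < 1 by norm_num)
    have hsum : ∑ k ∈ Finset.Ico n (r n), (1 / 2 : ℝ) ^ k ≤ x := by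
      rw [Finset.sum_Ico_eq_sum_range]
      simp only [pow_add]
      rw [← Finset.mul_sum]
      have h1 := sum_geometric_two_le (r n - n)
      have h2 : (0 : ℝ) ≤ (1 / 2) ^ n := by positivity
      nlinarith
    have hZ := Xs_shift hsum (Xs_sum hS (fun k => by positivity) hY (Finset.Ico n (r n)))
    refine ⟨_, hZ, ?_⟩
    filter_upwards [hYnn] with ω hω
    simp only [Finset.sum_apply]
    have hnn : ∀ k ∈ Finset.Ico n (r n), 0 ≤ Y k N ω := fun k _ => hω k N
    have h0 : 0 ≤ ∑ k ∈ Finset.Ico n (r n), Y k N ω := Finset.sum_nonneg hnn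
    by_cases hωA : ω ∈ A
    · rw [Set.indicator_of_mem hωA]
      obtain ⟨k, hk, hk'⟩ := Set.mem_iUnion₂.1 (Set.mem_iInter.1 hωA n)
      have h1 : 1 < Y k N ω := hk'
      have h2 := Finset.single_le_sum hnn hk
      linarith
    · rw [Set.indicator_of_notMem hωA]
      linarith

end main

end NA1Aux

/-- **Remark 2.1.** Condition NA1_s holds if and only if, for every finite stopping time `T`,
the set `{X_T : X ∈ 𝒳_s(1)}` is bounded in probability. -/
theorem na1s_iff_bddInProb_stoppingTime
    {Ω : Type*} {m : MeasurableSpace Ω} (P : MeasureTheory.Measure Ω)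
    [MeasureTheory.IsProbabilityMeasure P] (ℱ : MeasureTheory.Filtration ℝ≥0 m)
    (hright : RightContinuousFiltration ℱ) (hcompl : CompleteFiltration ℱ P)
    (d : ℕ) (S : ℝ≥0 → Ω → Fin d → ℝ)
    (hS_adapted : MeasureTheory.StronglyAdapted ℱ S)
    (hS_cadlag : ∀ ω, IsCadlag (fun t => S t ω))
    (hS_nonneg : ∀ t ω i, 0 ≤ S t ω i) :
    NA1s P ℱ S ↔
      ∀ T : Ω → ℝ≥0, MeasureTheory.IsStoppingTime ℱ (fun ω => (T ω : WithTop ℝ≥0)) →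
        BddInProb P ((fun X : ℝ≥0 → Ω → ℝ => fun ω => X (T ω) ω) '' Xs P ℱ S 1) := by
  constructor
  · intro h T hT
    exact NA1Aux.bdd_of_na hS_adapted hS_cadlag hS_nonneg h T hT
  · intro h T ξ
    exact NA1Aux.not_arb T (h (fun _ => T) (isStoppingTime_const ℱ T)) ξ

end
end

section
/- Assume condition NA1_s holds. Then for each k ∈ ℕ there exists a wealth process X̃ ∈ 𝒳_s^k(1) with P[X̃_t > 0] = 1 for all t ∈ 𝕋^k such that, defining Ỹ := 1/X̃ (on the event where X̃ is positive), for every X ∈ 𝒳_s^k(1) and all s, t ∈ 𝕋^k with s ≤ t one has E[Ỹ_t X_t | ℱ_s] ≤ Ỹ_s X_s almost surely. -/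
open MeasureTheory Set Filter
open scoped NNReal ENNReal Topology

noncomputable section

variable {Ω : Type*} {m : MeasurableSpace Ω}

/-- The dyadic trading-time grid `𝕋^k = {m/2^k : m ∈ ℕ, 0 ≤ m ≤ k·2^k}`. -/
def dyadicGrid (k : ℕ) : Set ℝ≥0 :=
  {t | ∃ m : ℕ, m ≤ k * 2 ^ k ∧ t = (m : ℝ≥0) / 2 ^ k}

/-- `𝒳_s^k(1)`: wealth processes in `𝒳_s(1)` whose trading times all belong to `𝕋^k`. -/
def Xsk {Ω : Type*} {m : MeasurableSpace Ω} (P : MeasureTheory.Measure Ω)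
    (ℱ : MeasureTheory.Filtration ℝ≥0 m) {d : ℕ} (S : ℝ≥0 → Ω → Fin d → ℝ) (k : ℕ) :
    Set (ℝ≥0 → Ω → ℝ) :=
  {X | ∃ θ : SimpleStrategy ℱ d, θ.Admissible P S 1 ∧
    (∀ j ≤ θ.n, ∀ ω, θ.τ j ω ∈ dyadicGrid k) ∧ X = θ.wealth S 1}


/-! ### Part 1: the one-period problem -/

/-- Abstract minimising-sequence lemma. -/
lemma exists_min_seq {V : Type*} (A : Set V) (J : V → ℝ≥0∞) (N : V → ℝ) (D : V → V → ℝ)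
    (mid : V → V → V) (hmA : ∀ x ∈ A, ∀ y ∈ A, mid x y ∈ A)
    (hmJ : ∀ x ∈ A, ∀ y ∈ A, ∀ c, J x ≤ c → J y ≤ c → J (mid x y) ≤ c)
    (hN0 : ∀ x ∈ A, 0 ≤ N x) (C : ℝ) (hNC : ∀ x ∈ A, N x ≤ C)
    (hD : ∀ x ∈ A, ∀ y ∈ A, D x y = 2 * N x + 2 * N y - 4 * N (mid x y))
    (hfin : ∃ x ∈ A, J x < ⊤) (ε : ℕ → ℝ) (hε : ∀ n, 0 < ε n) :
    ∃ x : ℕ → V, (∀ n, x n ∈ A) ∧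
      (∀ y ∈ A, ∀ n, J (x n) ≤ J y + ((n : ℝ≥0∞) + 1)⁻¹) ∧
      ∀ p n m, p ≤ n → p ≤ m → D (x n) (x m) < ε p := by
  classical
  obtain ⟨x0, hx0, hx0J⟩ := hfin
  set M : ℝ≥0∞ := ⨅ x ∈ A, J x with hM
  have hMtop : M < ⊤ := lt_of_le_of_lt (iInf₂_le x0 hx0) hx0J
  have hMle : ∀ y ∈ A, M ≤ J y := fun y hy => iInf₂_le y hy
  set c : ℕ → ℝ≥0∞ := fun n => M + ((n : ℝ≥0∞) + 1)⁻¹ with hc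
  have hcanti : ∀ p n, p ≤ n → c n ≤ c p := by
    intro p n h
    simp only [hc]
    gcongr
  have hcM : ∀ n, M < c n := by
    intro n
    refine ENNReal.lt_add_right hMtop.ne ?_
    simp only [ne_eq, ENNReal.inv_eq_zero]
    finiteness
  set L : ℕ → Set V := fun n => {x | x ∈ A ∧ J x ≤ c n} with hL
  have hLne : ∀ n, (L n).Nonempty := by
    intro n
    have := hcM n
    rw [hM] at this
    simp only [iInf_lt_iff] at this
    obtain ⟨x, hx, h⟩ := this
    exact ⟨x, hx, h.le⟩
  have hLsub : ∀ p n, p ≤ n → L n ⊆ L p := fun p n h x hx => ⟨hx.1, hx.2.trans (hcanti p n h)⟩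
  set a : ℕ → ℝ := fun n => sInf (N '' L n) with ha
  have hbb : ∀ n, BddBelow (N '' L n) := by
    intro n
    refine ⟨0, ?_⟩
    rintro _ ⟨x, hx, rfl⟩
    exact hN0 x hx.1
  have hale : ∀ n, ∀ x ∈ L n, a n ≤ N x := fun n x hx => csInf_le (hbb n) ⟨x, hx, rfl⟩
  have hamono : Monotone a := by
    intro p n h
    exact csInf_le_csInf (hbb p) ((hLne n).image N) (Set.image_mono (hLsub p n h))
  have habdd : BddAbove (Set.range a) := by
    refine ⟨C, ?_⟩
    rintro _ ⟨n, rfl⟩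
    obtain ⟨x, hx⟩ := hLne n
    exact (hale n x hx).trans (hNC x hx.1)
  have hlim := tendsto_atTop_ciSup hamono habdd
  set l : ℝ := ⨆ i, a i with hl
  have hal : ∀ n, a n ≤ l := fun n => le_ciSup habdd n
  have hex : ∀ n : ℕ, ∃ x ∈ L n, N x < a n + 1 / ((n : ℝ) + 1) := by
    intro n
    have : a n < a n + 1 / ((n : ℝ) + 1) := by
      have : 0 < 1 / ((n : ℝ) + 1) := by positivity
      linarith
    obtain ⟨_, ⟨x, hx, rfl⟩, h⟩ := exists_lt_of_csInf_lt ((hLne n).image N) this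
    exact ⟨x, hx, h⟩
  choose x hxL hxN using hex
  have hbound : ∀ p n m, p ≤ n → p ≤ m →
      D (x n) (x m) ≤ 4 * (l - a p) + 4 * (1 / ((p : ℝ) + 1)) := by
    intro p n m hn hm
    have hn' := hLsub p n hn (hxL n)
    have hm' := hLsub p m hm (hxL m)
    rw [hD _ hn'.1 _ hm'.1]
    have h1 : a p ≤ N (mid (x n) (x m)) :=
      hale p _ ⟨hmA _ hn'.1 _ hm'.1, hmJ _ hn'.1 _ hm'.1 _ hn'.2 hm'.2⟩
    have h2 : 1 / ((n : ℝ) + 1) ≤ 1 / ((p : ℝ) + 1) := by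
      have : (p : ℝ) ≤ n := by exact_mod_cast hn
      gcongr
    have h3 : 1 / ((m : ℝ) + 1) ≤ 1 / ((p : ℝ) + 1) := by
      have : (p : ℝ) ≤ m := by exact_mod_cast hm
      gcongr
    linarith [hxN n, hxN m, hal n, hal m]
  have hto : Tendsto (fun p : ℕ => 4 * (l - a p) + 4 * (1 / ((p : ℝ) + 1))) atTop (𝓝 0) := by
    have h := ((tendsto_const_nhds (x := l)).sub hlim).const_mul 4 |>.add
      ((tendsto_one_div_add_atTop_nhds_zero_nat (𝕜 := ℝ)).const_mul 4)
    simpa using h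
  have hev : ∀ q : ℕ, ∃ p0, ∀ p ≥ p0, 4 * (l - a p) + 4 * (1 / ((p : ℝ) + 1)) < ε q := by
    intro q
    exact eventually_atTop.1 (hto.eventually (gt_mem_nhds (hε q)))
  obtain ⟨φ, hφ, hφε⟩ := extraction_forall_of_eventually' hev
  refine ⟨x ∘ φ, fun n => (hxL _).1, ?_, ?_⟩
  · intro y hy n
    have h1 := (hLsub _ _ (hφ.id_le n) (hxL (φ n))).2
    exact h1.trans (add_le_add_left (hMle y hy) _)
  · intro p n m hn hm
    exact (hbound (φ p) _ _ (hφ.monotone hn) (hφ.monotone hm)).trans_lt (hφε p)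

/-- `-log`, as a continuous function with values in `[0,∞]`. -/
def negLog (x : ℝ) : ℝ≥0∞ := (-(ENNReal.log (ENNReal.ofReal x))).toENNReal

lemma continuous_negLog : Continuous negLog :=
  EReal.continuous_toENNReal.comp
    (continuous_neg.comp (ENNReal.continuous_log.comp ENNReal.continuous_ofReal))

lemma negLog_of_nonpos {x : ℝ} (hx : x ≤ 0) : negLog x = ⊤ := by
  simp [negLog, ENNReal.log_ofReal, hx]

lemma negLog_of_pos {x : ℝ} (hx : 0 < x) : negLog x = ENNReal.ofReal (-Real.log x) := by
  rw [negLog, ENNReal.log_ofReal_of_pos hx, ← EReal.coe_neg, EReal.real_coe_toENNReal]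

lemma negLog_mid {x y : ℝ} (hx1 : x ≤ 1) (hy1 : y ≤ 1) :
    2 * negLog ((x + y) / 2) ≤ negLog x + negLog y := by
  rcases le_or_gt x 0 with hx | hx
  · simp [negLog_of_nonpos hx]
  rcases le_or_gt y 0 with hy | hy
  · simp [negLog_of_nonpos hy]
  have hxy : 0 < (x + y) / 2 := by positivity
  rw [negLog_of_pos hx, negLog_of_pos hy, negLog_of_pos hxy]
  have lx : Real.log x ≤ 0 := Real.log_nonpos hx.le hx1
  have ly : Real.log y ≤ 0 := Real.log_nonpos hy.le hy1
  rw [← ENNReal.ofReal_add (by linarith) (by linarith),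
    show (2 : ℝ≥0∞) = ENNReal.ofReal 2 by simp, ← ENNReal.ofReal_mul (by norm_num)]
  apply ENNReal.ofReal_le_ofReal
  have := strictConcaveOn_log_Ioi.concaveOn.2 (show x ∈ Set.Ioi 0 from hx)
    (show y ∈ Set.Ioi 0 from hy) (show (0 : ℝ) ≤ 1 / 2 by norm_num)
    (show (0 : ℝ) ≤ 1 / 2 by norm_num) (by norm_num)
  simp only [smul_eq_mul] at this
  have e : (x + y) / 2 = 1 / 2 * x + 1 / 2 * y := by ring
  rw [e]
  linarith

/-- Portfolio weights measurable w.r.t. `G` with values in the simplex. -/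
def IsWeight {Ω ι : Type*} [Fintype ι] (G : MeasurableSpace Ω) (ρ : ι → Ω → ℝ) : Prop :=
  (∀ i, Measurable[G] (ρ i)) ∧ (∀ i ω, 0 ≤ ρ i ω) ∧ ∀ ω, ∑ i, ρ i ω = 1

lemma IsWeight.le_one {Ω ι : Type*} [Fintype ι] {G : MeasurableSpace Ω} {ρ : ι → Ω → ℝ}
    (h : IsWeight G ρ) (i : ι) (ω : Ω) : ρ i ω ≤ 1 := by
  rw [← h.2.2 ω]
  exact Finset.single_le_sum (f := fun i => ρ i ω) (fun j _ => h.2.1 j ω) (Finset.mem_univ i)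

lemma weight_sum_le_one {ι : Type*} [Fintype ι] (p q : ι → ℝ) (hp : ∀ i, 0 ≤ p i)
    (hp1 : ∑ i, p i = 1) (hq : ∀ i, 0 ≤ q i) (hq1 : ∑ i, q i = 1) : ∑ i, p i * q i ≤ 1 := by
  rw [← hp1]
  refine Finset.sum_le_sum fun i _ => ?_
  have : q i ≤ 1 := by
    rw [← hq1]
    exact Finset.single_le_sum (f := q) (fun j _ => hq j) (Finset.mem_univ i)
  nlinarith [hp i]


lemma exists_opt {Ω ι : Type*} [Fintype ι] [Nonempty ι] (G : MeasurableSpace Ω)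
    {m : MeasurableSpace Ω} (hG : G ≤ m) (P : Measure Ω) [IsProbabilityMeasure P]
    (Q : ι → Ω → ℝ) (hQm : ∀ i, Measurable (Q i)) (hQ0 : ∀ i ω, 0 ≤ Q i ω)
    (hQ1 : ∀ ω, ∑ i, Q i ω = 1) :
    ∃ w : ι → Ω → ℝ, IsWeight G w ∧ (∫⁻ ω, negLog (∑ i, w i ω * Q i ω) ∂P) ≠ ⊤ ∧
      ∀ ρ, IsWeight G ρ →
        ∫⁻ ω, negLog (∑ i, w i ω * Q i ω) ∂P ≤ ∫⁻ ω, negLog (∑ i, ρ i ω * Q i ω) ∂P := by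
  classical
  set A : Set (ι → Ω → ℝ) := {ρ | IsWeight G ρ} with hA
  set J : (ι → Ω → ℝ) → ℝ≥0∞ := fun ρ => ∫⁻ ω, negLog (∑ i, ρ i ω * Q i ω) ∂P with hJ
  set N : (ι → Ω → ℝ) → ℝ := fun ρ => ∑ i, ∫ ω, (ρ i ω) ^ 2 ∂P with hN
  set D : (ι → Ω → ℝ) → (ι → Ω → ℝ) → ℝ :=
    fun ρ σ => ∑ i, ∫ ω, (ρ i ω - σ i ω) ^ 2 ∂P with hD
  set mid : (ι → Ω → ℝ) → (ι → Ω → ℝ) → (ι → Ω → ℝ) :=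
    fun ρ σ i ω => (ρ i ω + σ i ω) / 2 with hmid
  have hmeas : ∀ ρ ∈ A, ∀ i, Measurable (ρ i) := fun ρ hρ i => (hρ.1 i).mono hG le_rfl
  have hmeasV : ∀ ρ ∈ A, Measurable (fun ω => ∑ i, ρ i ω * Q i ω) := fun ρ hρ =>
    Finset.measurable_sum _ fun i _ => (hmeas ρ hρ i).mul (hQm i)
  have hmeasJ : ∀ ρ ∈ A, Measurable (fun ω => negLog (∑ i, ρ i ω * Q i ω)) := fun ρ hρ =>
    continuous_negLog.measurable.comp (hmeasV ρ hρ)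
  have hsq : ∀ f : Ω → ℝ, Measurable f → (∀ ω, |f ω| ≤ 1) → Integrable (fun ω => f ω ^ 2) P := by
    intro f hf hb
    refine Integrable.of_bound (hf.pow_const 2).aestronglyMeasurable 1 (ae_of_all _ fun ω => ?_)
    rw [Real.norm_eq_abs, abs_pow]
    exact pow_le_one₀ (abs_nonneg _) (hb ω)
  have hmidA : ∀ x ∈ A, ∀ y ∈ A, mid x y ∈ A := by
    intro x hx y hy
    refine ⟨fun i => ((hx.1 i).add (hy.1 i)).div_const 2, fun i ω => ?_, fun ω => ?_⟩
    · have := hx.2.1 i ω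
      have := hy.2.1 i ω
      simp only [hmid]
      positivity
    · simp only [hmid]
      rw [← Finset.sum_div, Finset.sum_add_distrib, hx.2.2, hy.2.2]
      norm_num
  have habs : ∀ x ∈ A, ∀ i ω, |x i ω| ≤ 1 := by
    intro x hx i ω
    rw [abs_of_nonneg (hx.2.1 i ω)]
    exact hx.le_one i ω
  have hN0 : ∀ x ∈ A, 0 ≤ N x := fun x hx =>
    Finset.sum_nonneg fun i _ => integral_nonneg fun ω => sq_nonneg _
  have hNC : ∀ x ∈ A, N x ≤ (Fintype.card ι : ℝ) := by
    intro x hx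
    calc N x ≤ ∑ i : ι, (1 : ℝ) := by
          refine Finset.sum_le_sum fun i _ => ?_
          calc ∫ ω, (x i ω) ^ 2 ∂P ≤ ∫ ω, (1 : ℝ) ∂P := by
                refine integral_mono (hsq _ (hmeas x hx i) (habs x hx i)) (integrable_const _) ?_
                intro ω
                exact pow_le_one₀ (hx.2.1 i ω) (hx.le_one i ω)
            _ = 1 := by simp
      _ = _ := by simp
  have hDpar : ∀ x ∈ A, ∀ y ∈ A, D x y = 2 * N x + 2 * N y - 4 * N (mid x y) := by
    intro x hx y hy
    simp only [hD, hN, Finset.mul_sum]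
    rw [← Finset.sum_add_distrib, ← Finset.sum_sub_distrib]
    refine Finset.sum_congr rfl fun i _ => ?_
    have i1 := (hsq _ (hmeas x hx i) (habs x hx i)).const_mul 2
    have i2 := (hsq _ (hmeas y hy i) (habs y hy i)).const_mul 2
    have i3 := (hsq _ (hmeas _ (hmidA x hx y hy) i) (habs _ (hmidA x hx y hy) i)).const_mul 4
    rw [← integral_const_mul, ← integral_const_mul, ← integral_const_mul,
      ← integral_add i1 i2]
    refine Eq.trans ?_ (integral_sub (i1.add i2) i3)
    refine integral_congr_ae (ae_of_all _ fun ω => ?_)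
    simp only [hmid]
    ring
  have hmJ : ∀ x ∈ A, ∀ y ∈ A, ∀ c, J x ≤ c → J y ≤ c → J (mid x y) ≤ c := by
    intro x hx y hy c hxc hyc
    have h2 : 2 * J (mid x y) ≤ J x + J y := by
      simp only [hJ]
      rw [← lintegral_const_mul _ (hmeasJ _ (hmidA x hx y hy)), ← lintegral_add_left (hmeasJ x hx)]
      refine lintegral_mono fun ω => ?_
      have e : ∑ i, mid x y i ω * Q i ω
          = ((∑ i, x i ω * Q i ω) + (∑ i, y i ω * Q i ω)) / 2 := by
        simp only [hmid]
        rw [← Finset.sum_add_distrib, Finset.sum_div]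
        refine Finset.sum_congr rfl fun i _ => ?_
        ring
      rw [e]
      exact negLog_mid
        (weight_sum_le_one _ _ (fun i => hx.2.1 i ω) (hx.2.2 ω) (fun i => hQ0 i ω) (hQ1 ω))
        (weight_sum_le_one _ _ (fun i => hy.2.1 i ω) (hy.2.2 ω) (fun i => hQ0 i ω) (hQ1 ω))
    have h3 : 2 * J (mid x y) ≤ 2 * c := by
      rw [two_mul c]
      exact h2.trans (add_le_add hxc hyc)
    exact (ENNReal.mul_le_mul_iff_right (by norm_num) (by norm_num)).1 h3
  have hcard : (0 : ℝ) < Fintype.card ι := by exact_mod_cast Fintype.card_pos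
  set u : ι → Ω → ℝ := fun _ _ => (Fintype.card ι : ℝ)⁻¹ with hu
  have huA : u ∈ A := by
    refine ⟨fun i => measurable_const, fun i ω => by simp only [hu]; positivity, fun ω => ?_⟩
    simp only [hu, Finset.sum_const, Finset.card_univ, nsmul_eq_mul]
    field_simp
  have hufin : J u < ⊤ := by
    simp only [hJ, hu]
    have : ∀ ω, ∑ i, (Fintype.card ι : ℝ)⁻¹ * Q i ω = (Fintype.card ι : ℝ)⁻¹ := by
      intro ω
      rw [← Finset.mul_sum, hQ1, mul_one]
    simp only [this]
    rw [negLog_of_pos (by positivity)]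
    simp
  obtain ⟨x, hxA, hxJ, hxD⟩ := exists_min_seq A J N D mid hmidA hmJ hN0 _ hNC hDpar
    ⟨u, huA, hufin⟩ (fun n => (1 / 4 : ℝ) ^ n) (fun n => by positivity)
  -- almost sure convergence
  have hconv : ∀ i, ∀ᵐ ω ∂P, ∃ l, Tendsto (fun n => x n i ω) atTop (𝓝 l) := by
    intro i
    refine Lp.ae_tendsto_of_cauchy_eLpNorm (p := 2)
      (B := fun n => ENNReal.ofReal ((1 / 2 : ℝ) ^ n))
      (fun n => (hmeas _ (hxA n) i).aestronglyMeasurable) (by norm_num) ?_ ?_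
    · rw [← ENNReal.ofReal_tsum_of_nonneg (fun n => by positivity)
        (summable_geometric_of_lt_one (by norm_num) (by norm_num))]
      exact ENNReal.ofReal_ne_top
    · intro p n k hn hk
      have hm1 : Measurable (x n i - x k i) :=
        (hmeas _ (hxA n) i).sub (hmeas _ (hxA k) i)
      have hmem : MemLp (x n i - x k i) 2 P := by
        refine MemLp.of_bound hm1.aestronglyMeasurable 1 (ae_of_all _ fun ω => ?_)
        rw [Real.norm_eq_abs, abs_le, Pi.sub_apply]
        have := (hxA n).2.1 i ω
        have := (hxA k).2.1 i ω
        have := (hxA n).le_one i ω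
        have := (hxA k).le_one i ω
        constructor <;> linarith
      rw [hmem.eLpNorm_eq_integral_rpow_norm (by norm_num) (by norm_num)]
      refine (ENNReal.ofReal_lt_ofReal_iff (by positivity)).2 ?_
      have hle : ∫ ω, (x n i ω - x k i ω) ^ 2 ∂P ≤ D (x n) (x k) :=
        Finset.single_le_sum (f := fun i => ∫ ω, (x n i ω - x k i ω) ^ 2 ∂P)
          (fun j _ => integral_nonneg fun ω => sq_nonneg _) (Finset.mem_univ i)
      have hlt := hle.trans_lt (hxD p n k hn hk)
      have e1 : ∫ a, ‖(x n i - x k i) a‖ ^ (ENNReal.toReal 2) ∂P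
          = ∫ ω, (x n i ω - x k i ω) ^ 2 ∂P := by
        refine integral_congr_ae (ae_of_all _ fun ω => ?_)
        simp
      rw [e1]
      have e2 : (ENNReal.toReal 2)⁻¹ = (1 / 2 : ℝ) := by simp
      rw [e2, ← Real.sqrt_eq_rpow]
      refine (Real.sqrt_lt' (by positivity)).2 ?_
      refine hlt.trans_eq ?_
      rw [← pow_mul, mul_comm, pow_mul]
      norm_num
  set E : Set Ω := {ω | ∀ i, ∃ l, Tendsto (fun n => x n i ω) atTop (𝓝 l)} with hE
  have hEm : MeasurableSet[G] E := by
    have : E = ⋂ i, {ω | ∃ l, Tendsto (fun n => x n i ω) atTop (𝓝 l)} := by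
      ext ω
      simp [hE]
    rw [this]
    refine MeasurableSet.iInter fun i => ?_
    exact @measurableSet_exists_tendsto ℕ ℝ Ω G _ _ _ _ _ _ atTop _ (fun n => x n i)
      (fun n => (hxA n).1 i)
  have hEae : ∀ᵐ ω ∂P, ω ∈ E := by
    change ∀ᵐ ω ∂P, ∀ i, ∃ l, Tendsto (fun n => x n i ω) atTop (𝓝 l)
    exact ae_all_iff.2 hconv
  set w : ι → Ω → ℝ :=
    fun i ω => if ω ∈ E then limsup (fun n => x n i ω) atTop else (Fintype.card ι : ℝ)⁻¹ with hw
  have hwlim : ∀ ω ∈ E, ∀ i, Tendsto (fun n => x n i ω) atTop (𝓝 (w i ω)) := by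
    intro ω hω i
    obtain ⟨l, hl⟩ := hω i
    simp only [hw, if_pos hω]
    rwa [hl.limsup_eq]
  have hwA : IsWeight G w := by
    refine ⟨fun i => ?_, fun i ω => ?_, fun ω => ?_⟩
    · refine Measurable.ite hEm ?_ measurable_const
      exact Measurable.limsup (fun n => (hxA n).1 i)
    · by_cases hω : ω ∈ E
      · exact ge_of_tendsto' (hwlim ω hω i) fun n => (hxA n).2.1 i ω
      · simp only [hw, if_neg hω]
        positivity
    · by_cases hω : ω ∈ E
      · have h1 := tendsto_finsetSum Finset.univ (fun i _ => hwlim ω hω i)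
        simp only [(hxA _).2.2 ω] at h1
        exact (tendsto_nhds_unique h1 tendsto_const_nhds)
      · simp only [hw, if_neg hω, Finset.sum_const, Finset.card_univ, nsmul_eq_mul]
        field_simp
  have hopt : ∀ ρ, IsWeight G ρ → J w ≤ J ρ := by
    intro ρ hρ
    have h1 : J w ≤ liminf (fun n => J (x n)) atTop := by
      refine le_trans (le_of_eq ?_) (lintegral_liminf_le (fun n => hmeasJ _ (hxA n)))
      refine lintegral_congr_ae ?_
      filter_upwards [hEae] with ω hω
      refine (Tendsto.liminf_eq ?_).symm
      refine (continuous_negLog.tendsto _).comp ?_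
      exact tendsto_finsetSum _ fun i _ => (hwlim ω hω i).mul_const _
    have h2 : liminf (fun n => J (x n)) atTop
        ≤ liminf (fun n : ℕ => J ρ + ((n : ℝ≥0∞) + 1)⁻¹) atTop :=
      liminf_le_liminf (Eventually.of_forall fun n => hxJ ρ hρ n)
    have h3 : Tendsto (fun n : ℕ => J ρ + ((n : ℝ≥0∞) + 1)⁻¹) atTop (𝓝 (J ρ + 0)) := by
      refine tendsto_const_nhds.add ?_
      have := (tendsto_add_atTop_iff_nat 1).2 ENNReal.tendsto_inv_nat_nhds_zero
      simpa using this
    rw [h3.liminf_eq, add_zero] at h2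
    exact h1.trans h2
  exact ⟨w, hwA, ((hopt u huA).trans_lt hufin).ne, hopt⟩

lemma opt_ratio {Ω ι : Type*} [Fintype ι] (G : MeasurableSpace Ω)
    {m : MeasurableSpace Ω} (hG : G ≤ m) (P : Measure Ω) [IsProbabilityMeasure P]
    (Q : ι → Ω → ℝ) (hQm : ∀ i, Measurable (Q i)) (hQ0 : ∀ i ω, 0 ≤ Q i ω)
    (hQ1 : ∀ ω, ∑ i, Q i ω = 1)
    (w : ι → Ω → ℝ) (hw : IsWeight G w) (hfin : (∫⁻ ω, negLog (∑ i, w i ω * Q i ω) ∂P) ≠ ⊤)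
    (hopt : ∀ ρ, IsWeight G ρ →
        ∫⁻ ω, negLog (∑ i, w i ω * Q i ω) ∂P ≤ ∫⁻ ω, negLog (∑ i, ρ i ω * Q i ω) ∂P) :
    (∀ᵐ ω ∂P, 0 < ∑ i, w i ω * Q i ω) ∧
    ∀ ρ, IsWeight G ρ →
      ∫⁻ ω, ENNReal.ofReal ((∑ i, ρ i ω * Q i ω) / ∑ i, w i ω * Q i ω) ∂P ≤ 1 := by
  have hmeasV : ∀ ρ, IsWeight G ρ → Measurable (fun ω => ∑ i, ρ i ω * Q i ω) := fun ρ hρ =>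
    Finset.measurable_sum _ fun i _ => ((hρ.1 i).mono hG le_rfl).mul (hQm i)
  have hV0 : ∀ ρ, IsWeight G ρ → ∀ ω, 0 ≤ ∑ i, ρ i ω * Q i ω := fun ρ hρ ω =>
    Finset.sum_nonneg fun i _ => mul_nonneg (hρ.2.1 i ω) (hQ0 i ω)
  have hV1 : ∀ ρ, IsWeight G ρ → ∀ ω, ∑ i, ρ i ω * Q i ω ≤ 1 := fun ρ hρ ω =>
    weight_sum_le_one _ _ (fun i => hρ.2.1 i ω) (hρ.2.2 ω) (fun i => hQ0 i ω) (hQ1 ω)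
  set a : Ω → ℝ := fun ω => ∑ i, w i ω * Q i ω with ha
  have ham : Measurable a := hmeasV w hw
  have hapos : ∀ᵐ ω ∂P, 0 < a ω := by
    filter_upwards [ae_lt_top (continuous_negLog.measurable.comp ham) hfin] with ω hω
    by_contra h
    rw [Function.comp_apply, negLog_of_nonpos (not_lt.1 h)] at hω
    exact lt_irrefl _ hω
  refine ⟨hapos, fun ρ hρ => ?_⟩
  set b : Ω → ℝ := fun ω => ∑ i, ρ i ω * Q i ω with hb
  have hbm : Measurable b := hmeasV ρ hρ
  set f : Ω → ℝ := fun ω => -Real.log (a ω) with hf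
  have hfm : Measurable f := (Real.measurable_log.comp ham).neg
  have hf0 : ∀ ω, 0 ≤ f ω := fun ω =>
    neg_nonneg.2 (Real.log_nonpos (hV0 w hw ω) (hV1 w hw ω))
  have hfJ : ∫⁻ ω, negLog (a ω) ∂P = ∫⁻ ω, ENNReal.ofReal (f ω) ∂P := by
    refine lintegral_congr_ae ?_
    filter_upwards [hapos] with ω hω
    rw [negLog_of_pos hω]
  have hfint : Integrable f P := by
    refine (lintegral_ofReal_ne_top_iff_integrable hfm.aestronglyMeasurable
      (ae_of_all _ hf0)).1 ?_
    rw [← hfJ]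
    exact hfin
  set e : ℕ → ℝ := fun n => 1 / ((n : ℝ) + 2) with he
  have he0 : ∀ n, 0 < e n := fun n => by simp only [he]; positivity
  have he1 : ∀ n, e n ≤ 1 / 2 := by
    intro n
    simp only [he]
    have : (0 : ℝ) ≤ n := Nat.cast_nonneg n
    gcongr
    linarith
  have helim : Tendsto e atTop (𝓝 0) := by
    have h := (tendsto_add_atTop_iff_nat 1).2 (tendsto_one_div_add_atTop_nhds_zero_nat (𝕜 := ℝ))
    refine h.congr fun n => ?_
    simp only [he]
    push_cast
    congr 1
    ring
  set g : ℕ → Ω → ℝ := fun n ω => (b ω - a ω) / ((1 - e n) * a ω + e n * b ω) + 2 with hg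
  have hgm : ∀ n, Measurable (g n) := fun n =>
    ((hbm.sub ham).div ((ham.const_mul _).add (hbm.const_mul _))).add_const _
  have hgint : ∀ n, ∫⁻ ω, ENNReal.ofReal (g n ω) ∂P ≤ ENNReal.ofReal 2 := by
    intro n
    set σ : ι → Ω → ℝ := fun i ω => (1 - e n) * w i ω + e n * ρ i ω with hσ
    have h1e : 0 < 1 - e n := by linarith [he1 n]
    have hσw : IsWeight G σ := by
      refine ⟨fun i => ((hw.1 i).const_mul _).add ((hρ.1 i).const_mul _), fun i ω => ?_,
        fun ω => ?_⟩
      · exact add_nonneg (mul_nonneg h1e.le (hw.2.1 i ω)) (mul_nonneg (he0 n).le (hρ.2.1 i ω))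
      · simp only [hσ]
        rw [Finset.sum_add_distrib, ← Finset.mul_sum, ← Finset.mul_sum, hw.2.2, hρ.2.2]
        ring
    have hσV : ∀ ω, ∑ i, σ i ω * Q i ω = (1 - e n) * a ω + e n * b ω := by
      intro ω
      simp only [hσ, ha, hb, Finset.mul_sum]
      rw [← Finset.sum_add_distrib]
      exact Finset.sum_congr rfl fun i _ => by ring
    set c : Ω → ℝ := fun ω => (1 - e n) * a ω + e n * b ω with hc
    have hcm : Measurable c := (ham.const_mul _).add (hbm.const_mul _)
    have hc1 : ∀ ω, c ω ≤ 1 := fun ω => (hσV ω).symm.le.trans (hV1 σ hσw ω)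
    have hb0 : ∀ ω, 0 ≤ b ω := hV0 ρ hρ
    have hcge : ∀ ω, (1 - e n) * a ω ≤ c ω := fun ω =>
      le_add_of_nonneg_right (mul_nonneg (he0 n).le (hb0 ω))
    have hc0 : ∀ ω, 0 ≤ c ω := fun ω =>
      (mul_nonneg h1e.le (hV0 w hw ω)).trans (hcge ω)
    have hcpos : ∀ᵐ ω ∂P, 0 < c ω := by
      filter_upwards [hapos] with ω hω
      exact (mul_pos h1e hω).trans_le (hcge ω)
    set f' : Ω → ℝ := fun ω => -Real.log (c ω) with hf'
    have hf'm : Measurable f' := (Real.measurable_log.comp hcm).neg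
    have hf'0 : ∀ ω, 0 ≤ f' ω := fun ω => neg_nonneg.2 (Real.log_nonpos (hc0 ω) (hc1 ω))
    have hf'int : Integrable f' P := by
      refine Integrable.mono' (hfint.add (integrable_const (-Real.log (1 - e n))))
        hf'm.aestronglyMeasurable ?_
      filter_upwards [hapos] with ω hω
      rw [Real.norm_eq_abs, abs_of_nonneg (hf'0 ω)]
      have := Real.log_le_log (mul_pos h1e hω) (hcge ω)
      rw [Real.log_mul h1e.ne' hω.ne'] at this
      simp only [hf', hf, Pi.add_apply]
      linarith
    have hle : ∫ ω, f ω ∂P ≤ ∫ ω, f' ω ∂P := by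
      have h := hopt σ hσw
      have h2 : ∫⁻ ω, negLog (∑ i, σ i ω * Q i ω) ∂P = ∫⁻ ω, ENNReal.ofReal (f' ω) ∂P := by
        refine lintegral_congr_ae ?_
        filter_upwards [hcpos] with ω hω
        rw [hσV ω, negLog_of_pos hω]
      rw [h2, hfJ, ← ofReal_integral_eq_lintegral_ofReal hfint (ae_of_all _ hf0),
        ← ofReal_integral_eq_lintegral_ofReal hf'int (ae_of_all _ hf'0)] at h
      exact (ENNReal.ofReal_le_ofReal_iff (integral_nonneg hf'0)).1 h
    have hpt : ∀ᵐ ω ∂P, 0 ≤ g n ω ∧ g n ω ≤ (e n)⁻¹ * (f ω - f' ω) + 2 := by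
      filter_upwards [hapos, hcpos] with ω hω hcω
      constructor
      · have : -2 ≤ (b ω - a ω) / c ω := by
          rw [le_div_iff₀ hcω]
          have h1 := hcge ω
          have h2 := he1 n
          have h3 := hb0 ω
          nlinarith
        simp only [hg]
        linarith
      · have hlog := Real.one_sub_inv_le_log_of_pos (div_pos hcω hω)
        rw [Real.log_div hcω.ne' hω.ne', inv_div] at hlog
        have e1 : 1 - a ω / c ω = e n * ((b ω - a ω) / c ω) := by
          field_simp
          simp only [hc]
          ring
        rw [e1] at hlog
        have h3 : (b ω - a ω) / c ω ≤ (e n)⁻¹ * (f ω - f' ω) := by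
          rw [inv_mul_eq_div, le_div_iff₀ (he0 n)]
          simp only [hf, hf']
          linarith
        simp only [hg]
        linarith
    have hintg : Integrable (fun ω => (e n)⁻¹ * (f ω - f' ω) + 2) P :=
      ((hfint.sub hf'int).const_mul _).add (integrable_const _)
    calc ∫⁻ ω, ENNReal.ofReal (g n ω) ∂P
        ≤ ∫⁻ ω, ENNReal.ofReal ((e n)⁻¹ * (f ω - f' ω) + 2) ∂P := by
          refine lintegral_mono_ae ?_
          filter_upwards [hpt] with ω hω
          exact ENNReal.ofReal_le_ofReal hω.2
      _ = ENNReal.ofReal (∫ ω, ((e n)⁻¹ * (f ω - f' ω) + 2) ∂P) := by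
          refine (ofReal_integral_eq_lintegral_ofReal hintg ?_).symm
          filter_upwards [hpt] with ω hω
          exact hω.1.trans hω.2
      _ ≤ ENNReal.ofReal 2 := by
          refine ENNReal.ofReal_le_ofReal ?_
          have hdint : Integrable (fun ω => (e n)⁻¹ * (f ω - f' ω)) P :=
            (hfint.sub hf'int).const_mul _
          rw [integral_add hdint (integrable_const _), integral_const_mul]
          have := integral_sub hfint hf'int
          have h2 : 0 < (e n)⁻¹ := inv_pos.2 (he0 n)
          have h3 : ∫ ω, (f ω - f' ω) ∂P ≤ 0 := by
            rw [this]
            linarith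
          have h4 : (e n)⁻¹ * ∫ ω, (f ω - f' ω) ∂P ≤ 0 := mul_nonpos_of_nonneg_of_nonpos h2.le h3
          simp only [integral_const, probReal_univ, smul_eq_mul, one_mul]
          linarith
  have hfatou : ∫⁻ ω, ENNReal.ofReal (b ω / a ω + 1) ∂P ≤ ENNReal.ofReal 2 := by
    calc ∫⁻ ω, ENNReal.ofReal (b ω / a ω + 1) ∂P
        = ∫⁻ ω, liminf (fun n => ENNReal.ofReal (g n ω)) atTop ∂P := by
          refine lintegral_congr_ae ?_
          filter_upwards [hapos] with ω hω
          refine (Tendsto.liminf_eq ?_).symm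
          refine (ENNReal.continuous_ofReal.tendsto _).comp ?_
          have h1 : Tendsto (fun n => (1 - e n) * a ω + e n * b ω) atTop
              (𝓝 ((1 - 0) * a ω + 0 * b ω)) :=
            ((helim.const_sub 1).mul_const _).add (helim.mul_const _)
          rw [show (1 - 0) * a ω + 0 * b ω = a ω by ring] at h1
          have h2 := ((tendsto_const_nhds (x := b ω - a ω)).div h1 hω.ne').add_const 2
          have h3 : (b ω - a ω) / a ω + 2 = b ω / a ω + 1 := by
            field_simp
            ring
          rw [h3] at h2
          exact h2
      _ ≤ liminf (fun n => ∫⁻ ω, ENNReal.ofReal (g n ω) ∂P) atTop :=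
          lintegral_liminf_le fun n => (hgm n).ennreal_ofReal
      _ ≤ liminf (fun _ : ℕ => ENNReal.ofReal 2) atTop :=
          liminf_le_liminf (Eventually.of_forall hgint)
      _ = ENNReal.ofReal 2 := by simp
  have hsplit : ∫⁻ ω, ENNReal.ofReal (b ω / a ω + 1) ∂P
      = ∫⁻ ω, ENNReal.ofReal (b ω / a ω) ∂P + 1 := by
    have : ∀ ω, ENNReal.ofReal (b ω / a ω + 1) = ENNReal.ofReal (b ω / a ω) + 1 := by
      intro ω
      rw [ENNReal.ofReal_add (div_nonneg (hV0 ρ hρ ω) (hV0 w hw ω)) zero_le_one,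
        ENNReal.ofReal_one]
    simp only [this]
    rw [lintegral_add_right _ measurable_const]
    simp
  rw [hsplit] at hfatou
  have h2 : ENNReal.ofReal 2 = 1 + 1 := by
    rw [show (2 : ℝ) = 1 + 1 by norm_num, ENNReal.ofReal_add zero_le_one zero_le_one]
    simp
  rw [h2] at hfatou
  exact (ENNReal.add_le_add_iff_right ENNReal.one_ne_top).1 hfatou

/-- One-period numéraire, for returns `R ≥ 0` with positive total. -/
lemma exists_one_period {Ω ι : Type*} [Fintype ι] [Nonempty ι] (G : MeasurableSpace Ω)
    {m : MeasurableSpace Ω} (hG : G ≤ m) (P : Measure Ω) [IsProbabilityMeasure P]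
    (R : ι → Ω → ℝ) (hRm : ∀ i, Measurable (R i)) (hR0 : ∀ i ω, 0 ≤ R i ω)
    (hR1 : ∀ ω, 0 < ∑ i, R i ω) :
    ∃ w : ι → Ω → ℝ, IsWeight G w ∧ (∀ᵐ ω ∂P, 0 < ∑ i, w i ω * R i ω) ∧
      ∀ i, ∀ c : Ω → ℝ≥0∞, Measurable[G] c →
        ∫⁻ ω, c ω * ENNReal.ofReal (R i ω / ∑ j, w j ω * R j ω) ∂P ≤ ∫⁻ ω, c ω ∂P := by
  classical
  set T : Ω → ℝ := fun ω => ∑ i, R i ω with hT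
  have hTm : Measurable T := Finset.measurable_sum _ fun i _ => hRm i
  set Q : ι → Ω → ℝ := fun i ω => R i ω / T ω with hQ
  have hQm : ∀ i, Measurable (Q i) := fun i => (hRm i).div hTm
  have hQ0 : ∀ i ω, 0 ≤ Q i ω := fun i ω => div_nonneg (hR0 i ω) (hR1 ω).le
  have hQ1 : ∀ ω, ∑ i, Q i ω = 1 := by
    intro ω
    simp only [hQ]
    rw [← Finset.sum_div]
    exact div_self (hR1 ω).ne'
  obtain ⟨w, hw, hfin, hopt⟩ := exists_opt G hG P Q hQm hQ0 hQ1
  obtain ⟨hpos, hrat⟩ := opt_ratio G hG P Q hQm hQ0 hQ1 w hw hfin hopt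
  have hQV : ∀ (ρ : ι → Ω → ℝ) ω, ∑ i, ρ i ω * Q i ω = (∑ i, ρ i ω * R i ω) / T ω := by
    intro ρ ω
    simp only [hQ]
    rw [Finset.sum_div]
    exact Finset.sum_congr rfl fun i _ => by ring
  have hposR : ∀ᵐ ω ∂P, 0 < ∑ i, w i ω * R i ω := by
    filter_upwards [hpos] with ω hω
    rw [hQV] at hω
    have h := mul_pos hω (hR1 ω)
    rwa [div_mul_cancel₀ _ (hR1 ω).ne'] at h
  refine ⟨w, hw, hposR, fun i c hc => ?_⟩
  set q : Ω → ℝ≥0∞ := fun ω => ENNReal.ofReal (R i ω / ∑ j, w j ω * R j ω) with hq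
  have hqm : Measurable q :=
    ((hRm i).div (Finset.measurable_sum _ fun j _ =>
      ((hw.1 j).mono hG le_rfl).mul (hRm j))).ennreal_ofReal
  have hset : ∀ A, MeasurableSet[G] A → ∫⁻ ω in A, q ω ∂P ≤ P A := by
    intro A hA
    have hAm : MeasurableSet A := hG _ hA
    set ρ : ι → Ω → ℝ := fun j ω => if ω ∈ A then (if j = i then 1 else 0) else w j ω with hρ
    have hρw : IsWeight G ρ := by
      refine ⟨fun j => Measurable.ite hA measurable_const (hw.1 j), fun j ω => ?_, fun ω => ?_⟩
      · simp only [hρ]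
        split_ifs
        · exact zero_le_one
        · exact le_rfl
        · exact hw.2.1 j ω
      · by_cases hω : ω ∈ A
        · simp [hρ, hω]
        · simp [hρ, hω, hw.2.2]
    have h := hrat ρ hρw
    rw [← lintegral_add_compl _ hAm] at h
    have h1 : ∫⁻ ω in A, ENNReal.ofReal ((∑ i, ρ i ω * Q i ω) / ∑ i, w i ω * Q i ω) ∂P
        = ∫⁻ ω in A, q ω ∂P := by
      refine setLIntegral_congr_fun hAm fun ω hω => ?_
      simp only [hq]
      rw [hQV, hQV, div_div_div_cancel_right₀ (hR1 ω).ne']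
      simp [hρ, hω]
    have h2 : ∫⁻ ω in Aᶜ, ENNReal.ofReal ((∑ i, ρ i ω * Q i ω) / ∑ i, w i ω * Q i ω) ∂P
        = P Aᶜ := by
      rw [← setLIntegral_one]
      refine setLIntegral_congr_fun_ae hAm.compl ?_
      filter_upwards [hpos] with ω hω hωA
      have : ω ∉ A := hωA
      simp only [hρ, if_neg this]
      rw [div_self hω.ne', ENNReal.ofReal_one]
    rw [h1, h2] at h
    have h3 : P A + P Aᶜ = 1 := by
      rw [measure_add_measure_compl hAm, measure_univ]
    rw [← h3] at h
    exact (ENNReal.add_le_add_iff_right (measure_ne_top P _)).1 h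
  have hmeasle : (P.withDensity q).trim hG ≤ P.trim hG := by
    refine Measure.le_iff.2 fun A hA => ?_
    rw [trim_measurableSet_eq hG hA, trim_measurableSet_eq hG hA,
      withDensity_apply _ (hG _ hA)]
    exact hset A hA
  calc ∫⁻ ω, c ω * q ω ∂P = ∫⁻ ω, (q * c) ω ∂P := by
        refine lintegral_congr fun ω => ?_
        rw [Pi.mul_apply, mul_comm]
    _ = ∫⁻ ω, c ω ∂(P.withDensity q) :=
        (lintegral_withDensity_eq_lintegral_mul P hqm (hc.mono hG le_rfl)).symm
    _ = ∫⁻ ω, c ω ∂((P.withDensity q).trim hG) := (lintegral_trim hG hc).symm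
    _ ≤ ∫⁻ ω, c ω ∂(P.trim hG) := lintegral_mono' hmeasle le_rfl
    _ = ∫⁻ ω, c ω ∂P := lintegral_trim hG hc

/-! ### Part 2: strategies along the grid -/

/-- Grid points. -/
def gridPt (k l : ℕ) : ℝ≥0 := (l : ℝ≥0) / 2 ^ k

lemma gridPt_le_iff (k a b : ℕ) : gridPt k a ≤ gridPt k b ↔ a ≤ b := by
  have h : (0 : ℝ≥0) < 2 ^ k := by positivity
  unfold gridPt
  rw [div_le_div_iff_of_pos_right h]
  exact Nat.cast_le

lemma gridPt_lt_iff (k a b : ℕ) : gridPt k a < gridPt k b ↔ a < b := by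
  rw [← not_le, gridPt_le_iff, not_le]

lemma gridPt_zero (k : ℕ) : gridPt k 0 = 0 := by simp [gridPt]

/-- Under NA1, an asset with price zero stays at zero. -/
lemma no_revival {Ω : Type*} {m : MeasurableSpace Ω} (P : Measure Ω)
    [IsProbabilityMeasure P] (ℱ : Filtration ℝ≥0 m)
    (d : ℕ) (S : ℝ≥0 → Ω → Fin d → ℝ) (hS_adapted : StronglyAdapted ℱ S)
    (hS_nonneg : ∀ t ω i, 0 ≤ S t ω i) (hNA1 : NA1s P ℱ S) (s t : ℝ≥0) (hst : s ≤ t)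
    (i : Fin d) : ∀ᵐ ω ∂P, S s ω i = 0 → S t ω i = 0 := by
  classical
  have hSm : ∀ r i, Measurable[ℱ r] (fun ω => S r ω i) := fun r i =>
    (@measurable_pi_apply _ _ _ i).comp (hS_adapted r).measurable
  set B : Set Ω := {ω | S s ω i = 0} with hB
  have hBm : MeasurableSet[ℱ s] B := (hSm s i) (measurableSet_singleton 0)
  by_contra hcon
  refine hNA1 t (fun ω => if ω ∈ B then S t ω i else 0) ⟨?_, ?_, ?_, ?_⟩
  · exact Measurable.ite (ℱ.mono hst _ hBm) (hSm t i) measurable_const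
  · refine ae_of_all _ fun ω => ?_
    dsimp only
    split_ifs
    · exact hS_nonneg t ω i
    · exact le_rfl
  · rw [pos_iff_ne_zero]
    intro h0
    apply hcon
    rw [ae_iff]
    refine measure_mono_null ?_ h0
    intro ω hω
    have hω' : ¬ (S s ω i = 0 → S t ω i = 0) := hω
    push Not at hω'
    have hωB : ω ∈ B := hω'.1
    change 0 < if ω ∈ B then S t ω i else 0
    rw [if_pos hωB]
    exact lt_of_le_of_ne (hS_nonneg t ω i) (Ne.symm hω'.2)
  · intro x hx
    let τ' : ℕ → ℝ≥0 := fun j => if j = 0 then 0 else if j = 1 then s else t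
    let θ : SimpleStrategy ℱ d :=
      { n := 2
        τ := fun j _ => τ' j
        ϑ := fun j ω i' => if j = 1 then (if ω ∈ B then (if i' = i then 1 else 0) else 0) else 0
        τ_zero := fun ω => by simp [τ']
        τ_mono := by
          intro j ω
          rcases j with _ | _ | j
          · simp [τ']
          · simpa [τ'] using hst
          · simp [τ']
        τ_stopping := fun j => isStoppingTime_const ℱ (τ' j)
        ϑ_meas := by
          intro j
          have e := IsStoppingTime.measurableSpace_const ℱ (τ' j)
          refine Measurable.mono ?_ e.ge le_rfl
          refine @measurable_pi_lambda _ _ _ (ℱ (τ' j)) _ _ fun i' => ?_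
          by_cases hj : j = 1
          · subst hj
            simp only [if_true]
            exact Measurable.ite hBm measurable_const measurable_const
          · simp only [if_neg hj]
            exact measurable_const }
    have hw : ∀ r ω, θ.wealth S x r ω
        = x + if ω ∈ B then S (min t r) ω i - S (min s r) ω i else 0 := by
      intro r ω
      by_cases hω : ω ∈ B <;>
      simp [SimpleStrategy.wealth, θ, τ', hω]
    refine ⟨θ.wealth S x, ⟨θ, ?_, rfl⟩, ?_⟩
    · intro j hj
      refine ae_of_all _ fun ω => ⟨fun i' => ?_, ?_⟩
      · simp only [θ]
        split_ifs <;> norm_num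
      · rw [hw]
        have hj' : j = 0 ∨ j = 1 := by
          have : j < 2 := hj
          omega
        rcases hj' with rfl | rfl
        · simp [θ, τ', hx.le]
        · by_cases hω : ω ∈ B
          · have h0 : S s ω i = 0 := hω
            simp [θ, τ', hω, h0, hx.le, hst]
          · simp [θ, hω, hx.le]
    · refine ae_of_all _ fun ω => ?_
      rw [hw]
      by_cases hω : ω ∈ B
      · have h0 : S s ω i = 0 := hω
        simp [hω, h0, hx.le, hst]
      · simp [hω, hx.le]

/-- Holdings on the grid interval `(l, l+1]`. -/
def gridHold {Ω : Type*} {m : MeasurableSpace Ω} {ℱ : Filtration ℝ≥0 m} {d : ℕ}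
    (θ : SimpleStrategy ℱ d) (k l : ℕ) (ω : Ω) (i : Fin d) : ℝ :=
  ∑ j ∈ Finset.range θ.n,
    if θ.τ j ω ≤ gridPt k l ∧ gridPt k l < θ.τ (j + 1) ω then θ.ϑ j ω i else 0

lemma stop_set_eq {Ω : Type*} (τ : Ω → ℝ≥0) (t : ℝ≥0) :
    {ω | (τ ω : WithTop ℝ≥0) ≤ (t : WithTop ℝ≥0)} = {ω | τ ω ≤ t} := by
  ext ω
  exact WithTop.coe_le_coe

lemma measurable_ite_stopping {Ω : Type*} {m : MeasurableSpace Ω} {ℱ : Filtration ℝ≥0 m}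
    (τ : Ω → ℝ≥0) (hτ : IsStoppingTime ℱ (fun ω => (τ ω : WithTop ℝ≥0))) (f : Ω → ℝ)
    (hf : Measurable[hτ.measurableSpace] f) (t : ℝ≥0) :
    Measurable[ℱ t] (fun ω => if τ ω ≤ t then f ω else 0) := by
  classical
  have hle : MeasurableSet[ℱ t] {ω | τ ω ≤ t} := by
    have := hτ t
    rwa [stop_set_eq] at this
  intro B hB
  have h1 : MeasurableSet[ℱ t] (f ⁻¹' B ∩ {ω | τ ω ≤ t}) := by
    have := (hf hB)
    rw [IsStoppingTime.measurableSet] at this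
    have h2 := this.2 t
    rwa [stop_set_eq] at h2
  by_cases h0 : (0 : ℝ) ∈ B
  · have : (fun ω => if τ ω ≤ t then f ω else 0) ⁻¹' B
        = (f ⁻¹' B ∩ {ω | τ ω ≤ t}) ∪ {ω | τ ω ≤ t}ᶜ := by
      ext ω
      by_cases h : τ ω ≤ t <;> simp [h, h0]
    rw [this]
    exact h1.union hle.compl
  · have : (fun ω => if τ ω ≤ t then f ω else 0) ⁻¹' B = (f ⁻¹' B ∩ {ω | τ ω ≤ t}) := by
      ext ω
      by_cases h : τ ω ≤ t <;> simp [h, h0]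
    rw [this]
    exact h1

lemma measurable_gridHold {Ω : Type*} {m : MeasurableSpace Ω} {ℱ : Filtration ℝ≥0 m} {d : ℕ}
    (θ : SimpleStrategy ℱ d) (k l : ℕ) (i : Fin d) :
    Measurable[ℱ (gridPt k l)] (fun ω => gridHold θ k l ω i) := by
  classical
  unfold gridHold
  refine Finset.measurable_sum _ fun j _ => ?_
  have h1 := measurable_ite_stopping (θ.τ j) (θ.τ_stopping j) (fun ω => θ.ϑ j ω i)
    ((@measurable_pi_apply _ _ _ i).comp (θ.ϑ_meas j)) (gridPt k l)
  have h2 : MeasurableSet[ℱ (gridPt k l)] {ω | gridPt k l < θ.τ (j + 1) ω} := by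
    have h3 : MeasurableSet[ℱ (gridPt k l)] {ω | θ.τ (j + 1) ω ≤ gridPt k l} := by
      have := θ.τ_stopping (j + 1) (gridPt k l)
      rwa [stop_set_eq] at this
    have : {ω | gridPt k l < θ.τ (j + 1) ω} = {ω | θ.τ (j + 1) ω ≤ gridPt k l}ᶜ := by
      ext ω
      simp
    rw [this]
    exact h3.compl
  have h4 : Measurable[ℱ (gridPt k l)] (fun ω => if gridPt k l < θ.τ (j + 1) ω then
      (if θ.τ j ω ≤ gridPt k l then θ.ϑ j ω i else 0) else (0 : ℝ)) :=
    Measurable.ite h2 h1 measurable_const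
  convert h4 using 2 with ω
  by_cases ha : θ.τ j ω ≤ gridPt k l <;> by_cases hb : gridPt k l < θ.τ (j + 1) ω <;>
    simp [ha, hb]

lemma wealth_zero {Ω : Type*} {m : MeasurableSpace Ω} {ℱ : Filtration ℝ≥0 m} {d : ℕ}
    (θ : SimpleStrategy ℱ d) (S : ℝ≥0 → Ω → Fin d → ℝ) (x : ℝ) (ω : Ω) :
    θ.wealth S x 0 ω = x := by
  simp [SimpleStrategy.wealth]

lemma wealth_step {Ω : Type*} {m : MeasurableSpace Ω} {ℱ : Filtration ℝ≥0 m} {d : ℕ}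
    (θ : SimpleStrategy ℱ d) (S : ℝ≥0 → Ω → Fin d → ℝ) (x : ℝ) (k l : ℕ)
    (hgrid : ∀ j ≤ θ.n, ∀ ω, θ.τ j ω ∈ dyadicGrid k) (ω : Ω) :
    θ.wealth S x (gridPt k (l + 1)) ω = θ.wealth S x (gridPt k l) ω +
      ∑ i, gridHold θ k l ω i * (S (gridPt k (l + 1)) ω i - S (gridPt k l) ω i) := by
  have hg : ∀ j ≤ θ.n, θ.τ j ω ≤ gridPt k l ∨ gridPt k (l + 1) ≤ θ.τ j ω := by
    intro j hj
    obtain ⟨a, _, ha⟩ := hgrid j hj ω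
    have ha' : θ.τ j ω = gridPt k a := ha
    rw [ha', gridPt_le_iff, gridPt_le_iff]
    omega
  have hll : gridPt k l < gridPt k (l + 1) := (gridPt_lt_iff _ _ _).2 (Nat.lt_succ_self l)
  have hstep : ∀ j ≤ θ.n, ∀ i, S (min (θ.τ j ω) (gridPt k (l + 1))) ω i
      = S (min (θ.τ j ω) (gridPt k l)) ω i + (if gridPt k l < θ.τ j ω then
        (S (gridPt k (l + 1)) ω i - S (gridPt k l) ω i) else 0) := by
    intro j hj i
    rcases hg j hj with h | h
    · rw [min_eq_left h, min_eq_left (h.trans hll.le), if_neg (not_lt.2 h), add_zero]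
    · rw [min_eq_right h, min_eq_right (hll.le.trans h), if_pos (hll.trans_le h)]
      ring
  unfold SimpleStrategy.wealth gridHold
  simp only [Finset.sum_mul]
  rw [Finset.sum_comm (s := (Finset.univ : Finset (Fin d))), add_assoc, ← Finset.sum_add_distrib]
  congr 1
  refine Finset.sum_congr rfl fun j hj => ?_
  rw [← Finset.sum_add_distrib]
  refine Finset.sum_congr rfl fun i _ => ?_
  have hj' : j < θ.n := Finset.mem_range.1 hj
  rw [hstep (j + 1) hj' i, hstep j hj'.le i]
  have hmono := θ.τ_mono j ω
  by_cases h1 : θ.τ j ω ≤ gridPt k l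
  · by_cases h2 : gridPt k l < θ.τ (j + 1) ω
    · simp only [h1, h2, and_self, if_true, not_lt.2 h1, if_false]
      ring
    · simp only [h2, and_false, if_false, not_lt.2 h1]
      ring
  · have h1' := not_le.1 h1
    have h2 := h1'.trans_le hmono
    simp only [h1, false_and, if_false, h1', h2, if_true]
    ring

lemma wealth_between {Ω : Type*} {m : MeasurableSpace Ω} {ℱ : Filtration ℝ≥0 m} {d : ℕ}
    (θ : SimpleStrategy ℱ d) (S : ℝ≥0 → Ω → Fin d → ℝ) (x : ℝ) (ω : Ω) (j : ℕ) (hj : j < θ.n)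
    (t : ℝ≥0) (h1 : θ.τ j ω ≤ t) (h2 : t < θ.τ (j + 1) ω) :
    θ.wealth S x t ω = θ.wealth S x (θ.τ j ω) ω +
      ∑ i, θ.ϑ j ω i * (S t ω i - S (θ.τ j ω) ω i) := by
  have hmono : Monotone (fun j => θ.τ j ω) := monotone_nat_of_le_succ fun j => θ.τ_mono j ω
  suffices h : ∑ j' ∈ Finset.range θ.n, ∑ i, (θ.ϑ j' ω i *
      (S (min (θ.τ (j' + 1) ω) t) ω i - S (min (θ.τ j' ω) t) ω i) - θ.ϑ j' ω i *
      (S (min (θ.τ (j' + 1) ω) (θ.τ j ω)) ω i - S (min (θ.τ j' ω) (θ.τ j ω)) ω i))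
      = ∑ i, θ.ϑ j ω i * (S t ω i - S (θ.τ j ω) ω i) by
    rw [← h]
    unfold SimpleStrategy.wealth
    simp only [Finset.sum_sub_distrib]
    ring
  rw [Finset.sum_eq_single j]
  · refine Finset.sum_congr rfl fun i _ => ?_
    rw [min_eq_right h2.le, min_eq_left h1, min_eq_right (h1.trans h2.le), min_self]
    ring
  · intro j' _ hne
    refine Finset.sum_eq_zero fun i _ => ?_
    rcases lt_or_gt_of_ne hne with hlt | hgt
    · have a1 : θ.τ (j' + 1) ω ≤ θ.τ j ω := hmono hlt
      have a2 : θ.τ j' ω ≤ θ.τ j ω := hmono hlt.le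
      rw [min_eq_left a1, min_eq_left a2, min_eq_left (a1.trans h1), min_eq_left (a2.trans h1)]
      ring
    · have a1 : θ.τ (j + 1) ω ≤ θ.τ j' ω := hmono hgt
      have a2 : t ≤ θ.τ j' ω := h2.le.trans a1
      have a3 : θ.τ j' ω ≤ θ.τ (j' + 1) ω := θ.τ_mono j' ω
      rw [min_eq_right a2, min_eq_right (a2.trans a3), min_eq_right (h1.trans a2),
        min_eq_right ((h1.trans a2).trans a3)]
      ring
  · intro h
    exact absurd (Finset.mem_range.2 hj) h

lemma gridHold_eq {Ω : Type*} {m : MeasurableSpace Ω} {ℱ : Filtration ℝ≥0 m} {d : ℕ}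
    (θ : SimpleStrategy ℱ d) (k l : ℕ) (ω : Ω) (j : ℕ) (hj : j < θ.n)
    (h1 : θ.τ j ω ≤ gridPt k l) (h2 : gridPt k l < θ.τ (j + 1) ω) (i : Fin d) :
    gridHold θ k l ω i = θ.ϑ j ω i := by
  have hmono : Monotone (fun j => θ.τ j ω) := monotone_nat_of_le_succ fun j => θ.τ_mono j ω
  unfold gridHold
  rw [Finset.sum_eq_single j]
  · rw [if_pos ⟨h1, h2⟩]
  · intro j' _ hne
    rw [if_neg]
    rintro ⟨b1, b2⟩
    rcases lt_or_gt_of_ne hne with hlt | hgt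
    · have a1 : θ.τ (j' + 1) ω ≤ θ.τ j ω := hmono hlt
      exact absurd (b2.trans_le (a1.trans h1)) (lt_irrefl _)
    · have a1 : θ.τ (j + 1) ω ≤ θ.τ j' ω := hmono hgt
      exact absurd (h2.trans_le (a1.trans b1)) (lt_irrefl _)
  · intro h
    exact absurd (Finset.mem_range.2 hj) h

lemma grid_admissible {Ω : Type*} {m : MeasurableSpace Ω} {ℱ : Filtration ℝ≥0 m} {d : ℕ}
    (P : Measure Ω) (θ : SimpleStrategy ℱ d) (S : ℝ≥0 → Ω → Fin d → ℝ) (k : ℕ)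
    (hS_nonneg : ∀ t ω i, 0 ≤ S t ω i)
    (hgrid : ∀ j ≤ θ.n, ∀ ω, θ.τ j ω ∈ dyadicGrid k) (hadm : θ.Admissible P S 1) :
    ∀ᵐ ω ∂P, ∀ l, 0 ≤ θ.wealth S 1 (gridPt k l) ω ∧ (∀ i, 0 ≤ gridHold θ k l ω i) ∧
      ∑ i, gridHold θ k l ω i * S (gridPt k l) ω i ≤ θ.wealth S 1 (gridPt k l) ω := by
  have hall : ∀ᵐ ω ∂P, ∀ j, j < θ.n → (∀ i, 0 ≤ θ.ϑ j ω i) ∧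
      ∑ i, θ.ϑ j ω i * S (θ.τ j ω) ω i ≤ θ.wealth S 1 (θ.τ j ω) ω := by
    rw [ae_all_iff]
    intro j
    by_cases hj : j < θ.n
    · filter_upwards [hadm j hj] with ω hω _ using hω
    · exact ae_of_all _ fun ω h => absurd h hj
  filter_upwards [hall] with ω hω
  have key : ∀ l, 0 ≤ θ.wealth S 1 (gridPt k l) ω → (∀ i, 0 ≤ gridHold θ k l ω i) ∧
      ∑ i, gridHold θ k l ω i * S (gridPt k l) ω i ≤ θ.wealth S 1 (gridPt k l) ω := by
    intro l hl
    by_cases hex : ∃ j < θ.n, θ.τ j ω ≤ gridPt k l ∧ gridPt k l < θ.τ (j + 1) ω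
    · obtain ⟨j, hj, h1, h2⟩ := hex
      simp only [gridHold_eq θ k l ω j hj h1 h2]
      refine ⟨(hω j hj).1, ?_⟩
      rw [wealth_between θ S 1 ω j hj _ h1 h2]
      have h3 := (hω j hj).2
      simp only [mul_sub, Finset.sum_sub_distrib]
      linarith
    · have h0 : ∀ i, gridHold θ k l ω i = 0 := by
        intro i
        refine Finset.sum_eq_zero fun j hj => ?_
        rw [if_neg]
        intro h
        exact hex ⟨j, Finset.mem_range.1 hj, h⟩
      simp only [h0]
      refine ⟨fun _ => le_rfl, ?_⟩
      simpa using hl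
  have hnn : ∀ l, 0 ≤ θ.wealth S 1 (gridPt k l) ω := by
    intro l
    induction l with
    | zero =>
      rw [gridPt_zero, wealth_zero]
      exact zero_le_one
    | succ l ih =>
      rw [wealth_step θ S 1 k l hgrid ω]
      obtain ⟨h1, h2⟩ := key l ih
      simp only [mul_sub, Finset.sum_sub_distrib]
      have h3 : 0 ≤ ∑ i, gridHold θ k l ω i * S (gridPt k (l + 1)) ω i :=
        Finset.sum_nonneg fun i _ => mul_nonneg (h1 i) (hS_nonneg _ ω i)
      linarith
  exact fun l => ⟨hnn l, key l (hnn l)⟩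

lemma measurable_wealth_grid {Ω : Type*} {m : MeasurableSpace Ω} {ℱ : Filtration ℝ≥0 m} {d : ℕ}
    (θ : SimpleStrategy ℱ d) (S : ℝ≥0 → Ω → Fin d → ℝ) (k : ℕ)
    (hS_adapted : StronglyAdapted ℱ S)
    (hgrid : ∀ j ≤ θ.n, ∀ ω, θ.τ j ω ∈ dyadicGrid k) (l : ℕ) :
    Measurable[ℱ (gridPt k l)] (θ.wealth S 1 (gridPt k l)) := by
  have hSm : ∀ r i, Measurable[ℱ r] (fun ω => S r ω i) := fun r i =>
    (@measurable_pi_apply _ _ _ i).comp (hS_adapted r).measurable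
  induction l with
  | zero =>
    have : θ.wealth S 1 (gridPt k 0) = fun _ => 1 := by
      funext ω
      rw [gridPt_zero, wealth_zero]
    rw [this]
    exact measurable_const
  | succ l ih =>
    have hle : ℱ (gridPt k l) ≤ ℱ (gridPt k (l + 1)) :=
      ℱ.mono ((gridPt_le_iff _ _ _).2 (Nat.le_succ l))
    have : θ.wealth S 1 (gridPt k (l + 1)) = fun ω => θ.wealth S 1 (gridPt k l) ω +
      ∑ i, gridHold θ k l ω i * (S (gridPt k (l + 1)) ω i - S (gridPt k l) ω i) := by
      funext ω
      exact wealth_step θ S 1 k l hgrid ω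
    rw [this]
    refine (ih.mono hle le_rfl).add (Finset.measurable_sum _ fun i _ => ?_)
    exact ((measurable_gridHold θ k l i).mono hle le_rfl).mul
      ((hSm _ i).sub ((hSm _ i).mono hle le_rfl))

lemma condExp_le_of_lintegral {Ω : Type*} (G : MeasurableSpace Ω) {m : MeasurableSpace Ω}
    (hG : G ≤ m) (P : Measure Ω) [IsProbabilityMeasure P] (f g : Ω → ℝ)
    (hf : Measurable f) (hg : Measurable[G] g) (hf0 : 0 ≤ᵐ[P] f) (hg0 : 0 ≤ᵐ[P] g)
    (hfin : ∫⁻ ω, ENNReal.ofReal (g ω) ∂P ≠ ⊤)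
    (hle : ∀ A, MeasurableSet[G] A →
      ∫⁻ ω in A, ENNReal.ofReal (f ω) ∂P ≤ ∫⁻ ω in A, ENNReal.ofReal (g ω) ∂P) :
    ∀ᵐ ω ∂P, (P[f|G]) ω ≤ g ω := by
  have hgi : Integrable g P :=
    (lintegral_ofReal_ne_top_iff_integrable (hg.mono hG le_rfl).aestronglyMeasurable hg0).1 hfin
  have hfi : Integrable f P := by
    refine (lintegral_ofReal_ne_top_iff_integrable hf.aestronglyMeasurable hf0).1 ?_
    have := hle Set.univ MeasurableSet.univ
    simp only [Measure.restrict_univ] at this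
    exact (this.trans_lt (lt_top_iff_ne_top.2 hfin)).ne
  refine ae_le_of_ae_le_trim (hm := hG) ?_
  have hgs : StronglyMeasurable[G] g := hg.stronglyMeasurable
  have hcs : StronglyMeasurable[G] (P[f|G]) := stronglyMeasurable_condExp
  refine ae_le_of_forall_setIntegral_le (integrable_condExp.trim hG hcs) (hgi.trim hG hgs) ?_
  intro A hA _
  rw [← setIntegral_trim hG hcs hA, ← setIntegral_trim hG hgs hA, setIntegral_condExp hG hfi hA]
  rw [integral_eq_lintegral_of_nonneg_ae (ae_restrict_of_ae hf0) hf.aestronglyMeasurable,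
    integral_eq_lintegral_of_nonneg_ae (ae_restrict_of_ae hg0)
      (hg.mono hG le_rfl).aestronglyMeasurable]
  refine ENNReal.toReal_mono ?_ (hle A hA)
  exact ((setLIntegral_le_lintegral A _).trans_lt (lt_top_iff_ne_top.2 hfin)).ne

/-- Gross returns on the grid interval `(l, l+1]`; `none` is cash. -/
def gridRet {Ω : Type*} {d : ℕ} (S : ℝ≥0 → Ω → Fin d → ℝ) (k l : ℕ) (o : Option (Fin d)) (ω : Ω) :
    ℝ :=
  o.elim 1 fun i =>
    if S (gridPt k l) ω i = 0 then 1 else S (gridPt k (l + 1)) ω i / S (gridPt k l) ω i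

lemma measurable_gridRet {Ω : Type*} {m : MeasurableSpace Ω} {ℱ : Filtration ℝ≥0 m} {d : ℕ}
    (S : ℝ≥0 → Ω → Fin d → ℝ) (hS_adapted : StronglyAdapted ℱ S) (k l : ℕ)
    (o : Option (Fin d)) : Measurable[ℱ (gridPt k (l + 1))] (gridRet S k l o) := by
  classical
  have hSm : ∀ r i, Measurable[ℱ r] (fun ω => S r ω i) := fun r i =>
    (@measurable_pi_apply _ _ _ i).comp (hS_adapted r).measurable
  have hle : ℱ (gridPt k l) ≤ ℱ (gridPt k (l + 1)) :=
    ℱ.mono ((gridPt_le_iff _ _ _).2 (Nat.le_succ l))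
  cases o with
  | none => exact measurable_const
  | some i =>
    have h1 := (hSm (gridPt k l) i).mono hle le_rfl
    have h2 : MeasurableSet[ℱ (gridPt k (l + 1))] {ω | S (gridPt k l) ω i = 0} :=
      h1 (measurableSet_singleton 0)
    exact Measurable.ite h2 measurable_const ((hSm _ i).div h1)

lemma gridRet_nonneg {Ω : Type*} {d : ℕ} (S : ℝ≥0 → Ω → Fin d → ℝ)
    (hS_nonneg : ∀ t ω i, 0 ≤ S t ω i) (k l : ℕ) (o : Option (Fin d)) (ω : Ω) :
    0 ≤ gridRet S k l o ω := by
  cases o with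
  | none => exact zero_le_one
  | some i =>
    simp only [gridRet, Option.elim]
    split_ifs
    · exact zero_le_one
    · exact div_nonneg (hS_nonneg _ _ _) (hS_nonneg _ _ _)

/-- The one-step supermartingale inequality. -/
lemma step_ineq {Ω : Type*} (G : MeasurableSpace Ω) {m : MeasurableSpace Ω} (hG : G ≤ m)
    (P : Measure Ω) {ι : Type*} [Fintype ι] (r : ι → Ω → ℝ)
    (hrm : ∀ o, Measurable (r o)) (hr0 : ∀ o ω, 0 ≤ r o ω)
    (hr : ∀ o, ∀ c : Ω → ℝ≥0∞, Measurable[G] c →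
        ∫⁻ ω, c ω * ENNReal.ofReal (r o ω) ∂P ≤ ∫⁻ ω, c ω ∂P)
    (C : ι → Ω → ℝ) (hCm : ∀ o, Measurable[G] (C o)) (hC0 : ∀ᵐ ω ∂P, ∀ o, 0 ≤ C o ω)
    (A : Set Ω) (hA : MeasurableSet[G] A) :
    ∫⁻ ω in A, ENNReal.ofReal (∑ o, C o ω * r o ω) ∂P
      ≤ ∫⁻ ω in A, ENNReal.ofReal (∑ o, C o ω) ∂P := by
  have hAm : MeasurableSet A := hG _ hA
  have e1 : ∫⁻ ω in A, ENNReal.ofReal (∑ o, C o ω * r o ω) ∂P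
      = ∫⁻ ω in A, ∑ o, ENNReal.ofReal (C o ω) * ENNReal.ofReal (r o ω) ∂P := by
    refine lintegral_congr_ae (ae_restrict_of_ae ?_)
    filter_upwards [hC0] with ω hω
    rw [ENNReal.ofReal_sum_of_nonneg fun o _ => mul_nonneg (hω o) (hr0 o ω)]
    exact Finset.sum_congr rfl fun o _ => ENNReal.ofReal_mul (hω o)
  have e2 : ∫⁻ ω in A, ENNReal.ofReal (∑ o, C o ω) ∂P
      = ∫⁻ ω in A, ∑ o, ENNReal.ofReal (C o ω) ∂P := by
    refine lintegral_congr_ae (ae_restrict_of_ae ?_)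
    filter_upwards [hC0] with ω hω
    rw [ENNReal.ofReal_sum_of_nonneg fun o _ => hω o]
  have hCm' : ∀ o, Measurable (fun ω => ENNReal.ofReal (C o ω)) := fun o =>
    ((hCm o).mono hG le_rfl).ennreal_ofReal
  have hprod : ∀ o, Measurable (fun ω => ENNReal.ofReal (C o ω) * ENNReal.ofReal (r o ω)) :=
    fun o => (hCm' o).mul (hrm o).ennreal_ofReal
  rw [e1, e2, lintegral_finsetSum _ fun o _ => hprod o,
    lintegral_finsetSum _ fun o _ => hCm' o]
  refine Finset.sum_le_sum fun o _ => ?_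
  have h := hr o (A.indicator fun ω => ENNReal.ofReal (C o ω))
    ((hCm o).ennreal_ofReal.indicator hA)
  rw [lintegral_indicator hAm] at h
  refine le_trans (le_of_eq ?_) h
  rw [← lintegral_indicator hAm]
  refine lintegral_congr fun ω => ?_
  by_cases hω : ω ∈ A <;> simp [hω]

/-- **Lemma 2.2.** Under NA1_s, for each `k` there is a "num\'eraire portfolio" `X̃ ∈ 𝒳_s^k(1)`,
positive at all times of `𝕋^k`, such that `Ỹ := 1/X̃` deflates every `X ∈ 𝒳_s^k(1)` into a
supermartingale along the grid `𝕋^k`. -/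
theorem exists_discrete_numeraire
    {Ω : Type*} {m : MeasurableSpace Ω} (P : MeasureTheory.Measure Ω)
    [MeasureTheory.IsProbabilityMeasure P] (ℱ : MeasureTheory.Filtration ℝ≥0 m)
    (hright : RightContinuousFiltration ℱ) (hcompl : CompleteFiltration ℱ P)
    (d : ℕ) (S : ℝ≥0 → Ω → Fin d → ℝ)
    (hS_adapted : MeasureTheory.StronglyAdapted ℱ S)
    (hS_cadlag : ∀ ω, IsCadlag (fun t => S t ω))
    (hS_nonneg : ∀ t ω i, 0 ≤ S t ω i)
    (hNA1 : NA1s P ℱ S) (k : ℕ) :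
    ∃ Xnum ∈ Xsk P ℱ S k,
      (∀ t ∈ dyadicGrid k, ∀ᵐ ω ∂P, 0 < Xnum t ω) ∧
      ∀ X ∈ Xsk P ℱ S k, ∀ s ∈ dyadicGrid k, ∀ t ∈ dyadicGrid k, s ≤ t →
        ∀ᵐ ω ∂P, (P[fun ω => (Xnum t ω)⁻¹ * X t ω|ℱ s]) ω ≤ (Xnum s ω)⁻¹ * X s ω := by
  classical
  have hSm : ∀ r i, Measurable[ℱ r] (fun ω => S r ω i) := fun r i =>
    (@measurable_pi_apply _ _ _ i).comp (hS_adapted r).measurable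
  have hsum : ∀ l ω, 0 < ∑ o, gridRet S k l o ω := by
    intro l ω
    rw [Fintype.sum_option]
    have h1 : gridRet S k l none ω = 1 := rfl
    have h2 : 0 ≤ ∑ i, gridRet S k l (some i) ω :=
      Finset.sum_nonneg fun i _ => gridRet_nonneg S hS_nonneg k l (some i) ω
    rw [h1]
    linarith
  have hone : ∀ l, ∃ w : Option (Fin d) → Ω → ℝ, IsWeight (ℱ (gridPt k l)) w ∧
      (∀ᵐ ω ∂P, 0 < ∑ o, w o ω * gridRet S k l o ω) ∧
      ∀ o, ∀ c : Ω → ℝ≥0∞, Measurable[ℱ (gridPt k l)] c →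
        ∫⁻ ω, c ω * ENNReal.ofReal (gridRet S k l o ω / ∑ j, w j ω * gridRet S k l j ω) ∂P
          ≤ ∫⁻ ω, c ω ∂P := fun l =>
    exists_one_period (ℱ (gridPt k l)) (ℱ.le _) P (gridRet S k l)
      (fun o => (measurable_gridRet S hS_adapted k l o).mono (ℱ.le _) le_rfl)
      (gridRet_nonneg S hS_nonneg k l) (hsum l)
  choose w hw hwpos hwint using hone
  set V : ℕ → Ω → ℝ := fun l ω => ∑ o, w l o ω * gridRet S k l o ω with hV
  have hmonoF : ∀ a b, a ≤ b → ℱ (gridPt k a) ≤ ℱ (gridPt k b) := fun a b h =>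
    ℱ.mono ((gridPt_le_iff _ _ _).2 h)
  have hVm : ∀ l, Measurable[ℱ (gridPt k (l + 1))] (V l) := fun l =>
    Finset.measurable_sum _ fun o _ => (((hw l).1 o).mono (hmonoF l (l + 1) (Nat.le_succ l))
      le_rfl).mul (measurable_gridRet S hS_adapted k l o)
  have hV0 : ∀ l ω, 0 ≤ V l ω := fun l ω => Finset.sum_nonneg fun o _ =>
    mul_nonneg ((hw l).2.1 o ω) (gridRet_nonneg S hS_nonneg k l o ω)
  set W : ℕ → Ω → ℝ := fun l ω => ∏ j ∈ Finset.range l, V j ω with hW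
  have hWsucc : ∀ l ω, W (l + 1) ω = W l ω * V l ω := fun l ω => Finset.prod_range_succ _ _
  have hWm : ∀ l, Measurable[ℱ (gridPt k l)] (W l) := fun l =>
    Finset.measurable_prod _ fun j hj =>
      (hVm j).mono (hmonoF (j + 1) l (Finset.mem_range.1 hj)) le_rfl
  have hW0 : ∀ l ω, 0 ≤ W l ω := fun l ω => Finset.prod_nonneg fun j _ => hV0 j ω
  have hVpos : ∀ᵐ ω ∂P, ∀ l, 0 < V l ω := ae_all_iff.2 hwpos
  have hWpos : ∀ᵐ ω ∂P, ∀ l, 0 < W l ω := by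
    filter_upwards [hVpos] with ω hω l
    exact Finset.prod_pos fun j _ => hω j
  -- the numéraire strategy
  let θ : SimpleStrategy ℱ d :=
    { n := k * 2 ^ k
      τ := fun j _ => gridPt k j
      ϑ := fun j ω i => W j ω * w j (some i) ω / S (gridPt k j) ω i
      τ_zero := fun ω => gridPt_zero k
      τ_mono := fun j ω => (gridPt_le_iff _ _ _).2 (Nat.le_succ j)
      τ_stopping := fun j => isStoppingTime_const ℱ (gridPt k j)
      ϑ_meas := by
        intro j
        have e := IsStoppingTime.measurableSpace_const ℱ (gridPt k j)
        refine Measurable.mono ?_ e.ge le_rfl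
        refine @measurable_pi_lambda _ _ _ (ℱ (gridPt k j)) _ _ fun i => ?_
        exact ((hWm j).mul ((hw j).1 (some i))).div (hSm _ i) }
  have hθgrid : ∀ j ≤ θ.n, ∀ ω, θ.τ j ω ∈ dyadicGrid k := fun j hj ω => ⟨j, hj, rfl⟩
  have hθhold : ∀ l < k * 2 ^ k, ∀ ω i,
      gridHold θ k l ω i = W l ω * w l (some i) ω / S (gridPt k l) ω i := by
    intro l hl ω i
    exact gridHold_eq θ k l ω l hl le_rfl ((gridPt_lt_iff _ _ _).2 (Nat.lt_succ_self l)) i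
  have hθW : ∀ l ≤ k * 2 ^ k, ∀ ω, θ.wealth S 1 (gridPt k l) ω = W l ω := by
    intro l
    induction l with
    | zero =>
      intro _ ω
      rw [gridPt_zero, wealth_zero]
      simp [hW]
    | succ l ih =>
      intro hl ω
      have hl' : l < k * 2 ^ k := hl
      rw [wealth_step θ S 1 k l hθgrid ω, ih hl'.le ω, hWsucc]
      have e1 : ∀ i, gridHold θ k l ω i * (S (gridPt k (l + 1)) ω i - S (gridPt k l) ω i)
          = W l ω * (w l (some i) ω * gridRet S k l (some i) ω - w l (some i) ω) := by
        intro i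
        rw [hθhold l hl' ω i]
        simp only [gridRet, Option.elim]
        by_cases h0 : S (gridPt k l) ω i = 0
        · simp [h0]
        · simp only [if_neg h0]
          field_simp
      simp only [e1]
      rw [← Finset.mul_sum, Finset.sum_sub_distrib]
      have e2 : V l ω = w l none ω + ∑ i, w l (some i) ω * gridRet S k l (some i) ω := by
        simp only [hV]
        rw [Fintype.sum_option]
        simp [gridRet]
      have e3 := (hw l).2.2 ω
      rw [Fintype.sum_option] at e3
      rw [e2, ← sub_eq_of_eq_add' e3.symm]
      ring
  have hθadm : θ.Admissible P S 1 := by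
    intro j hj
    refine ae_of_all _ fun ω => ⟨fun i => ?_, ?_⟩
    · exact div_nonneg (mul_nonneg (hW0 j ω) ((hw j).2.1 (some i) ω)) (hS_nonneg _ ω i)
    · have hτ : θ.τ j ω = gridPt k j := rfl
      have hj' : j < k * 2 ^ k := hj
      rw [hτ, hθW j hj'.le ω]
      have e3 := (hw j).2.2 ω
      rw [Fintype.sum_option] at e3
      calc ∑ i, θ.ϑ j ω i * S (gridPt k j) ω i ≤ ∑ i, W j ω * w j (some i) ω := by
            refine Finset.sum_le_sum fun i _ => ?_
            have hϑ : θ.ϑ j ω i = W j ω * w j (some i) ω / S (gridPt k j) ω i := rfl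
            rw [hϑ]
            by_cases h0 : S (gridPt k j) ω i = 0
            · rw [h0]
              simpa using mul_nonneg (hW0 j ω) ((hw j).2.1 (some i) ω)
            · rw [div_mul_cancel₀ _ h0]
        _ = W j ω * ∑ i, w j (some i) ω := by rw [Finset.mul_sum]
        _ ≤ W j ω * 1 := by
            refine mul_le_mul_of_nonneg_left ?_ (hW0 j ω)
            linarith [(hw j).2.1 none ω]
        _ = W j ω := mul_one _
  refine ⟨θ.wealth S 1, ⟨θ, hθadm, hθgrid, rfl⟩, ?_, ?_⟩
  · rintro t ⟨l, hl, rfl⟩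
    filter_upwards [hWpos] with ω hω
    exact (hθW l hl ω).symm ▸ hω l
  rintro X ⟨η, hηadm, hηgrid, rfl⟩ s ⟨a, ha, rfl⟩ t ⟨b, hb, rfl⟩ hst
  have hab : a ≤ b := (gridPt_le_iff k a b).1 hst
  set x : ℕ → Ω → ℝ := fun l => η.wealth S 1 (gridPt k l) with hx
  have hxm : ∀ l, Measurable[ℱ (gridPt k l)] (x l) := fun l =>
    measurable_wealth_grid η S k hS_adapted hηgrid l
  have hxadm := grid_admissible P η S k hS_nonneg hηgrid hηadm
  have hrev : ∀ᵐ ω ∂P, ∀ l i, S (gridPt k l) ω i = 0 → S (gridPt k (l + 1)) ω i = 0 := by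
    rw [ae_all_iff]
    intro l
    rw [ae_all_iff]
    intro i
    exact no_revival P ℱ d S hS_adapted hS_nonneg hNA1 _ _
      ((gridPt_le_iff _ _ _).2 (Nat.le_succ l)) i
  have hstep : ∀ l, ∀ A, MeasurableSet[ℱ (gridPt k l)] A →
      ∫⁻ ω in A, ENNReal.ofReal ((W (l + 1) ω)⁻¹ * x (l + 1) ω) ∂P
        ≤ ∫⁻ ω in A, ENNReal.ofReal ((W l ω)⁻¹ * x l ω) ∂P := by
    intro l A hA
    set H : Ω → Fin d → ℝ := gridHold η k l with hH
    have hHm : ∀ i, Measurable[ℱ (gridPt k l)] (fun ω => H ω i) := measurable_gridHold η k l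
    let C : Option (Fin d) → Ω → ℝ := fun o ω =>
      o.elim ((W l ω)⁻¹ * (x l ω - ∑ i, H ω i * S (gridPt k l) ω i))
        fun i => (W l ω)⁻¹ * (H ω i * S (gridPt k l) ω i)
    have hCm : ∀ o, Measurable[ℱ (gridPt k l)] (C o) := by
      intro o
      cases o with
      | none =>
        exact (hWm l).inv.mul ((hxm l).sub
          (Finset.measurable_sum _ fun i _ => (hHm i).mul (hSm _ i)))
      | some i => exact (hWm l).inv.mul ((hHm i).mul (hSm _ i))
    have hC0 : ∀ᵐ ω ∂P, ∀ o, 0 ≤ C o ω := by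
      filter_upwards [hxadm] with ω hω o
      obtain ⟨h1, h2, h3⟩ := hω l
      cases o with
      | none => exact mul_nonneg (inv_nonneg.2 (hW0 l ω)) (sub_nonneg.2 h3)
      | some i =>
        exact mul_nonneg (inv_nonneg.2 (hW0 l ω)) (mul_nonneg (h2 i) (hS_nonneg _ ω i))
    have hmain := step_ineq (ℱ (gridPt k l)) (ℱ.le _) P
      (fun o ω => gridRet S k l o ω / V l ω)
      (fun o => ((measurable_gridRet S hS_adapted k l o).div (hVm l)).mono (ℱ.le _) le_rfl)
      (fun o ω => div_nonneg (gridRet_nonneg S hS_nonneg k l o ω) (hV0 l ω))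
      (hwint l) C hCm hC0 A hA
    have e1 : ∫⁻ ω in A, ENNReal.ofReal ((W (l + 1) ω)⁻¹ * x (l + 1) ω) ∂P
        = ∫⁻ ω in A, ENNReal.ofReal (∑ o, C o ω * (gridRet S k l o ω / V l ω)) ∂P := by
      refine lintegral_congr_ae (ae_restrict_of_ae ?_)
      filter_upwards [hrev] with ω hω
      congr 1
      have hSR : ∀ i, S (gridPt k (l + 1)) ω i
          = S (gridPt k l) ω i * gridRet S k l (some i) ω := by
        intro i
        simp only [gridRet, Option.elim]
        by_cases h0 : S (gridPt k l) ω i = 0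
        · simp [h0, hω l i h0]
        · simp only [if_neg h0]
          field_simp
      have hxs : x (l + 1) ω = x l ω + ∑ i, H ω i *
          (S (gridPt k (l + 1)) ω i - S (gridPt k l) ω i) := wealth_step η S 1 k l hηgrid ω
      rw [hxs, hWsucc, Fintype.sum_option, mul_inv]
      simp only [C, Option.elim]
      have hn : gridRet S k l none ω = 1 := rfl
      rw [hn]
      have e4 : ∑ i, (W l ω)⁻¹ * (H ω i * S (gridPt k l) ω i) * (gridRet S k l (some i) ω / V l ω)
          = (W l ω)⁻¹ * (V l ω)⁻¹ * ∑ i, H ω i * S (gridPt k (l + 1)) ω i := by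
        rw [Finset.mul_sum]
        refine Finset.sum_congr rfl fun i _ => ?_
        rw [hSR i, div_eq_mul_inv]
        ring
      rw [e4]
      simp only [mul_sub, Finset.sum_sub_distrib, div_eq_mul_inv]
      ring
    have e2 : ∫⁻ ω in A, ENNReal.ofReal ((W l ω)⁻¹ * x l ω) ∂P
        = ∫⁻ ω in A, ENNReal.ofReal (∑ o, C o ω) ∂P := by
      refine lintegral_congr fun ω => ?_
      congr 1
      rw [Fintype.sum_option]
      simp only [C, Option.elim]
      rw [← Finset.mul_sum]
      ring
    rw [e1, e2]
    exact hmain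
  have hiter : ∀ p q, p ≤ q → ∀ A, MeasurableSet[ℱ (gridPt k p)] A →
      ∫⁻ ω in A, ENNReal.ofReal ((W q ω)⁻¹ * x q ω) ∂P
        ≤ ∫⁻ ω in A, ENNReal.ofReal ((W p ω)⁻¹ * x p ω) ∂P := by
    intro p q hpq A hA
    induction q, hpq using Nat.le_induction with
    | base => exact le_rfl
    | succ q hpq ih => exact (hstep q A (hmonoF p q hpq A hA)).trans ih
  have hnn : ∀ l, 0 ≤ᵐ[P] fun ω => (W l ω)⁻¹ * x l ω := by
    intro l
    filter_upwards [hxadm] with ω hω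
    exact mul_nonneg (inv_nonneg.2 (hW0 l ω)) (hω l).1
  have hfin : ∫⁻ ω, ENNReal.ofReal ((W a ω)⁻¹ * x a ω) ∂P ≠ ⊤ := by
    have h := hiter 0 a (Nat.zero_le a) Set.univ MeasurableSet.univ
    simp only [Measure.restrict_univ] at h
    refine (h.trans_lt ?_).ne
    have h1 : ∀ ω, (W 0 ω)⁻¹ * x 0 ω = 1 := by
      intro ω
      simp only [hx, gridPt_zero, wealth_zero]
      simp [hW]
    simp [h1]
  have hfinal := condExp_le_of_lintegral (ℱ (gridPt k a)) (ℱ.le _) P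
    (fun ω => (W b ω)⁻¹ * x b ω) (fun ω => (W a ω)⁻¹ * x a ω)
    (((hWm b).inv.mul (hxm b)).mono (ℱ.le _) le_rfl) ((hWm a).inv.mul (hxm a)) (hnn b) (hnn a)
    hfin (hiter a b hab)
  have eb : θ.wealth S 1 (gridPt k b) = W b := funext (hθW b hb)
  have ea : θ.wealth S 1 (gridPt k a) = W a := funext (hθW a ha)
  change ∀ᵐ ω ∂P, (P[fun ω => (θ.wealth S 1 (gridPt k b) ω)⁻¹ * x b ω|ℱ (gridPt k a)]) ω
    ≤ (θ.wealth S 1 (gridPt k a) ω)⁻¹ * x a ω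
  rw [eb, ea]
  exact hfinal

end
end
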